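/- arXiv:2511.22140 — 3 statements merged into one kernel-verified Lean document; each statement's English description precedes it below -/
import Mathlib

section
/- Let D = (V,E) be an r-rooted digraph (possibly infinite) and v ∈ V \ {r}. For every v-linked set X and every I ∈ G_D(v), there exists a family R = {R_e : e ∈ δ_D(X)} of pairwise edge-disjoint paths witnessing that X is v-linked such that the paths in R cover I (every edge of I lies on some path in R). -/
/-- A digraph on vertex type `V` with edge type `E` (parallel edges allowed, no loops). -/
structure MultiDigraph (V : Type*) (E : Type*) where
  tail : E → V
  head : E → V
  no_loops : ∀ e, tail e ≠ head e

namespace MultiDigraph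

variable {V E : Type*}

/-- `p` is a (finite) directed path from `s` to `t` in the spanning subdigraph `D(L)`,
identified with its list of edges (consecutive edges are incident, visited vertices
are pairwise distinct). -/
def IsPathIn (D : MultiDigraph V E) (L : Set E) (s t : V) (p : List E) : Prop :=
  ∃ hne : p ≠ [],
    D.tail (p.head hne) = s ∧
    D.head (p.getLast hne) = t ∧
    p.Chain' (fun e f => D.head e = D.tail f) ∧
    (s :: p.map D.head).Nodup ∧
    ∀ e ∈ p, e ∈ L

/-- `δ_{D(L)}(v)`: the set of ingoing edges of `v` lying in `L`. -/
def delta (D : MultiDigraph V E) (L : Set E) (v : V) : Set E :=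
  {e | e ∈ L ∧ D.head e = v}

/-- `δ_{D(L)}(X)`: the set of edges of `D(L)` entering the vertex set `X`
(tail outside `X`, head inside `X`). -/
def edgesInto (D : MultiDigraph V E) (L : Set E) (X : Set V) : Set E :=
  {e | e ∈ L ∧ D.tail e ∉ X ∧ D.head e ∈ X}

/-- `I ∈ 𝒢_{D(L)}(v)`: `I` is a set of ingoing edges of `v` in `D(L)` for which
there is a set of pairwise edge-disjoint `r`–`v` paths of `D(L)` covering `I`. -/
def MemGv (D : MultiDigraph V E) (L : Set E) (r v : V) (I : Set E) : Prop :=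
  I ⊆ D.delta L v ∧
  ∃ Ps : Set (List E),
    (∀ p ∈ Ps, D.IsPathIn L r v p) ∧
    Ps.Pairwise (fun p q => p.Disjoint q) ∧
    ∀ e ∈ I, ∃ p ∈ Ps, e ∈ p

/-- `L' ∈ 𝒢(D(L))`: `L'` is a union `⋃_{v ≠ r} I_v` with `I_v ∈ 𝒢_{D(L)}(v)`;
equivalently, every edge of `L'` has head distinct from `r` and for each `v ≠ r`
the set of ingoing edges of `v` in `L'` belongs to `𝒢_{D(L)}(v)`. -/
def MemG (D : MultiDigraph V E) (L : Set E) (r : V) (L' : Set E) : Prop :=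
  L' ⊆ L ∧ (∀ e ∈ L', D.head e ≠ r) ∧
    ∀ v, v ≠ r → D.MemGv L r v (D.delta L' v)

/-- `F` is a flame: `F ∈ 𝒢(D(F))`. -/
def IsFlame (D : MultiDigraph V E) (r : V) (F : Set E) : Prop :=
  D.MemG F r F

/-- `C` is a transversal of the set `Ps` of paths: `C` consists of exactly one
edge from each path in `Ps`. -/
def IsTransversal (Ps : Set (List E)) (C : Set E) : Prop :=
  (∀ p ∈ Ps, ∃! e, e ∈ C ∧ e ∈ p) ∧ ∀ e ∈ C, ∃ p ∈ Ps, e ∈ p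

/-- `C` is an `s`–`t` cut in `D(L)`: every `s`–`t` path of `D(L)` meets `C`. -/
def IsCut (D : MultiDigraph V E) (L : Set E) (s t : V) (C : Set E) : Prop :=
  ∀ p, D.IsPathIn L s t p → ∃ e ∈ p, e ∈ C

/-- `L` is large at `v`: `D(L)` admits a set `Ps` of pairwise edge-disjoint
`r`–`v` paths together with a transversal of `Ps` that is an `r`–`v` cut in `D`. -/
def LargeAt (D : MultiDigraph V E) (r v : V) (L : Set E) : Prop :=
  ∃ (Ps : Set (List E)) (C : Set E),
    (∀ p ∈ Ps, D.IsPathIn L r v p) ∧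
    Ps.Pairwise (fun p q => p.Disjoint q) ∧
    IsTransversal Ps C ∧
    D.IsCut Set.univ r v C

/-- `L` is large: it is large at every `v ≠ r`. -/
def Large (D : MultiDigraph V E) (r : V) (L : Set E) : Prop :=
  ∀ v, v ≠ r → D.LargeAt r v L

/-- `D` contains a directed cycle. -/
def HasCycle (D : MultiDigraph V E) : Prop :=
  ∃ (p : List E) (hne : p ≠ []),
    p.Chain' (fun e f => D.head e = D.tail f) ∧
    D.head (p.getLast hne) = D.tail (p.head hne) ∧
    (p.map D.head).Nodup

/-- `D` contains a backward-infinite path: edges `…, f 2, f 1, f 0` (with `f 0` the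
last edge, so the path has a final vertex `D.head (f 0)` but no first vertex); the
visited vertices `D.head (f n)` are pairwise distinct. -/
def HasBackwardInfinitePath (D : MultiDigraph V E) : Prop :=
  ∃ f : ℕ → E,
    (∀ n, D.tail (f n) = D.head (f (n + 1))) ∧
    Function.Injective (fun n => D.head (f n))

/-- `X ⊆ V \ {r}` is `v`-linked in `D(L)`: `v ∈ X` and there is a family
`{P e : e ∈ δ_{D(L)}(X)}` of pairwise edge-disjoint paths of `D(L)`, where `P e`
has `e` as its initial edge and `v` as its terminal vertex. -/
def VLinked (D : MultiDigraph V E) (L : Set E) (r v : V) (X : Set V) : Prop :=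
  r ∉ X ∧ v ∈ X ∧
  ∃ P : E → List E,
    (∀ e ∈ D.edgesInto L X, D.IsPathIn L (D.tail e) v (P e) ∧ (P e).head? = some e) ∧
    (D.edgesInto L X).Pairwise (fun e f => (P e).Disjoint (P f))

/-- `p` is an `r`–`X` path in `D(L)`: a path starting at `r` meeting `X` exactly
in its last vertex. -/
def IsRXPathIn (D : MultiDigraph V E) (L : Set E) (r : V) (X : Set V) (p : List E) : Prop :=
  ∃ hne : p ≠ [],
    D.tail (p.head hne) = r ∧
    D.head (p.getLast hne) ∈ X ∧
    (∀ e ∈ p.dropLast, D.head e ∉ X) ∧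
    p.Chain' (fun e f => D.head e = D.tail f) ∧
    (r :: p.map D.head).Nodup ∧
    ∀ e ∈ p, e ∈ L

/-- `X` is fillable in `D(L)`: there is a set `Ps` of pairwise edge-disjoint
`r`–`X` paths in `D(L)` whose set of terminal edges is exactly `δ_{D(L)}(X)`. -/
def Fillable (D : MultiDigraph V E) (L : Set E) (r : V) (X : Set V) : Prop :=
  ∃ Ps : Set (List E),
    (∀ p ∈ Ps, D.IsRXPathIn L r X p) ∧
    Ps.Pairwise (fun p q => p.Disjoint q) ∧
    {e | ∃ p ∈ Ps, p.getLast? = some e} = D.edgesInto L X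

end MultiDigraph

/-- Existence of stable matchings: elements of `J` are potential matches between their `c`-label and
their `d`-label, and smaller values of `ρ` and `σ` are preferred. -/
theorem exists_stable_matching {E α β : Type*} (J : Set E) (c : E → α) (d : E → β) (ρ σ : E → ℕ) :
    ∃ M ⊆ J, (∀ e ∈ M, ∀ f ∈ M, c e = c f → ρ e = ρ f) ∧
      (∀ e ∈ M, ∀ f ∈ M, d e = d f → σ e = σ f) ∧
      ∀ e ∈ J, (∃ m ∈ M, c m = c e ∧ ρ m ≤ ρ e) ∨ (∃ m ∈ M, d m = d e ∧ σ m < σ e) := by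
  let rejC : Set E → Set E := fun A => {e | e ∈ A ∧ ∃ f ∈ A, c f = c e ∧ ρ f < ρ e}
  let rejD : Set E → Set E := fun A => {e | e ∈ A ∧ ∃ f ∈ A, d f = d e ∧ σ f < σ e}
  have hC : Monotone rejC := by
    rintro A B h e ⟨he, f, hf, h1⟩
    exact ⟨h he, f, h hf, h1⟩
  have hD : Monotone rejD := by
    rintro A B h e ⟨he, f, hf, h1⟩
    exact ⟨h he, f, h hf, h1⟩
  let F : Set E →o Set E :=
    ⟨fun A => J \ rejD (J \ rejC A), fun A B h =>
      Set.sdiff_subset_sdiff_right (hD (Set.sdiff_subset_sdiff_right (hC h)))⟩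
  obtain ⟨A, hA⟩ : ∃ A, J \ rejD (J \ rejC A) = A := ⟨_, F.map_lfp⟩
  obtain ⟨B, hB⟩ : ∃ B, J \ rejC A = B := ⟨_, rfl⟩
  rw [hB] at hA
  have memA : ∀ e, e ∈ A ↔ e ∈ J ∧ e ∉ rejD B := fun e => by rw [← hA]; rfl
  have memB : ∀ e, e ∈ B ↔ e ∈ J ∧ e ∉ rejC A := fun e => by rw [← hB]; rfl
  refine ⟨A ∩ B, fun e he => ((memA e).1 he.1).1, ?_, ?_, ?_⟩
  · intro e he f hf h
    have h1 := ((memB e).1 he.2).2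
    have h2 := ((memB f).1 hf.2).2
    by_contra hne
    rcases lt_or_gt_of_ne hne with hlt | hlt
    · exact h2 ⟨hf.1, e, he.1, h, hlt⟩
    · exact h1 ⟨he.1, f, hf.1, h.symm, hlt⟩
  · intro e he f hf h
    have h1 := ((memA e).1 he.1).2
    have h2 := ((memA f).1 hf.1).2
    by_contra hne
    rcases lt_or_gt_of_ne hne with hlt | hlt
    · exact h2 ⟨hf.2, e, he.2, h, hlt⟩
    · exact h1 ⟨he.2, f, hf.2, h.symm, hlt⟩
  · intro e he
    by_cases heA : e ∈ A
    · left
      obtain ⟨m, ⟨hmA, hmc⟩, hmin⟩ := exists_minimalFor_of_wellFoundedLT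
        (fun f => f ∈ A ∧ c f = c e) ρ ⟨e, heA, rfl⟩
      refine ⟨m, ⟨hmA, (memB m).2 ⟨((memA m).1 hmA).1, ?_⟩⟩, hmc, ?_⟩
      · rintro ⟨-, f, hf, hfc, hlt⟩
        have := hmin (j := f) ⟨hf, hfc.trans hmc⟩ hlt.le
        omega
      · rcases le_total (ρ m) (ρ e) with h | h
        · exact h
        · exact hmin (j := e) ⟨heA, rfl⟩ h
    · right
      have hrej : e ∈ rejD B := by
        by_contra h
        exact heA ((memA e).2 ⟨he, h⟩)
      obtain ⟨-, g, hg, hgd, hlt⟩ := hrej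
      obtain ⟨m, ⟨hmB, hmd⟩, hmin⟩ := exists_minimalFor_of_wellFoundedLT
        (fun f => f ∈ B ∧ d f = d e) σ ⟨g, hg, hgd⟩
      refine ⟨m, ⟨(memA m).2 ⟨((memB m).1 hmB).1, ?_⟩, hmB⟩, hmd, ?_⟩
      · rintro ⟨-, f, hf, hfd, hlt'⟩
        have := hmin (j := f) ⟨hf, hfd.trans hmd⟩ hlt'.le
        omega
      · rcases le_total (σ m) (σ g) with h | h
        · exact h.trans_lt hlt
        · exact (hmin (j := g) ⟨hg, hgd⟩ h).trans_lt hlt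

theorem idxOf_lt_of_mem_left {E : Type*} [DecidableEq E] {l₁ l₂ : List E} {m x : E}
    (hnd : (l₁ ++ m :: l₂).Nodup) (hx : x ∈ l₁) :
    (l₁ ++ m :: l₂).idxOf x < (l₁ ++ m :: l₂).idxOf m := by
  have hm : m ∉ l₁ := fun h => (List.nodup_append.1 hnd).2.2 m h m (by simp) rfl
  rw [List.idxOf_append_of_mem hx, List.idxOf_append_of_notMem hm]
  have := List.idxOf_lt_length_of_mem hx
  omega

/-- Linkage theorem of Pym type: a family `P` of disjoint lists with set of initial elements `S` and
a family `Q` of disjoint lists with initial elements in `S` can be combined into a family of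
disjoint lists with set of initial elements `S` that covers the last elements of `Q`. -/
theorem exists_linkage {E ι : Type*} [Nonempty ι] (S : Set E) (P : E → List E) (T : Set ι)
    (Q : ι → List E) (hPhead : ∀ a ∈ S, a ∈ (P a).head?) (hPnd : ∀ a ∈ S, (P a).Nodup)
    (hPdisj : S.Pairwise fun a b => (P a).Disjoint (P b))
    (hQhead : ∀ t ∈ T, ∃ b ∈ S, b ∈ (Q t).head?) (hQnd : ∀ t ∈ T, (Q t).Nodup)
    (hQdisj : T.Pairwise fun a b => (Q a).Disjoint (Q b)) :
    ∃ R : E → List E,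
      (∀ a ∈ S, R a = P a ∨ ∃ t ∈ T, ∃ m l₁ l₂ k₁ k₂,
        P a = l₁ ++ m :: l₂ ∧ Q t = k₁ ++ m :: k₂ ∧ R a = l₁ ++ m :: k₂) ∧
      (S.Pairwise fun a b => (R a).Disjoint (R b)) ∧
      ∀ t ∈ T, ∃ a ∈ S, ∀ e ∈ (Q t).getLast?, e ∈ R a := by
  classical
  have hc : ∀ e, ∃ a, (∃ a ∈ S, e ∈ P a) → a ∈ S ∧ e ∈ P a := by
    intro e
    by_cases h : ∃ a ∈ S, e ∈ P a
    · obtain ⟨a, h⟩ := h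
      exact ⟨a, fun _ => h⟩
    · exact ⟨e, fun h' => absurd h' h⟩
  have hd : ∀ e, ∃ t, (∃ t ∈ T, e ∈ Q t) → t ∈ T ∧ e ∈ Q t := by
    intro e
    by_cases h : ∃ t ∈ T, e ∈ Q t
    · obtain ⟨t, h⟩ := h
      exact ⟨t, fun _ => h⟩
    · exact ⟨Classical.arbitrary ι, fun h' => absurd h' h⟩
  choose c hc using hc
  choose d hd using hd
  have c_eq : ∀ a ∈ S, ∀ e ∈ P a, c e = a := by
    intro a ha e he
    obtain ⟨h1, h2⟩ := hc e ⟨a, ha, he⟩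
    by_contra hne
    exact hPdisj h1 ha hne h2 he
  have d_eq : ∀ t ∈ T, ∀ e ∈ Q t, d e = t := by
    intro t ht e he
    obtain ⟨h1, h2⟩ := hd e ⟨t, ht, he⟩
    by_contra hne
    exact hQdisj h1 ht hne h2 he
  obtain ⟨M, hMJ, hMc, hMd, hstab⟩ := exists_stable_matching
    {e | (∃ a ∈ S, e ∈ P a) ∧ ∃ t ∈ T, e ∈ Q t} c d
    (fun e => (P (c e)).idxOf e) (fun e => (Q (d e)).reverse.idxOf e)
  simp only [Set.mem_ofPred_eq] at hstab
  have c_inj : ∀ e ∈ M, ∀ f ∈ M, c e = c f → e = f := by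
    intro e he f hf h
    have h1 := hMc e he f hf h
    simp only [h] at h1
    have h2 := (hc e (hMJ he).1).2
    rw [h] at h2
    exact (List.idxOf_inj h2).1 h1
  have d_inj : ∀ e ∈ M, ∀ f ∈ M, d e = d f → e = f := by
    intro e he f hf h
    have h1 := hMd e he f hf h
    simp only [h] at h1
    have h2 := (hd e (hMJ he).2).2
    rw [h] at h2
    exact (List.idxOf_inj (List.mem_reverse.2 h2)).1 h1
  have hR : ∀ a, ∃ R, a ∈ S → (R = P a ∧ ∀ m ∈ M, c m ≠ a) ∨ ∃ m ∈ M, c m = a ∧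
      ∃ l₁ l₂ k₁ k₂, P a = l₁ ++ m :: l₂ ∧ Q (d m) = k₁ ++ m :: k₂ ∧ R = l₁ ++ m :: k₂ := by
    intro a
    by_cases h : ∃ m ∈ M, c m = a
    · obtain ⟨m, hm, rfl⟩ := h
      obtain ⟨l₁, l₂, hl⟩ := List.append_of_mem (hc m (hMJ hm).1).2
      obtain ⟨k₁, k₂, hk⟩ := List.append_of_mem (hd m (hMJ hm).2).2
      exact ⟨_, fun _ => Or.inr ⟨m, hm, rfl, l₁, l₂, k₁, k₂, hl, hk, rfl⟩⟩
    · exact ⟨P a, fun _ => Or.inl ⟨rfl, fun m hm hma => h ⟨m, hm, hma⟩⟩⟩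
  choose R hR using hR
  have hmem : ∀ a ∈ S, ∀ x ∈ R a,
      (x ∈ P a ∧ ∀ m ∈ M, c m = a → m ≠ x → (P a).idxOf x < (P a).idxOf m) ∨
      ∃ m ∈ M, c m = a ∧ x ∈ Q (d m) ∧ (Q (d m)).reverse.idxOf x < (Q (d m)).reverse.idxOf m := by
    intro a ha x hx
    rcases hR a ha with ⟨h1, h2⟩ | ⟨m, hm, hma, l₁, l₂, k₁, k₂, hl, hk, hRa⟩
    · exact Or.inl ⟨h1 ▸ hx, fun m hm hma => absurd hma (h2 m hm)⟩
    · rw [hRa, List.mem_append, List.mem_cons] at hx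
      have hndP := hPnd a ha
      have hndQ := hQnd _ (hd m (hMJ hm).2).1
      rcases hx with hx | rfl | hx
      · refine Or.inl ⟨by simp [hl, hx], fun m' hm' hma' _ => ?_⟩
        obtain rfl := c_inj m hm m' hm' (hma.trans hma'.symm)
        rw [hl] at hndP ⊢
        exact idxOf_lt_of_mem_left hndP hx
      · refine Or.inl ⟨by simp [hl], fun m' hm' hma' hne => ?_⟩
        exact absurd (c_inj m' hm' x hm (hma'.trans hma.symm)) hne
      · refine Or.inr ⟨m, hm, hma, by simp [hk, hx], ?_⟩
        have hnd := List.nodup_reverse.2 hndQ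
        have hrev : (Q (d m)).reverse = k₂.reverse ++ m :: k₁.reverse := by simp [hk]
        rw [hrev] at hnd ⊢
        exact idxOf_lt_of_mem_left hnd (List.mem_reverse.2 hx)
  have hcross : ∀ a ∈ S, ∀ b ∈ S, a ≠ b → ∀ x ∈ P a,
      (∀ m ∈ M, c m = a → m ≠ x → (P a).idxOf x < (P a).idxOf m) →
      (∃ m ∈ M, c m = b ∧ x ∈ Q (d m) ∧
        (Q (d m)).reverse.idxOf x < (Q (d m)).reverse.idxOf m) → False := by
    rintro a ha b hb hab x hx hbefore ⟨m, hm, hmb, hxQ, hafter⟩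
    have hmT := (hd m (hMJ hm).2).1
    have hcx := c_eq a ha x hx
    have hdx := d_eq _ hmT x hxQ
    rcases hstab x ⟨⟨a, ha, hx⟩, _, hmT, hxQ⟩ with ⟨n, hn, hnc, hle⟩ | ⟨n, hn, hnd, hlt⟩
    · by_cases hnx : n = x
      · obtain rfl := hnx
        obtain rfl := d_inj n hn m hm hdx
        exact hab (hcx.symm.trans hmb)
      · have := hbefore n hn (hnc.trans hcx) hnx
        rw [hnc, hcx] at hle
        omega
    · obtain rfl := d_inj n hn m hm (hnd.trans hdx)
      rw [hdx] at hlt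
      omega
  refine ⟨R, ?_, ?_, ?_⟩
  · intro a ha
    rcases hR a ha with ⟨h1, -⟩ | ⟨m, hm, -, l₁, l₂, k₁, k₂, h⟩
    · exact Or.inl h1
    · exact Or.inr ⟨d m, (hd m (hMJ hm).2).1, m, l₁, l₂, k₁, k₂, h⟩
  · intro a ha b hb hab x hxa hxb
    rcases hmem a ha x hxa with ⟨ha1, ha2⟩ | h1 <;> rcases hmem b hb x hxb with ⟨hb1, hb2⟩ | h2
    · exact hPdisj ha hb hab ha1 hb1
    · exact hcross a ha b hb hab x ha1 ha2 h2
    · exact hcross b hb a ha hab.symm x hb1 hb2 h1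
    · obtain ⟨m, hm, rfl, hxm, -⟩ := h1
      obtain ⟨n, hn, rfl, hxn, -⟩ := h2
      have h3 := d_eq _ (hd m (hMJ hm).2).1 x hxm
      have h4 := d_eq _ (hd n (hMJ hn).2).1 x hxn
      exact hab (congrArg c (d_inj m hm n hn (h3.symm.trans h4)))
  · intro t ht
    obtain ⟨b, hb, hbt⟩ := hQhead t ht
    have hbP : b ∈ P b := List.mem_of_mem_head? (hPhead b hb)
    have hbQ : b ∈ Q t := List.mem_of_mem_head? hbt
    have hdb := d_eq t ht b hbQ
    have hcb := c_eq b hb b hbP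
    obtain ⟨m, hm, hmt⟩ : ∃ m ∈ M, d m = t := by
      rcases hstab b ⟨⟨b, hb, hbP⟩, t, ht, hbQ⟩ with ⟨m, hm, hmc, hle⟩ | ⟨m, hm, hmd, -⟩
      · refine ⟨m, hm, ?_⟩
        have hmP := (hc m (hMJ hm).1).2
        rw [hmc, hcb] at hle hmP
        obtain ⟨l, hl⟩ : ∃ l, P b = b :: l := by
          have := hPhead b hb
          cases h : P b with
          | nil => simp [h] at this
          | cons x l => simp [h] at this; exact ⟨l, by rw [this]⟩
        have h0 : (P b).idxOf b = 0 := by simp [hl]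
        have h1 : (P b).idxOf m = (P b).idxOf b := by omega
        rw [(List.idxOf_inj hmP).1 h1, hdb]
      · exact ⟨m, hm, hmd.trans hdb⟩
    have hcS := (hc m (hMJ hm).1).1
    refine ⟨c m, hcS, fun e he => ?_⟩
    rcases hR _ hcS with ⟨-, h⟩ | ⟨n, hn, hnc, l₁, l₂, k₁, k₂, -, hk, hRa⟩
    · exact absurd rfl (h m hm)
    · obtain rfl := c_inj n hn m hm hnc
      rw [← hmt, hk] at he
      rw [hRa]
      simp only [List.getLast?_append, List.getLast?_cons, Option.mem_def, Option.some_or,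
        Option.some.injEq] at he
      subst he
      rw [List.mem_append]
      right
      cases k₂ with
      | nil => simp
      | cons x k =>
        rw [List.getLast?_eq_some_getLast (by simp : x :: k ≠ []), Option.getD_some]
        exact List.mem_cons_of_mem _ (List.getLast_mem _)

namespace MultiDigraph

variable {V E : Type*} (D : MultiDigraph V E)

/-- Every walk between distinct vertices contains a path between them. -/
theorem exists_isPathIn_of_walk (t : V) (w : List E) : ∀ hne : w ≠ [],
    w.IsChain (fun e f => D.head e = D.tail f) → D.head (w.getLast hne) = t →
    D.tail (w.head hne) ≠ t →
    ∃ p, D.IsPathIn Set.univ (D.tail (w.head hne)) t p ∧ p ⊆ w := by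
  induction w with
  | nil => intro h; exact absurd rfl h
  | cons e w ih =>
    intro _ hch hlast hst
    simp only [List.head_cons] at hst ⊢
    by_cases het : D.head e = t
    · refine ⟨[e], ⟨by simp, by simp, by simpa using het, .singleton _, ?_, by simp⟩,
        by simp⟩
      simpa using D.no_loops e
    have hw : w ≠ [] := by
      rintro rfl
      exact het (by simpa using hlast)
    have hjoin : D.head e = D.tail (w.head hw) := by
      obtain ⟨x, w', rfl⟩ := List.exists_cons_of_ne_nil hw
      exact (List.isChain_cons_cons.1 hch).1
    obtain ⟨p, ⟨hp, hps, hpt, hpc, hpn, -⟩, hpw⟩ := ih hw hch.tail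
      (by rw [List.getLast_cons hw] at hlast; exact hlast) (hjoin ▸ het)
    by_cases hs : D.tail e ∈ p.map D.head
    · obtain ⟨f, hf, hfs⟩ := List.mem_map.1 hs
      obtain ⟨l₁, l₂, rfl⟩ := List.append_of_mem hf
      have hl₂ : l₂ ≠ [] := by
        rintro rfl
        exact hst (hfs.symm.trans (by simpa using hpt))
      have hsub : (f :: l₂) <:+ l₁ ++ f :: l₂ := List.suffix_append _ _
      have hcf : (f :: l₂).IsChain (fun e f => D.head e = D.tail f) := List.IsChain.suffix hpc hsub
      refine ⟨l₂, ⟨hl₂, ?_, ?_, hcf.tail, ?_, by simp⟩, ?_⟩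
      · obtain ⟨x, l, rfl⟩ := List.exists_cons_of_ne_nil hl₂
        rw [← hfs]
        exact (List.isChain_cons_cons.1 hcf).1.symm
      · rw [← hpt, List.getLast_append_of_right_ne_nil _ _ (by simp), List.getLast_cons hl₂]
      · rw [← hfs, ← List.map_cons]
        exact (List.nodup_cons.1 hpn).2.sublist (hsub.sublist.map _)
      · intro x hx
        exact List.mem_cons_of_mem _ (hpw (by simp [hx]))
    · refine ⟨e :: p, ⟨by simp, by simp, by rw [List.getLast_cons hp]; exact hpt, ?_, ?_, by simp⟩,
        List.cons_subset_cons _ hpw⟩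
      · obtain ⟨x, p', rfl⟩ := List.exists_cons_of_ne_nil hp
        exact List.isChain_cons_cons.2 ⟨hjoin.trans hps.symm, hpc⟩
      · rw [List.map_cons, hjoin]
        refine List.nodup_cons.2 ⟨?_, hpn⟩
        rw [List.mem_cons, not_or]
        exact ⟨hjoin ▸ D.no_loops e, hs⟩

/-- A walk ending in `X` stays in `X` or has a last edge entering `X`. -/
theorem forall_tail_mem_or_exists_last_entry (X : Set V) (w : List E) :
    w.IsChain (fun e f => D.head e = D.tail f) → (∀ e ∈ w.getLast?, D.head e ∈ X) →
    (∀ e ∈ w, D.tail e ∈ X) ∨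
      ∃ l₁ b l₂, w = l₁ ++ b :: l₂ ∧ b ∈ D.edgesInto Set.univ X ∧ ∀ e ∈ l₂, D.tail e ∈ X := by
  induction w with
  | nil => intro _ _; left; simp
  | cons e w ih =>
    intro hch hlast
    rcases ih hch.tail (by
      intro x hx
      cases w with
      | nil => simp at hx
      | cons y w => exact hlast x (by rw [List.getLast?_cons_cons]; exact hx)) with
      h | ⟨l₁, b, l₂, rfl, hb, h⟩
    · by_cases he : D.tail e ∈ X
      · left
        simpa [he] using h
      · right
        refine ⟨[], e, w, rfl, ⟨trivial, he, ?_⟩, h⟩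
        cases w with
        | nil => exact hlast e (by simp)
        | cons y w =>
          rw [(List.isChain_cons_cons.1 hch).1]
          exact h y (by simp)
    · right
      exact ⟨e :: l₁, b, l₂, rfl, hb, h⟩

/-- Walks to `v` with initial edge `a` that stay in `X` after `a` and do not pass through `v`. -/
def IsLinkWalk (X : Set V) (v : V) (a : E) (w : List E) : Prop :=
  w.IsChain (fun e f => D.head e = D.tail f) ∧ (∀ e ∈ w.getLast?, D.head e = v) ∧
    (∀ e ∈ w, D.tail e ≠ v) ∧ ∃ l, w = a :: l ∧ ∀ e ∈ l, D.tail e ∈ X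

variable {D}

theorem IsPathIn.tail_ne {L : Set E} {s t : V} {p : List E} (hp : D.IsPathIn L s t p) {e : E}
    (he : e ∈ p) : D.tail e ≠ t := by
  obtain ⟨hne, hs, ht, hc, hn, -⟩ := hp
  obtain ⟨l₁, l₂, rfl⟩ := List.append_of_mem he
  intro h
  have hlast : t ∈ (e :: l₂).map D.head := by
    rw [← ht, List.getLast_append_of_right_ne_nil _ _ (by simp)]
    exact List.mem_map_of_mem (List.getLast_mem _)
  rcases List.eq_nil_or_concat' l₁ with rfl | ⟨l, f, rfl⟩
  · have : s = t := by rw [← hs, ← h]; rfl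
    exact (List.nodup_cons.1 hn).1 (this ▸ hlast)
  · have hc' : (l ++ [f] ++ e :: l₂).IsChain (fun e f => D.head e = D.tail f) := hc
    have hf : D.head f = t := by
      rw [← h]
      exact (List.isChain_append.1 hc').2.2 f (by simp) e (by simp)
    have hn' := (List.nodup_cons.1 hn).2
    rw [List.map_append] at hn'
    exact (List.nodup_append.1 hn').2.2 t (by simp [← hf]) t hlast rfl

theorem IsPathIn.nodup {L : Set E} {s t : V} {p : List E} (hp : D.IsPathIn L s t p) : p.Nodup :=
  (List.nodup_cons.1 hp.choose_spec.2.2.2.1).2.of_map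

theorem IsPathIn.head_getLast? {L : Set E} {s t : V} {p : List E} (hp : D.IsPathIn L s t p) :
    ∀ e ∈ p.getLast?, D.head e = t := by
  obtain ⟨hne, -, ht, -⟩ := hp
  intro e he
  rw [List.getLast?_eq_some_getLast hne] at he
  obtain rfl := Option.some.inj he
  exact ht

/-- The part of a path to `v` from its last edge entering `X` on. -/
theorem IsPathIn.isLinkWalk_of_append {L : Set E} {X : Set V} {s v : V} {l₁ l₂ : List E} {b : E}
    (hp : D.IsPathIn L s v (l₁ ++ b :: l₂)) (h : ∀ e ∈ l₂, D.tail e ∈ X) :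
    D.IsLinkWalk X v b (b :: l₂) := by
  refine ⟨List.IsChain.suffix hp.choose_spec.2.2.1 (List.suffix_append _ _), ?_, ?_, l₂, rfl, h⟩
  · intro e he
    refine hp.head_getLast? e ?_
    rw [List.getLast?_append_of_ne_nil _ (by simp)]
    exact he
  · intro e he
    exact hp.tail_ne (List.mem_append_right _ he)

theorem IsLinkWalk.splice {X : Set V} {v : V} {a b m : E} {l₁ l₂ k₁ k₂ : List E}
    (hl : D.IsLinkWalk X v a (l₁ ++ m :: l₂)) (hk : D.IsLinkWalk X v b (k₁ ++ m :: k₂)) :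
    D.IsLinkWalk X v a (l₁ ++ m :: k₂) := by
  obtain ⟨hlc, -, hlt, l, hla, hlX⟩ := hl
  obtain ⟨hkc, hkv, hkt, k, hkb, hkX⟩ := hk
  have hk₂ : ∀ e ∈ k₂, D.tail e ∈ X := by
    intro e he
    refine hkX e ?_
    cases k₁ with
    | nil => simp at hkb; exact hkb.2 ▸ he
    | cons x k₁ => simp at hkb; simp [← hkb.2, he]
  refine ⟨?_, ?_, ?_, ?_⟩
  · rw [List.isChain_append] at hlc hkc ⊢
    exact ⟨hlc.1, hkc.2.1, fun x hx y hy => hlc.2.2 x hx y (by simpa using hy)⟩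
  · intro e he
    refine hkv e ?_
    rw [List.getLast?_append_of_ne_nil _ (by simp)] at he ⊢
    exact he
  · intro e he
    simp only [List.mem_append, List.mem_cons] at he hlt hkt
    rcases he with he | he | he
    · exact hlt e (Or.inl he)
    · exact hlt e (Or.inr (Or.inl he))
    · exact hkt e (Or.inr (Or.inr he))
  · cases l₁ with
    | nil =>
      simp at hla
      exact ⟨k₂, by simp [hla.1], hk₂⟩
    | cons x l₁ =>
      simp at hla
      refine ⟨l₁ ++ m :: k₂, by simp [hla.1], fun e he => ?_⟩
      simp only [List.mem_append, List.mem_cons] at he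
      rcases he with he | he | he
      · exact hlX e (by simp [← hla.2, he])
      · exact hlX e (by simp [← hla.2, he])
      · exact hk₂ e he

/-- An edge into `v` of a walk that does not pass through `v` is its last edge. -/
theorem eq_getLast_of_head_eq {v : V} {w : List E}
    (hc : w.IsChain (fun e f => D.head e = D.tail f)) (ht : ∀ e ∈ w, D.tail e ≠ v) {e : E}
    (he : e ∈ w) (hev : D.head e = v) : e ∈ w.getLast? := by
  obtain ⟨l₁, l₂, rfl⟩ := List.append_of_mem he
  cases l₂ with
  | nil => simp
  | cons f l =>
    have := (List.isChain_cons_cons.1 (List.isChain_append.1 hc).2.1).1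
    exact absurd (this.symm.trans hev) (ht f (by simp))

theorem IsLinkWalk.exists_isPathIn {X : Set V} {v : V} {a : E} {w : List E}
    (hw : D.IsLinkWalk X v a w) (ha : D.tail a ∉ X) :
    ∃ p, (D.IsPathIn Set.univ (D.tail a) v p ∧ p.head? = some a) ∧ p ⊆ w ∧
      ∀ e ∈ w, D.head e = v → e ∈ p := by
  obtain ⟨hc, hv, ht, l, rfl, hX⟩ := hw
  obtain ⟨p, hp, hpw⟩ := D.exists_isPathIn_of_walk v (a :: l) (by simp) hc
    (hv _ (by rw [List.getLast?_eq_some_getLast (by simp)]; rfl)) (ht a (by simp))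
  refine ⟨p, ⟨hp, ?_⟩, hpw, ?_⟩
  · obtain ⟨hne, hs, -⟩ := hp
    rw [List.head?_eq_some_head hne]
    rcases List.mem_cons.1 (hpw (List.head_mem hne)) with h | h
    · rw [h]
    · exact absurd (hX _ h) (by rw [hs]; exact ha)
  · intro e he hev
    obtain ⟨hne, -, hlast, -⟩ := hp
    have h1 := eq_getLast_of_head_eq hc ht he hev
    have h2 := eq_getLast_of_head_eq hc ht (hpw (List.getLast_mem hne)) hlast
    rw [Option.mem_unique h1 h2]
    exact List.getLast_mem hne

end MultiDigraph

/-- For a `v`-linked set `X` and `I ∈ 𝒢_D(v)`, there is a family of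
paths witnessing that `X` is `v`-linked that moreover covers `I`. -/
theorem stmt7 {V E : Type*} (D : MultiDigraph V E) (r : V)
    (hroot : ∀ e, D.head e ≠ r)
    (v : V) (hv : v ≠ r)
    (X : Set V) (hX : D.VLinked Set.univ r v X)
    (I : Set E) (hI : D.MemGv Set.univ r v I) :
    ∃ R : E → List E,
      (∀ e ∈ D.edgesInto Set.univ X,
        D.IsPathIn Set.univ (D.tail e) v (R e) ∧ (R e).head? = some e) ∧
      (D.edgesInto Set.univ X).Pairwise (fun e f => (R e).Disjoint (R f)) ∧
      ∀ e ∈ I, ∃ f ∈ D.edgesInto Set.univ X, e ∈ R f := by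
  obtain ⟨hrX, hvX, P, hP, hPdisj⟩ := hX
  obtain ⟨hIv, Ps, hPs, hPsdisj, hcov⟩ := hI
  have hPlink : ∀ a ∈ D.edgesInto Set.univ X, D.IsLinkWalk X v a (P a) := by
    intro a ha
    obtain ⟨hpath, hhead⟩ := hP a ha
    have haP : a ∈ P a := List.mem_of_mem_head? hhead
    rcases D.forall_tail_mem_or_exists_last_entry X (P a) hpath.choose_spec.2.2.1
      (fun e he => by rw [hpath.head_getLast? e he]; exact hvX) with h | ⟨l₁, b, l₂, hl, hb, h⟩
    · exact absurd (h a haP) ha.2.1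
    · have hab : a = b := by
        by_contra hne
        exact hPdisj ha hb hne (by simp [hl] : b ∈ P a) (List.mem_of_mem_head? (hP b hb).2)
      subst hab
      have hl₁ : l₁ = [] := by
        cases l₁ with
        | nil => rfl
        | cons x l =>
          have hnd := hpath.nodup
          rw [hl] at hhead hnd
          simp at hhead
          simp [hhead] at hnd
      rw [hl] at hpath ⊢
      subst hl₁
      exact hpath.isLinkWalk_of_append h
  have hQ : ∀ p : List E, ∃ q, p ∈ Ps → (∃ b ∈ D.edgesInto Set.univ X, D.IsLinkWalk X v b q) ∧
      q <:+ p ∧ q.getLast? = p.getLast? := by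
    intro p
    by_cases hp : p ∈ Ps
    · have hpath := hPs p hp
      rcases D.forall_tail_mem_or_exists_last_entry X p hpath.choose_spec.2.2.1
        (fun e he => by rw [hpath.head_getLast? e he]; exact hvX) with h | ⟨l₁, b, l₂, rfl, hb, h⟩
      · obtain ⟨hne, hs, -⟩ := hpath
        exact absurd (h _ (List.head_mem hne)) (by rw [hs]; exact hrX)
      · refine ⟨b :: l₂, fun _ => ⟨⟨b, hb, hpath.isLinkWalk_of_append h⟩, List.suffix_append _ _, ?_⟩⟩
        rw [List.getLast?_append_of_ne_nil _ (by simp)]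
    · exact ⟨[], fun h => absurd h hp⟩
  choose Q hQ using hQ
  obtain ⟨R, hR, hRdisj, hRcov⟩ := exists_linkage (D.edgesInto Set.univ X) P Ps Q
    (fun a ha => (hP a ha).2) (fun a ha => (hP a ha).1.nodup) hPdisj
    (fun p hp => by
      obtain ⟨b, hb, -, -, -, l, hl, -⟩ := (hQ p hp).1
      exact ⟨b, hb, by simp [hl]⟩)
    (fun p hp => (hPs p hp).nodup.sublist (hQ p hp).2.1.sublist)
    (fun p hp q hq hpq e hep heq => hPsdisj hp hq hpq
      ((hQ p hp).2.1.subset hep) ((hQ q hq).2.1.subset heq))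
  have hRlink : ∀ a ∈ D.edgesInto Set.univ X, D.IsLinkWalk X v a (R a) := by
    intro a ha
    rcases hR a ha with h | ⟨p, hp, m, l₁, l₂, k₁, k₂, hl, hk, h⟩
    · rw [h]
      exact hPlink a ha
    · obtain ⟨b, -, hb⟩ := (hQ p hp).1
      have ha' := hPlink a ha
      rw [hl] at ha'
      rw [hk] at hb
      rw [h]
      exact ha'.splice hb
  have hW : ∀ a, ∃ w, a ∈ D.edgesInto Set.univ X →
      (D.IsPathIn Set.univ (D.tail a) v w ∧ w.head? = some a) ∧ w ⊆ R a ∧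
      ∀ e ∈ R a, D.head e = v → e ∈ w := by
    intro a
    by_cases ha : a ∈ D.edgesInto Set.univ X
    · obtain ⟨w, hw⟩ := (hRlink a ha).exists_isPathIn ha.2.1
      exact ⟨w, fun _ => hw⟩
    · exact ⟨[], fun h => absurd h ha⟩
  choose W hW using hW
  refine ⟨W, fun a ha => (hW a ha).1, ?_, ?_⟩
  · intro a ha a' ha' hne e he he'
    exact hRdisj ha ha' hne ((hW a ha).2.1 he) ((hW a' ha').2.1 he')
  · intro e he
    have hev : D.head e = v := (hIv he).2
    obtain ⟨p, hp, hep⟩ := hcov e he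
    have hpath := hPs p hp
    have hlast := MultiDigraph.eq_getLast_of_head_eq hpath.choose_spec.2.2.1
      (fun f hf => hpath.tail_ne hf) hep hev
    obtain ⟨a, ha, hcova⟩ := hRcov p hp
    exact ⟨a, ha, (hW a ha).2.2 e (hcova e (by rw [(hQ p hp).2.2]; exact hlast)) hev⟩
end

section
/- Let D = (V,E) be an r-rooted digraph (possibly infinite) and v ∈ V \ {r}. If X ⊆ V \ {r} is both fillable and v-linked, then there is a set P of pairwise edge-disjoint rv-paths in D such that C := δ_D(X) is an rv-cut and a transversal of P (C contains exactly one edge from each path in P). -/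
namespace MultiDigraph

/-- A walk ending in `X`, none of whose edges after the first enters `X`, has all heads in `X`. -/
theorem head_mem_of_chain {V E : Type*} (D : MultiDigraph V E) (X : Set V) (a : E) (l : List E)
    (hc : (a :: l).IsChain (fun e f => D.head e = D.tail f))
    (hlast : D.head ((a :: l).getLast (List.cons_ne_nil a l)) ∈ X)
    (hl : ∀ e ∈ l, e ∉ D.edgesInto Set.univ X) : ∀ e ∈ a :: l, D.head e ∈ X := by
  induction l generalizing a with
  | nil => simpa using hlast
  | cons b l ih =>
    rw [List.isChain_cons_cons] at hc
    have hX := ih b hc.2 (by simpa using hlast) fun e he => hl e (List.mem_cons_of_mem _ he)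
    have hb : D.tail b ∈ X := by
      by_contra h
      exact hl b List.mem_cons_self ⟨Set.mem_univ _, h, hX b List.mem_cons_self⟩
    intro e he
    rcases List.mem_cons.1 he with rfl | he
    · rw [hc.1]
      exact hb
    · exact hX e he

/-- The edges entering a set that contains `t` but not `s` form an `s`–`t` cut. -/
theorem isCut_edgesInto {V E : Type*} (D : MultiDigraph V E) {s t : V} {X : Set V}
    (hs : s ∉ X) (ht : t ∈ X) : D.IsCut Set.univ s t (D.edgesInto Set.univ X) := by
  rintro p ⟨hne, hhead, hlast, hc, -, -⟩
  by_contra! h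
  obtain ⟨a, l, rfl⟩ := List.exists_cons_of_ne_nil hne
  have hX := D.head_mem_of_chain X a l hc (hlast ▸ ht)
    fun e he => h e (List.mem_cons_of_mem _ he)
  refine h a List.mem_cons_self ⟨Set.mem_univ _, ?_, hX a List.mem_cons_self⟩
  rw [List.head_cons] at hhead
  rwa [hhead]

end MultiDigraph

/-- If `X` is fillable and `v`-linked, then there is a set `Ps` of
pairwise edge-disjoint `r`–`v` paths such that `C := δ_D(X)` is an `r`–`v`-cut and
a transversal of `Ps`. -/
theorem stmt8 {V E : Type*} (D : MultiDigraph V E) (r : V)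
    (hroot : ∀ e, D.head e ≠ r)
    (v : V) (hv : v ≠ r)
    (X : Set V)
    (hfill : D.Fillable Set.univ r X)
    (hlinked : D.VLinked Set.univ r v X) :
    ∃ Ps : Set (List E),
      (∀ p ∈ Ps, D.IsPathIn Set.univ r v p) ∧
      Ps.Pairwise (fun p q => p.Disjoint q) ∧
      MultiDigraph.IsTransversal Ps (D.edgesInto Set.univ X) ∧
      D.IsCut Set.univ r v (D.edgesInto Set.univ X) := by
  classical
  obtain ⟨Qs, hQ, hQdis, hQlast⟩ := hfill
  obtain ⟨hrX, hvX, P, hP, hPdis⟩ := hlinked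
  have hcons : ∀ e ∈ D.edgesInto Set.univ X, ∃ m, P e = e :: m := fun e he =>
    List.head?_eq_some_iff.1 (hP e he).2
  have hδ : ∀ l e, l ++ [e] ∈ Qs → e ∈ D.edgesInto Set.univ X := by
    intro l e h
    rw [← hQlast]
    exact ⟨_, h, by simp⟩
  have hl : ∀ l e, l ++ [e] ∈ Qs → ∀ f ∈ l, D.head f ∉ X := by
    intro l e h f hf
    obtain ⟨_, -, -, h4, -⟩ := hQ _ h
    exact h4 f (by simpa using hf)
  have hmδ : ∀ e ∈ D.edgesInto Set.univ X, ∀ m, P e = e :: m →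
      ∀ f ∈ m, f ∉ D.edgesInto Set.univ X := by
    intro e he m hm f hf hfδ
    obtain ⟨⟨_, -, -, -, hnd, -⟩, -⟩ := hP e he
    obtain ⟨m', hm'⟩ := hcons f hfδ
    by_cases hef : e = f
    · subst hef
      simp only [hm, List.map_cons, List.nodup_cons] at hnd
      exact hnd.2.1 (List.mem_map_of_mem hf)
    · refine hPdis he hfδ hef (a := f) ?_ ?_
      · simp [hm, hf]
      · simp [hm']
  have hmX : ∀ e ∈ D.edgesInto Set.univ X, ∀ m, P e = e :: m →
      ∀ f ∈ e :: m, D.head f ∈ X := by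
    intro e he m hm
    obtain ⟨⟨_, -, hlast, hc, -, -⟩, -⟩ := hP e he
    simp only [hm] at hlast hc
    exact D.head_mem_of_chain X e m hc (hlast ▸ hvX) (hmδ e he m hm)
  refine ⟨{q | ∃ l e m, l ++ [e] ∈ Qs ∧ P e = e :: m ∧ q = l ++ e :: m}, ?_, ?_, ⟨?_, ?_⟩,
    D.isCut_edgesInto hrX hvX⟩
  · rintro _ ⟨l, e, m, hle, hm, rfl⟩
    have he := hδ l e hle
    have hX := hmX e he m hm
    have hlX := hl l e hle
    obtain ⟨_, h1, -, -, hc, hnd, -⟩ := hQ _ hle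
    obtain ⟨⟨_, -, hlast', hc', hnd', -⟩, -⟩ := hP e he
    simp only [hm] at hlast' hc' hnd'
    refine ⟨by simp, ?_, ?_, ?_, ?_, fun _ _ => Set.mem_univ _⟩
    · rw [← h1]
      cases l <;> simp
    · rwa [List.getLast_append_of_ne_nil _ (List.cons_ne_nil e m)]
    · have := List.IsChain.append_overlap (l₂ := [e]) (l₃ := m) hc hc' (by simp)
      rwa [List.append_assoc] at this
    · have hnd₁ : (r :: l.map D.head).Nodup := by
        refine hnd.sublist ?_
        simp
      have hnd₂ : ((e :: m).map D.head).Nodup := (List.nodup_cons.1 hnd').2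
      rw [List.map_append, ← List.cons_append]
      refine List.Nodup.append hnd₁ hnd₂ fun x hx hx' => ?_
      obtain ⟨f, hf, rfl⟩ := List.mem_map.1 hx'
      rcases List.mem_cons.1 hx with h | h
      · exact hroot f h
      · obtain ⟨g, hg, hgf⟩ := List.mem_map.1 h
        exact hlX g hg (hgf ▸ hX f hf)
  · rintro _ ⟨l₁, e₁, m₁, h₁, hm₁, rfl⟩ _ ⟨l₂, e₂, m₂, h₂, hm₂, rfl⟩ hne
    have he : e₁ ≠ e₂ := by
      rintro rfl
      have : l₁ ++ [e₁] = l₂ ++ [e₁] := by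
        by_contra h
        exact hQdis h₁ h₂ h (a := e₁) (by simp) (by simp)
      apply hne
      rw [List.append_cancel_right this, List.cons_injective (hm₁.symm.trans hm₂)]
    have hQne : l₁ ++ [e₁] ≠ l₂ ++ [e₂] := fun h => he (by simpa using (List.append_inj' h rfl).2)
    have hQd := hQdis h₁ h₂ hQne
    have hPd := hPdis (hδ _ _ h₁) (hδ _ _ h₂) he
    simp only [hm₁, hm₂] at hPd
    intro f hf₁ hf₂
    rcases List.mem_append.1 hf₁ with hf₁ | hf₁ <;> rcases List.mem_append.1 hf₂ with hf₂ | hf₂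
    · exact hQd (List.mem_append_left _ hf₁) (List.mem_append_left _ hf₂)
    · exact hl _ _ h₁ f hf₁ (hmX _ (hδ _ _ h₂) _ hm₂ f hf₂)
    · exact hl _ _ h₂ f hf₂ (hmX _ (hδ _ _ h₁) _ hm₁ f hf₁)
    · exact hPd hf₁ hf₂
  · rintro _ ⟨l, e, m, hle, hm, rfl⟩
    refine ⟨e, ⟨hδ _ _ hle, by simp⟩, ?_⟩
    rintro f ⟨hfδ, hf⟩
    rcases List.mem_append.1 hf with hf | hf
    · exact absurd hfδ.2.2 (hl _ _ hle f hf)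
    · rcases List.mem_cons.1 hf with hf | hf
      · exact hf
      · exact absurd hfδ (hmδ e (hδ _ _ hle) m hm f hf)
  · intro e he
    obtain ⟨m, hm⟩ := hcons e he
    obtain ⟨p, hp, hpe⟩ := hQlast.symm ▸ he
    obtain ⟨l, rfl⟩ := List.getLast?_eq_some_iff.1 hpe
    exact ⟨_, ⟨l, e, m, hp, hm, rfl⟩, by simp⟩
end

section
/- Let D = (V,E) be an r-rooted digraph (possibly infinite) and v ∈ V \ {r}. Then the ⊆-largest v-linked set X_{v,D} is fillable in D. -/
section

universe u v w

/-- A digraph with a source `s` without ingoing edges and a target `t ≠ s`. Sub-webs are given by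
edge sets. -/
structure Web (V : Type u) (E : Type v) where
  tail : E → V
  head : E → V
  s : V
  t : V
  s_ne_t : s ≠ t
  head_ne : ∀ e, head e ≠ s

namespace Web

variable {V : Type u} {E : Type v} (W : Web V E)

/-- `a` is the predecessor of `b` under the predecessor map `p`. -/
def Prel (p : E → E) (a b : E) : Prop := W.tail b ≠ W.s ∧ a = p b

/-- `U` is a union of edge-disjoint walks of `H` starting at `s`; the predecessor of an edge of `U`
on its walk is given by `p`. -/
structure Flow (H U : Set E) (p : E → E) : Prop where
  sub : U ⊆ H
  mem : ∀ e ∈ U, W.tail e ≠ W.s → p e ∈ U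
  head_eq : ∀ e ∈ U, W.tail e ≠ W.s → W.head (p e) = W.tail e
  inj : ∀ e ∈ U, ∀ f ∈ U, W.tail e ≠ W.s → W.tail f ≠ W.s → p e = p f → e = f
  acc : ∀ e ∈ U, Acc (W.Prel p) e

/-- `X` is a wave of `H`: all edges of `H` leaving `X` lie on the flow `U`. -/
structure IsWave (H : Set E) (X : Set V) (U : Set E) (p : E → E) : Prop
    extends W.Flow H U p where
  s_mem : W.s ∈ X
  t_notMem : W.t ∉ X
  tail_mem : ∀ e ∈ U, W.tail e ∈ X
  exit : ∀ e ∈ H, W.tail e ∈ X → W.head e ∉ X → e ∈ U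

/-- Some wave of `H` misses a source edge of `H`. -/
def Hindered (H : Set E) : Prop :=
  ∃ X U p c, W.IsWave H X U p ∧ c ∈ H ∧ W.tail c = W.s ∧ c ∉ U

/-- Vertices reachable from the source edge `c` in the residual digraph of `U`. -/
inductive Reach (H U : Set E) (c : E) : V → Prop
  | base : Reach H U c (W.head c)
  | fwd {e : E} : Reach H U c (W.tail e) → e ∈ H → e ∉ U → Reach H U c (W.head e)
  | bwd {e : E} : Reach H U c (W.head e) → e ∈ U → W.tail e ≠ W.s → Reach H U c (W.tail e)

variable {W}

theorem acc_of_source {p : E → E} {e : E} (h : W.tail e = W.s) : Acc (W.Prel p) e :=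
  Acc.intro _ fun _ hb => absurd h hb.1

theorem acc_of_pred {p : E → E} {e : E} (h : Acc (W.Prel p) (p e)) : Acc (W.Prel p) e :=
  Acc.intro _ fun _ hb => hb.2 ▸ h

theorem acc_pred {p : E → E} {e : E} (h : Acc (W.Prel p) e) (he : W.tail e ≠ W.s) :
    Acc (W.Prel p) (p e) := h.inv ⟨he, rfl⟩

theorem Flow.mono {H H' U : Set E} {p : E → E} (h : W.Flow H U p) (hU : U ⊆ H') :
    W.Flow H' U p := { h with sub := hU }

theorem IsWave.mono {H H' : Set E} {X : Set V} {U : Set E} {p : E → E} (h : W.IsWave H X U p)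
    (hU : U ⊆ H') (hH : ∀ e ∈ H', W.tail e ∈ X → W.head e ∉ X → e ∈ H ∨ e ∈ U) :
    W.IsWave H' X U p :=
  { h with
    sub := hU
    exit := fun e he h1 h2 => (hH e he h1 h2).elim (fun h3 => h.exit e h3 h1 h2) id }

theorem Reach.ne_s {H U : Set E} {c : E} {y : V} (h : W.Reach H U c y) : y ≠ W.s := by
  cases h with
  | base => exact W.head_ne _
  | fwd => exact W.head_ne _
  | bwd _ _ h => exact h

theorem IsWave.reach_subset {H : Set E} {X : Set V} {U : Set E} {p : E → E} {c : E}
    (h : W.IsWave H X U p) (hc : c ∈ H) (hcs : W.tail c = W.s) (hcU : c ∉ U) {y : V}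
    (hy : W.Reach H U c y) : y ∈ X := by
  induction hy with
  | base =>
    by_contra hn
    exact hcU (h.exit c hc (hcs ▸ h.s_mem) hn)
  | fwd _ he heU ih =>
    by_contra hn
    exact heU (h.exit _ he ih hn)
  | bwd _ heU _ _ => exact h.tail_mem _ heU

/-- The set reachable from a missed source edge is again a wave missing that edge. -/
theorem IsWave.reach {H : Set E} {X : Set V} {U : Set E} {p : E → E} {c : E}
    (h : W.IsWave H X U p) (hc : c ∈ H) (hcs : W.tail c = W.s) (hcU : c ∉ U) :
    ∃ U', W.IsWave H (insert W.s {y | W.Reach H U c y}) U' p ∧ c ∉ U' ∧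
      ∀ y, W.Reach H U c y → W.Reach H U' c y := by
  have hX : ∀ y, W.Reach H U c y → y ∈ X := fun y hy => h.reach_subset hc hcs hcU hy
  refine ⟨{e | e ∈ U ∧ (W.tail e = W.s ∨ W.Reach H U c (W.tail e))} ∪
    {e | e ∈ H ∧ W.tail e = W.s ∧ ¬ W.Reach H U c (W.head e)}, ?_, ?_, ?_⟩
  · constructor
    · constructor
      · rintro e (⟨he, _⟩ | ⟨he, _⟩)
        exacts [h.sub he, he]
      · rintro e (⟨he, he'⟩ | ⟨_, he, _⟩) hs
        · have h1 := he'.resolve_left hs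
          refine Or.inl ⟨h.mem e he hs, ?_⟩
          by_cases h2 : W.tail (p e) = W.s
          · exact Or.inl h2
          · refine Or.inr (Reach.bwd ?_ (h.mem e he hs) h2)
            rwa [h.head_eq e he hs]
        · exact absurd he hs
      · rintro e (⟨he, he'⟩ | ⟨_, he, _⟩) hs
        exacts [h.head_eq e he hs, absurd he hs]
      · rintro e (⟨he, _⟩ | ⟨_, he, _⟩) f (⟨hf, _⟩ | ⟨_, hf, _⟩) hes hfs
        · exact h.inj e he f hf hes hfs
        · exact absurd hf hfs
        · exact absurd he hes
        · exact absurd he hes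
      · rintro e (⟨he, _⟩ | ⟨_, he, _⟩)
        exacts [h.acc e he, acc_of_source he]
    · exact Set.mem_insert _ _
    · rintro (h1 | h1)
      exacts [W.s_ne_t h1.symm, h.t_notMem (hX _ h1)]
    · rintro e (⟨_, he⟩ | ⟨_, he, _⟩)
      exacts [he, Or.inl he]
    · rintro e he (h1 | h1) h2
      · exact Or.inr ⟨he, h1, fun h3 => h2 (Or.inr h3)⟩
      · refine Or.inl ⟨?_, Or.inr h1⟩
        by_contra h3
        exact h2 (Or.inr (Reach.fwd h1 he h3))
  · rintro (⟨he, _⟩ | ⟨_, _, he⟩)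
    exacts [hcU he, he Reach.base]
  · intro y hy
    induction hy with
    | base => exact Reach.base
    | fwd h1 h2 h3 ih =>
      refine Reach.fwd ih h2 ?_
      rintro (⟨h4, _⟩ | ⟨_, h4, _⟩)
      exacts [h3 h4, h1.ne_s h4]
    | bwd h1 h2 h3 ih =>
      exact Reach.bwd ih (Or.inl ⟨h2, Or.inr (Reach.bwd h1 h2 h3)⟩) h3

theorem Hindered.strong {H : Set E} (h : W.Hindered H) :
    ∃ X U p c, W.IsWave H X U p ∧ c ∈ H ∧ W.tail c = W.s ∧ c ∉ U ∧
      ∀ y ∈ X, y ≠ W.s → W.Reach H U c y := by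
  obtain ⟨X, U, p, c, hW, hc, hcs, hcU⟩ := h
  obtain ⟨U', h1, h2, h3⟩ := hW.reach hc hcs hcU
  exact ⟨_, U', p, c, h1, hc, hcs, h2, fun y hy hys => h3 y (hy.resolve_left hys)⟩

/-- Only finitely many edges are needed to witness that a vertex is reachable. -/
theorem Reach.local {H U : Set E} {c : E} {y : V} (h : W.Reach H U c y) :
    ∃ F : Set E, F.Finite ∧ ∀ Q, F ⊆ Q → W.Reach (H ∩ Q) (U ∩ Q) c y := by
  induction h with
  | base => exact ⟨∅, Set.finite_empty, fun _ _ => Reach.base⟩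
  | @fwd e _ h1 h2 ih =>
    obtain ⟨F, hF, h⟩ := ih
    refine ⟨insert e F, hF.insert e, fun Q hQ => ?_⟩
    exact Reach.fwd (h Q ((Set.subset_insert _ _).trans hQ)) ⟨h1, hQ (Set.mem_insert _ _)⟩
      fun h3 => h2 h3.1
  | @bwd e _ h1 h2 ih =>
    obtain ⟨F, hF, h⟩ := ih
    refine ⟨insert e F, hF.insert e, fun Q hQ => ?_⟩
    exact Reach.bwd (h Q ((Set.subset_insert _ _).trans hQ)) ⟨h1, hQ (Set.mem_insert _ _)⟩ h2

/-- If a predecessor map is a finite modification of a well-founded one, then an edge without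
successors lies on a walk from `s`. -/
theorem acc_of_finite_modification {U U₁ : Set E} {p p₁ : E → E} {q : E}
    (hacc : ∀ e ∈ U, Acc (W.Prel p) e)
    (hmem : ∀ e ∈ U₁, W.tail e ≠ W.s → p₁ e ∈ U₁)
    (hinj : ∀ e ∈ U₁, ∀ f ∈ U₁, W.tail e ≠ W.s → W.tail f ≠ W.s → p₁ e = p₁ f → e = f)
    (hU : (U₁ \ U).Finite) (hp : {e | e ∈ U₁ ∧ W.tail e ≠ W.s ∧ p₁ e ≠ p e}.Finite)
    (hq : q ∈ U₁) (htip : ∀ e ∈ U₁, W.tail e ≠ W.s → p₁ e ≠ q) : Acc (W.Prel p₁) q := by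
  by_contra hn
  set x : ℕ → E := fun n => p₁^[n] q with hx
  have hsucc : ∀ n, x (n + 1) = p₁ (x n) := fun n => Function.iterate_succ_apply' _ _ _
  have hbad : ∀ n, x n ∈ U₁ ∧ W.tail (x n) ≠ W.s ∧ ¬ Acc (W.Prel p₁) (x n) := by
    have aux : ∀ e ∈ U₁, ¬ Acc (W.Prel p₁) e → e ∈ U₁ ∧ W.tail e ≠ W.s ∧ ¬ Acc (W.Prel p₁) e :=
      fun e h1 h2 => ⟨h1, fun h3 => h2 (acc_of_source h3), h2⟩
    intro n
    induction n with
    | zero => exact aux _ hq hn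
    | succ n ih =>
      rw [hsucc]
      exact aux _ (hmem _ ih.1 ih.2.1) fun h => ih.2.2 (acc_of_pred h)
  have hxinj : ∀ i k, x i = x (i + k + 1) → False := by
    intro i
    induction i with
    | zero =>
      intro k hk
      rw [hsucc] at hk
      exact htip _ (hbad _).1 (hbad _).2.1 hk.symm
    | succ i ih =>
      intro k hk
      refine ih k (hinj _ (hbad _).1 _ (hbad _).1 (hbad _).2.1 (hbad _).2.1 ?_)
      rw [← hsucc, ← hsucc, hk]
      congr 1
      omega
  have hinjx : Function.Injective x := by
    intro i j hij
    rcases lt_trichotomy i j with h | h | h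
    · exact (hxinj i (j - i - 1) (by rw [hij]; congr 1; omega)).elim
    · exact h
    · exact (hxinj j (i - j - 1) (by rw [← hij]; congr 1; omega)).elim
  obtain ⟨N, hN⟩ : ∃ N, ∀ n ≥ N, x n ∉ (U₁ \ U) ∪ {e | e ∈ U₁ ∧ W.tail e ≠ W.s ∧ p₁ e ≠ p e} := by
    have hfin := Set.Finite.preimage (hinjx.injOn) (hU.union hp)
    obtain ⟨N, hN⟩ := hfin.bddAbove
    exact ⟨N + 1, fun n hn h => by have := hN (show n ∈ _ from h); omega⟩
  have key : ∀ e, Acc (W.Prel p) e → ∀ n ≥ N, x n ≠ e := by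
    intro e he
    induction he with
    | intro e _ ih =>
      intro n hn hxe
      refine ih (p e) ⟨?_, rfl⟩ (n + 1) (by omega) ?_
      · rw [← hxe]; exact (hbad n).2.1
      · rw [hsucc, hxe.symm]
        by_contra h
        exact hN n hn (Or.inr ⟨(hbad n).1, (hbad n).2.1, h⟩)
  have hNU : x N ∈ U := by
    by_contra h
    exact hN N le_rfl (Or.inl ⟨(hbad N).1, h⟩)
  exact key _ (hacc _ hNU) N le_rfl rfl

variable (W) in
/-- Vertices reachable in at most `n` steps in the residual digraph of `U`. -/
inductive ReachIn (H U : Set E) (c : E) : ℕ → V → Prop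
  | base : ReachIn H U c 0 (W.head c)
  | succ {n : ℕ} {y : V} : ReachIn H U c n y → ReachIn H U c (n + 1) y
  | fwd {n : ℕ} {e : E} : ReachIn H U c n (W.tail e) → e ∈ H → e ∉ U →
      ReachIn H U c (n + 1) (W.head e)
  | bwd {n : ℕ} {e : E} : ReachIn H U c n (W.head e) → e ∈ U → W.tail e ≠ W.s →
      ReachIn H U c (n + 1) (W.tail e)

theorem Reach.exists_reachIn {H U : Set E} {c : E} {y : V} (h : W.Reach H U c y) :
    ∃ n, W.ReachIn H U c n y := by
  induction h with
  | base => exact ⟨0, .base⟩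
  | fwd _ h1 h2 ih => obtain ⟨n, hn⟩ := ih; exact ⟨n + 1, .fwd hn h1 h2⟩
  | bwd _ h1 h2 ih => obtain ⟨n, hn⟩ := ih; exact ⟨n + 1, .bwd hn h1 h2⟩

theorem ReachIn.reach {H U : Set E} {c : E} {n : ℕ} {y : V} (h : W.ReachIn H U c n y) :
    W.Reach H U c y := by
  induction h with
  | base => exact .base
  | succ _ ih => exact ih
  | fwd _ h1 h2 ih => exact .fwd ih h1 h2
  | bwd _ h1 h2 ih => exact .bwd ih h1 h2

variable (W) in
/-- A flow without well-foundedness, obtained from `U, p` by modifications inside `R` (and adding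
the source edge `c`), in which `q` has no successor. -/
structure PreTip (H U : Set E) (p : E → E) (c : E) (R : V → Prop) (U₁ : Set E) (p₁ : E → E)
    (q : E) : Prop where
  sub : U₁ ⊆ H
  mem : ∀ e ∈ U₁, W.tail e ≠ W.s → p₁ e ∈ U₁
  head_eq : ∀ e ∈ U₁, W.tail e ≠ W.s → W.head (p₁ e) = W.tail e
  inj : ∀ e ∈ U₁, ∀ f ∈ U₁, W.tail e ≠ W.s → W.tail f ≠ W.s → p₁ e = p₁ f → e = f
  fin : (U₁ \ U).Finite
  fin_pred : {e | e ∈ U₁ ∧ W.tail e ≠ W.s ∧ p₁ e ≠ p e}.Finite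
  tip_mem : q ∈ U₁
  tip : ∀ e ∈ U₁, W.tail e ≠ W.s → p₁ e ≠ q
  added : ∀ e ∈ U₁, e ∉ U → e = c ∨ R (W.tail e) ∧ R (W.head e)
  removed : ∀ e ∈ U, e ∉ U₁ → R (W.tail e) ∧ R (W.head e)

theorem ReachIn.exists_preTip {H U : Set E} {p : E → E} {c : E} (hF : W.Flow H U p) (hc : c ∈ H)
    (hcs : W.tail c = W.s) (hcU : c ∉ U) (n : ℕ) :
    ∀ y, W.ReachIn H U c n y → ∃ U₁ p₁ q, W.PreTip H U p c (W.ReachIn H U c n) U₁ p₁ q ∧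
      W.head q = y := by
  classical
  induction n with
  | zero =>
    intro y hy
    refine ⟨insert c U, p, c, ?_, by cases hy; rfl⟩
    constructor
    · exact Set.insert_subset hc hF.sub
    · rintro e (rfl | he) hs
      exacts [absurd hcs hs, Or.inr (hF.mem e he hs)]
    · rintro e (rfl | he) hs
      exacts [absurd hcs hs, hF.head_eq e he hs]
    · rintro e (rfl | he) f (rfl | hf) hes hfs
      · exact fun _ => rfl
      · exact absurd hcs hes
      · exact absurd hcs hfs
      · exact hF.inj e he f hf hes hfs
    · refine (Set.finite_singleton c).subset ?_
      rintro e ⟨rfl | he, h⟩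
      exacts [rfl, absurd he h]
    · convert Set.finite_empty
      ext e
      simp
    · exact Set.mem_insert _ _
    · rintro e (rfl | he) hs h
      exacts [hs hcs, hcU (h ▸ hF.mem e he hs)]
    · rintro e (rfl | he) h
      exacts [Or.inl rfl, absurd he h]
    · exact fun e he h => absurd (Or.inr he) h
  | succ n ih =>
    intro y hy
    by_cases hyn : W.ReachIn H U c n y
    · obtain ⟨U₁, p₁, q, h, hq⟩ := ih y hyn
      exact ⟨U₁, p₁, q, { h with
        added := fun e h1 h2 => (h.added e h1 h2).imp id fun h => ⟨h.1.succ, h.2.succ⟩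
        removed := fun e h1 h2 => ⟨(h.removed e h1 h2).1.succ, (h.removed e h1 h2).2.succ⟩ }, hq⟩
    cases hy with
    | succ h => exact absurd h hyn
    | @fwd _ e h1 h2 h3 =>
      obtain ⟨U₁, p₁, q, h, hq⟩ := ih _ h1
      have heU : e ∉ U₁ := by
        intro h4
        rcases h.added e h4 h3 with rfl | h5
        · exact h1.reach.ne_s hcs
        · exact hyn h5.2
      have hpe : ∀ g ∈ U₁, W.tail g ≠ W.s → p₁ g ≠ e := fun g hg hgs hge =>
        heU (hge ▸ h.mem g hg hgs)
      have hne : ∀ g ∈ U₁, g ≠ e := fun g hg h => heU (h ▸ hg)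
      refine ⟨insert e U₁, Function.update p₁ e q, e, ?_, rfl⟩
      constructor
      · exact Set.insert_subset h2 h.sub
      · rintro g (rfl | hg) hs
        · rw [Function.update_self]; exact Or.inr h.tip_mem
        · rw [Function.update_of_ne (hne g hg)]; exact Or.inr (h.mem g hg hs)
      · rintro g (rfl | hg) hs
        · rw [Function.update_self]; exact hq
        · rw [Function.update_of_ne (hne g hg)]; exact h.head_eq g hg hs
      · rintro g (rfl | hg) f (rfl | hf) hgs hfs
        · exact fun _ => rfl
        · rw [Function.update_self, Function.update_of_ne (hne f hf)]
          exact fun h' => absurd h'.symm (h.tip f hf hfs)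
        · rw [Function.update_self, Function.update_of_ne (hne g hg)]
          exact fun h' => absurd h' (h.tip g hg hgs)
        · rw [Function.update_of_ne (hne g hg), Function.update_of_ne (hne f hf)]
          exact h.inj g hg f hf hgs hfs
      · refine (h.fin.insert e).subset ?_
        rintro g ⟨rfl | hg, hgU⟩
        exacts [Or.inl rfl, Or.inr ⟨hg, hgU⟩]
      · refine (h.fin_pred.insert e).subset ?_
        rintro g ⟨rfl | hg, hgs, hgp⟩
        · exact Or.inl rfl
        · rw [Function.update_of_ne (hne g hg)] at hgp
          exact Or.inr ⟨hg, hgs, hgp⟩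
      · exact Set.mem_insert _ _
      · rintro g (rfl | hg) hs
        · rw [Function.update_self]; exact hne _ h.tip_mem
        · rw [Function.update_of_ne (hne g hg)]; exact hpe g hg hs
      · rintro g (rfl | hg) hgU
        · exact Or.inr ⟨h1.succ, h1.fwd h2 h3⟩
        · exact (h.added g hg hgU).imp id fun h => ⟨h.1.succ, h.2.succ⟩
      · intro g hg hgU
        have := h.removed g hg fun h' => hgU (Or.inr h')
        exact ⟨this.1.succ, this.2.succ⟩
    | @bwd _ e h1 h2 h3 =>
      obtain ⟨U₁, p₁, q, h, hq⟩ := ih _ h1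
      have heU : e ∈ U₁ := by
        by_contra h4
        exact hyn (h.removed e h2 h4).1
      have hloop : p₁ e ≠ e := by
        intro h4
        have h5 := h.head_eq e heU h3
        rw [h4] at h5
        rw [h5] at h1
        exact hyn h1
      have huniq : ∀ g ∈ U₁, W.tail g ≠ W.s → g ≠ e → p₁ g ≠ p₁ e := fun g hg hgs hge h' =>
        hge (h.inj g hg e heU hgs h3 h')
      refine ⟨U₁ \ {e}, fun g => if p₁ g = e then q else p₁ g, p₁ e, ?_, h.head_eq e heU h3⟩
      have hqe : ∀ g ∈ U₁, W.tail g ≠ W.s → p₁ g = e → q ≠ e := fun g hg hgs hge hqe =>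
        h.tip g hg hgs (hge.trans hqe.symm)
      constructor
      · exact Set.sdiff_subset.trans h.sub
      · rintro g ⟨hg, hge⟩ hs
        by_cases h5 : p₁ g = e
        · simp only [h5, if_true]; exact ⟨h.tip_mem, hqe g hg hs h5⟩
        · simp only [h5, if_false]; exact ⟨h.mem g hg hs, h5⟩
      · rintro g ⟨hg, hge⟩ hs
        by_cases h5 : p₁ g = e
        · simp only [h5, if_true]; rw [hq, ← h5, h.head_eq g hg hs]
        · simp only [h5, if_false]; exact h.head_eq g hg hs
      · rintro g ⟨hg, hge⟩ f ⟨hf, hfe⟩ hgs hfs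
        by_cases h5 : p₁ g = e <;> by_cases h6 : p₁ f = e
        · exact fun _ => h.inj g hg f hf hgs hfs (h5.trans h6.symm)
        · simp only [h5, h6, if_true, if_false]; exact fun h' => absurd h'.symm (h.tip f hf hfs)
        · simp only [h5, h6, if_true, if_false]; exact fun h' => absurd h' (h.tip g hg hgs)
        · simp only [h5, h6, if_false]; exact h.inj g hg f hf hgs hfs
      · exact h.fin.subset fun g hg => ⟨hg.1.1, hg.2⟩
      · have : {g | g ∈ U₁ ∧ W.tail g ≠ W.s ∧ p₁ g = e}.Subsingleton := fun g hg f hf =>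
          h.inj g hg.1 f hf.1 hg.2.1 hf.2.1 (hg.2.2.trans hf.2.2.symm)
        refine (this.finite.union h.fin_pred).subset ?_
        rintro g ⟨⟨hg, _⟩, hgs, hgp⟩
        by_cases h5 : p₁ g = e
        · exact Or.inl ⟨hg, hgs, h5⟩
        · rw [if_neg h5] at hgp
          exact Or.inr ⟨hg, hgs, hgp⟩
      · exact ⟨h.mem e heU h3, hloop⟩
      · rintro g ⟨hg, hge⟩ hs
        by_cases h5 : p₁ g = e
        · simp only [h5, if_true]; exact (h.tip e heU h3).symm
        · simp only [h5, if_false]; exact huniq g hg hs hge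
      · rintro g ⟨hg, _⟩ hgU
        exact (h.added g hg hgU).imp id fun h => ⟨h.1.succ, h.2.succ⟩
      · intro g hg hgU
        by_cases h5 : g = e
        · subst h5; exact ⟨h1.bwd h2 h3, h1.succ⟩
        · have := h.removed g hg fun h' => hgU ⟨h', h5⟩
          exact ⟨this.1.succ, this.2.succ⟩

/-- Augmentation: a residually reachable vertex can be linked from `s` in addition to all ends of
the flow outside `X`. -/
theorem Flow.exists_tip {H U : Set E} {p : E → E} {c : E} (hF : W.Flow H U p) (hc : c ∈ H)
    (hcs : W.tail c = W.s) (hcU : c ∉ U) {X : Set V} (hs : W.s ∈ X)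
    (hX : ∀ y, W.Reach H U c y → y ∈ X) (htail : ∀ e ∈ U, W.tail e ∈ X) {y : V}
    (hy : W.Reach H U c y) :
    ∃ U₁ p₁ q, W.Flow H U₁ p₁ ∧ q ∈ U₁ ∧ W.head q = y ∧
      (∀ e ∈ U₁, W.tail e ≠ W.s → p₁ e ≠ q) ∧ (∀ e ∈ U₁, W.tail e ∈ X) ∧
      (∀ e ∈ U, W.head e ∉ X → e ∈ U₁) := by
  obtain ⟨n, hn⟩ := hy.exists_reachIn
  obtain ⟨U₁, p₁, q, h, hq⟩ := hn.exists_preTip hF hc hcs hcU n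
  have htail₁ : ∀ e ∈ U₁, W.tail e ∈ X := by
    intro e he
    by_cases heU : e ∈ U
    · exact htail e heU
    · rcases h.added e he heU with rfl | h1
      · rwa [hcs]
      · exact hX _ h1.1.reach
  have hacc : ∀ e ∈ U₁, (∀ g ∈ U₁, W.tail g ≠ W.s → p₁ g ≠ e) → Acc (W.Prel p₁) e :=
    fun e he h' => acc_of_finite_modification hF.acc h.mem h.inj h.fin h.fin_pred he h'
  refine ⟨{e | e ∈ U₁ ∧ Acc (W.Prel p₁) e}, p₁, q, ?_, ⟨h.tip_mem, hacc q h.tip_mem h.tip⟩, hq,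
    fun e he => h.tip e he.1, fun e he => htail₁ e he.1, ?_⟩
  · exact
      { sub := fun e he => h.sub he.1
        mem := fun e he hes => ⟨h.mem e he.1 hes, acc_pred he.2 hes⟩
        head_eq := fun e he => h.head_eq e he.1
        inj := fun e he f hf => h.inj e he.1 f hf.1
        acc := fun e he => he.2 }
  · intro e he heX
    have he₁ : e ∈ U₁ := by
      by_contra h'
      exact heX (hX _ (h.removed e he h').2.reach)
    refine ⟨he₁, hacc e he₁ fun g hg hgs hge => heX ?_⟩
    rw [← hge, h.head_eq g hg hgs]
    exact htail₁ g hg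

theorem Flow.insert {H U : Set E} {p : E → E} (h : W.Flow H U p) {f q : E} (hf : f ∉ U)
    (hq : q ∈ U) (hqf : W.head q = W.tail f) (htip : ∀ e ∈ U, W.tail e ≠ W.s → p e ≠ q) :
    ∃ p', W.Flow (insert f H) (insert f U) p' ∧ (∀ e ∈ U, p' e = p e) ∧ p' f = q := by
  classical
  have hne : ∀ g ∈ U, g ≠ f := fun g hg h => hf (h ▸ hg)
  have hacc : ∀ e ∈ U, Acc (W.Prel (Function.update p f q)) e := by
    intro e he
    have := h.acc e he
    induction this with
    | intro e _ ih =>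
      by_cases hes : W.tail e = W.s
      · exact acc_of_source hes
      · apply acc_of_pred
        rw [Function.update_of_ne (hne e he)]
        exact ih _ ⟨hes, rfl⟩ (h.mem e he hes)
  refine ⟨Function.update p f q, ?_, fun e he => Function.update_of_ne (hne e he) _ _,
    Function.update_self _ _ _⟩
  constructor
  · exact Set.insert_subset_insert h.sub
  · rintro g (rfl | hg) hs
    · rw [Function.update_self]; exact Or.inr hq
    · rw [Function.update_of_ne (hne g hg)]; exact Or.inr (h.mem g hg hs)
  · rintro g (rfl | hg) hs
    · rw [Function.update_self]; exact hqf
    · rw [Function.update_of_ne (hne g hg)]; exact h.head_eq g hg hs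
  · rintro g (rfl | hg) f' (rfl | hf') hgs hfs
    · exact fun _ => rfl
    · rw [Function.update_self, Function.update_of_ne (hne f' hf')]
      exact fun h' => absurd h'.symm (htip f' hf' hfs)
    · rw [Function.update_self, Function.update_of_ne (hne g hg)]
      exact fun h' => absurd h' (htip g hg hgs)
    · rw [Function.update_of_ne (hne g hg), Function.update_of_ne (hne f' hf')]
      exact h.inj g hg f' hf' hgs hfs
  · rintro g (rfl | hg)
    · apply acc_of_pred
      rw [Function.update_self]
      exact hacc q hq
    · exact hacc g hg

/-- Augmentation by an edge `f` outside `H` with reachable tail. -/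
theorem Flow.exists_augment {H U : Set E} {p : E → E} {c : E} (hF : W.Flow H U p) (hc : c ∈ H)
    (hcs : W.tail c = W.s) (hcU : c ∉ U) {X : Set V} (hs : W.s ∈ X)
    (hX : ∀ y, W.Reach H U c y → y ∈ X) (htail : ∀ e ∈ U, W.tail e ∈ X) {f : E} (hfH : f ∉ H)
    (hf : W.Reach H U c (W.tail f)) :
    ∃ U₁ p₁, W.Flow (Insert.insert f H) U₁ p₁ ∧ f ∈ U₁ ∧ (∀ e ∈ U₁, W.tail e ∈ X) ∧
      (∀ e ∈ U, W.head e ∉ X → e ∈ U₁) := by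
  obtain ⟨U₁, p₁, q, h1, h2, h3, h4, h5, h6⟩ := hF.exists_tip hc hcs hcU hs hX htail hf
  obtain ⟨p', h7, -, -⟩ := h1.insert (fun h => hfH (h1.sub h)) h2 h3 h4
  refine ⟨_, p', h7, Set.mem_insert _ _, ?_, fun e he h => Or.inr (h6 e he h)⟩
  rintro e (rfl | he)
  exacts [hX _ hf, h5 e he]

theorem IsWave.exists_augment {H U : Set E} {X : Set V} {p : E → E} {c : E}
    (h : W.IsWave H X U p) (hc : c ∈ H) (hcs : W.tail c = W.s) (hcU : c ∉ U) {f : E} (hfH : f ∉ H)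
    (hf : W.Reach H U c (W.tail f)) :
    ∃ U₁ p₁, W.IsWave (Insert.insert f H) X U₁ p₁ := by
  obtain ⟨U₁, p₁, h1, h2, h3, h4⟩ := h.toFlow.exists_augment hc hcs hcU h.s_mem
    (fun y hy => h.reach_subset hc hcs hcU hy) h.tail_mem hfH hf
  refine ⟨U₁, p₁, ⟨h1, h.s_mem, h.t_notMem, h3, ?_⟩⟩
  rintro e (rfl | he) h5 h6
  exacts [h2, h4 e (h.exit e he h5 h6) h6]

open Relation

theorem Flow.anc_mem {H U : Set E} {p : E → E} (h : W.Flow H U p) {a g : E} (hg : g ∈ U)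
    (ha : ReflTransGen (W.Prel p) a g) : a ∈ U := by
  induction ha using ReflTransGen.head_induction_on with
  | refl => exact hg
  | head h1 _ ih => rw [h1.2]; exact h.mem _ ih h1.1

theorem Flow.exists_root {H U : Set E} {p : E → E} (h : W.Flow H U p) {g : E} (hg : g ∈ U) :
    ∃ c ∈ U, W.tail c = W.s ∧ ReflTransGen (W.Prel p) c g := by
  have := h.acc g hg
  induction this with
  | intro g _ ih =>
    by_cases hs : W.tail g = W.s
    · exact ⟨g, hg, hs, .refl⟩
    · obtain ⟨c, h1, h2, h3⟩ := ih (p g) ⟨hs, rfl⟩ (h.mem g hg hs)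
      exact ⟨c, h1, h2, h3.tail ⟨hs, rfl⟩⟩

/-- Deleting the walk of a wave that ends in the exit `g`. -/
theorem IsWave.delete_chain {G : Set E} {X : Set V} {U : Set E} {p : E → E}
    (h : W.IsWave G X U p) {g : E} (hg : g ∈ U) (hgX : W.head g ∉ X) {G' : Set E} (hG' : G' ⊆ G)
    (hgG' : g ∉ G') (hU : {u ∈ U | ¬ ReflTransGen (W.Prel p) u g} ⊆ G') :
    W.IsWave G' X {u ∈ U | ¬ ReflTransGen (W.Prel p) u g} p := by
  constructor
  · constructor
    · exact hU
    · rintro u ⟨hu, hug⟩ hs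
      refine ⟨h.mem u hu hs, fun h1 => hug ?_⟩
      rcases ReflTransGen.cases_head h1 with h2 | ⟨b, h2, h3⟩
      · refine absurd (h.tail_mem u hu) ?_
        rwa [← h.head_eq u hu hs, h2]
      · rwa [h.inj u hu b (h.anc_mem hg h3) hs h2.1 h2.2]
    · exact fun u hu => h.head_eq u hu.1
    · exact fun u hu w hw => h.inj u hu.1 w hw.1
    · exact fun u hu => h.acc u hu.1
  · exact h.s_mem
  · exact h.t_notMem
  · exact fun u hu => h.tail_mem u hu.1
  · intro u hu h1 h2
    have huU := h.exit u (hG' hu) h1 h2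
    refine ⟨huU, fun h3 => ?_⟩
    rcases ReflTransGen.cases_head h3 with rfl | ⟨b, h4, h5⟩
    · exact hgG' hu
    · refine h2 ?_
      rw [h4.2, h.head_eq b (h.anc_mem hg h5) h4.1]
      exact h.tail_mem b (h.anc_mem hg h5)

/-- If a hindrance of `G \ {e}` exists although `G` is unhindered, then `e` leaves some wave. -/
theorem exists_wave_of_hindered_diff {G : Set E} (hG : ¬ W.Hindered G) {e : E} (he : e ∈ G)
    (h : W.Hindered (G \ {e})) :
    ∃ X U p, W.IsWave G X U p ∧ W.tail e ∈ X ∧ W.head e ∉ X ∧ W.tail e ≠ W.s := by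
  obtain ⟨X, U, p, c, hW, hc, hcs, hcU, hr⟩ := h.strong
  have heU : e ∉ U := fun h => (hW.sub h).2 rfl
  have hsub : U ⊆ G := hW.sub.trans Set.sdiff_subset
  have hex : W.tail e ∈ X ∧ W.head e ∉ X := by
    by_contra hn
    refine hG ⟨X, U, p, c, hW.mono hsub fun f hf h1 h2 => ?_, hc.1, hcs, hcU⟩
    refine Or.inl ⟨hf, ?_⟩
    rintro rfl
    exact hn ⟨h1, h2⟩
  by_cases hes : W.tail e = W.s
  · refine absurd ⟨X, insert e U, p, c, ?_, hc.1, hcs, ?_⟩ hG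
    · constructor
      · constructor
        · exact Set.insert_subset he hsub
        · rintro f (rfl | hf) hs
          exacts [absurd hes hs, Or.inr (hW.mem f hf hs)]
        · rintro f (rfl | hf) hs
          exacts [absurd hes hs, hW.head_eq f hf hs]
        · rintro f (rfl | hf) g (rfl | hg) hfs hgs
          exacts [fun _ => rfl, absurd hes hfs, absurd hes hgs, hW.inj f hf g hg hfs hgs]
        · rintro f (rfl | hf)
          exacts [acc_of_source hes, hW.acc f hf]
      · exact hW.s_mem
      · exact hW.t_notMem
      · rintro f (rfl | hf)
        exacts [hex.1, hW.tail_mem f hf]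
      · intro f hf h1 h2
        by_cases hfe : f = e
        · exact Or.inl hfe
        · exact Or.inr (hW.exit f ⟨hf, hfe⟩ h1 h2)
    · rintro (h1 | h1)
      exacts [hc.2 h1, hcU h1]
  · obtain ⟨U₁, p₁, h1⟩ := hW.exists_augment hc hcs hcU (f := e) (fun h => h.2 rfl)
      (hr _ hex.1 hes)
    rw [Set.insert_sdiff_singleton, Set.insert_eq_of_mem he] at h1
    exact ⟨X, U₁, p₁, h1, hex.1, hex.2, hes⟩

theorem not_hindered_diff_source {G : Set E} (hG : ¬ W.Hindered G) {a : E} (ha : a ∈ G)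
    (has : W.tail a = W.s) : ¬ W.Hindered (G \ {a}) := fun h => by
  obtain ⟨X, U, p, -, -, -, h1⟩ := exists_wave_of_hindered_diff hG ha h
  exact h1 has

/-- If neither `G` nor `G \ {e}` is hindered, then no wave of `G` is left by `e`, and waves of `G`
are waves of `G \ {e}`. -/
theorem IsWave.diff_singleton {G : Set E} {e : E} (hGe : ¬ W.Hindered (G \ {e}))
    (hes : W.tail e ≠ W.s) {X : Set V} {U : Set E} {p : E → E} (h : W.IsWave G X U p) :
    ¬ (e ∈ G ∧ W.tail e ∈ X ∧ W.head e ∉ X) ∧ ∃ U' p', W.IsWave (G \ {e}) X U' p' := by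
  have hnex : ¬ (e ∈ G ∧ W.tail e ∈ X ∧ W.head e ∉ X) := by
    rintro ⟨he, h1, h2⟩
    have heU := h.exit e he h1 h2
    obtain ⟨c, hcU, hcs, hce⟩ := h.exists_root heU
    refine hGe ⟨X, _, p, c, h.delete_chain heU h2 Set.sdiff_subset (fun h => h.2 rfl) ?_,
      ⟨h.sub hcU, ?_⟩, hcs, fun h => h.2 hce⟩
    · rintro u ⟨hu, hue⟩
      refine ⟨h.sub hu, ?_⟩
      rintro rfl
      exact hue .refl
    · rintro rfl
      exact hes hcs
  refine ⟨hnex, ?_⟩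
  by_cases hg : ∃ g ∈ U, W.head g ∉ X ∧ ReflTransGen (W.Prel p) e g
  · obtain ⟨g, hgU, hgX, heg⟩ := hg
    have heU := h.anc_mem hgU heg
    have hge : g ≠ e := by
      rintro rfl
      exact hnex ⟨h.sub heU, h.tail_mem g heU, hgX⟩
    have hgs : W.tail g ≠ W.s := by
      intro h1
      rcases ReflTransGen.cases_tail heg with h2 | ⟨b, -, h3⟩
      exacts [hge h2, h3.1 h1]
    obtain ⟨c, hcU, hcs, hce⟩ := h.exists_root hgU
    have hw := h.delete_chain (G' := (G \ {e}) \ {g}) hgU hgX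
      (Set.sdiff_subset.trans Set.sdiff_subset) (fun h => h.2 rfl) (by
        rintro u ⟨hu, hug⟩
        refine ⟨⟨h.sub hu, ?_⟩, ?_⟩
        · rintro rfl; exact hug heg
        · rintro rfl; exact hug .refl)
    have hc : c ∈ (G \ {e}) \ {g} := by
      refine ⟨⟨h.sub hcU, ?_⟩, ?_⟩
      · rintro rfl; exact hes hcs
      · rintro rfl; exact hgs hcs
    have hcU' : c ∉ {u ∈ U | ¬ ReflTransGen (W.Prel p) u g} := fun h => h.2 hce
    have hgG : g ∈ G \ {e} := ⟨h.sub hgU, hge⟩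
    by_cases hr : W.Reach ((G \ {e}) \ {g}) {u ∈ U | ¬ ReflTransGen (W.Prel p) u g} c (W.tail g)
    · obtain ⟨U₁, p₁, h1⟩ := hw.exists_augment hc hcs hcU' (f := g) (fun h => h.2 rfl) hr
      rw [Set.insert_sdiff_singleton, Set.insert_eq_of_mem hgG] at h1
      exact ⟨_, _, h1⟩
    · obtain ⟨U', h1, h2, -⟩ := hw.reach hc hcs hcU'
      refine absurd ⟨_, U', p, c, h1.mono (h1.sub.trans Set.sdiff_subset) ?_, hc.1, hcs, h2⟩ hGe
      intro f hf h3 h4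
      by_cases hfg : f = g
      · subst hfg
        exact absurd h3 (by rintro (h5 | h5); exacts [hgs h5, hr h5])
      · exact Or.inl ⟨hf, hfg⟩
  · refine ⟨{u ∈ U | ¬ ReflTransGen (W.Prel p) e u}, p, ?_⟩
    constructor
    · constructor
      · rintro u ⟨hu, heu⟩
        refine ⟨h.sub hu, ?_⟩
        rintro rfl
        exact heu .refl
      · exact fun u hu hs => ⟨h.mem u hu.1 hs, fun h1 => hu.2 (h1.tail ⟨hs, rfl⟩)⟩
      · exact fun u hu => h.head_eq u hu.1
      · exact fun u hu w hw => h.inj u hu.1 w hw.1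
      · exact fun u hu => h.acc u hu.1
    · exact h.s_mem
    · exact h.t_notMem
    · exact fun u hu => h.tail_mem u hu.1
    · intro u hu h1 h2
      have huU := h.exit u hu.1 h1 h2
      exact ⟨huU, fun h3 => hg ⟨u, huU, h2, h3⟩⟩

/-- `i` is the first index whose set contains `y`. -/
def First {ι : Type w} [LT ι] (Y : ι → Set V) (i : ι) (y : V) : Prop :=
  y ∈ Y i ∧ ∀ j < i, y ∉ Y j

theorem First.unique {ι : Type w} [LinearOrder ι] {Y : ι → Set V} {i j : ι} {y : V}
    (hi : First Y i y) (hj : First Y j y) : i = j := by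
  rcases lt_trichotomy i j with h | h | h
  exacts [absurd hi.1 (hj.2 _ h), h, absurd hj.1 (hi.2 _ h)]

theorem First.le {ι : Type w} [LinearOrder ι] {Y : ι → Set V} {i j : ι} {y : V}
    (hi : First Y i y) (hj : y ∈ Y j) : i ≤ j := not_lt.1 fun h => hi.2 _ h hj

theorem exists_first {ι : Type w} [LinearOrder ι] [WellFoundedLT ι] {Y : ι → Set V} {i : ι} {y : V}
    (h : y ∈ Y i) : ∃ j, First Y j y := by
  obtain ⟨j, h1, h2⟩ := WellFounded.has_min (wellFounded_lt (α := ι)) {j | y ∈ Y j} ⟨i, h⟩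
  exact ⟨j, h1, fun k hk hyk => h2 k hyk hk⟩

/-- Gluing a well-ordered family of flows `U i` along the sets `Y i`, where the edges of `T₁` are
dealt with by a separate flow `U₀`. -/
theorem glue {ι : Type w} [LinearOrder ι] [WellFoundedLT ι] {H : Set E} {Y : ι → Set V}
    {U : ι → Set E} {p : ι → E → E} {T₁ U₀ : Set E} {p₀ : E → E} (h₀ : W.Flow H U₀ p₀)
    (h₀T : U₀ ⊆ T₁)
    (hhead : ∀ i, ∀ e ∈ U i, W.tail e ≠ W.s → W.head (p i e) = W.tail e)
    (htail : ∀ i, ∀ e ∈ U i, W.tail e ≠ W.s → W.tail (p i e) ∈ Y i)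
    (hinj : ∀ i, ∀ e ∈ U i, ∀ f ∈ U i, W.tail e ≠ W.s → W.tail f ≠ W.s → p i e = p i f → e = f)
    (hacc : ∀ i, ∀ e ∈ U i, Acc (W.Prel (p i)) e)
    (hA : ∀ i, ∀ e ∈ U i, e ∈ H → e ∉ T₁ → First Y i (W.tail e) → W.tail e ≠ W.s →
      p i e ∈ U₀ ∨ (p i e ∉ T₁ ∧ p i e ∈ H ∧
        (W.tail (p i e) ≠ W.s → ∀ j, First Y j (W.tail (p i e)) → p i e ∈ U j)))
    (hB : ∀ i, ∀ e ∈ U i, e ∈ H → e ∉ T₁ → First Y i (W.tail e) → W.tail e ≠ W.s →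
      ∀ g ∈ U₀, W.tail g ≠ W.s → p i e ≠ p₀ g) :
    ∃ q, W.Flow H (U₀ ∪ {e | e ∈ H ∧ e ∉ T₁ ∧
      (W.tail e = W.s ∨ ∃ i, First Y i (W.tail e) ∧ e ∈ U i)}) q := by
  classical
  set q : E → E := fun e => if e ∈ U₀ then p₀ e else
    if h : ∃ i, First Y i (W.tail e) then p h.choose e else p₀ e with hq
  have hq₀ : ∀ e ∈ U₀, q e = p₀ e := fun e he => if_pos he
  have hq₁ : ∀ i, ∀ e, e ∉ U₀ → First Y i (W.tail e) → q e = p i e := by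
    intro i e he hi
    have h : ∃ i, First Y i (W.tail e) := ⟨i, hi⟩
    simp only [hq, if_neg he, dif_pos h]
    rw [h.choose_spec.unique hi]
  have hacc₀ : ∀ e ∈ U₀, Acc (W.Prel q) e := by
    intro e he
    have := h₀.acc e he
    induction this with
    | intro e _ ih =>
      by_cases hes : W.tail e = W.s
      · exact acc_of_source hes
      · apply acc_of_pred
        rw [hq₀ e he]
        exact ih _ ⟨hes, rfl⟩ (h₀.mem e he hes)
  have hcases : ∀ i, ∀ e ∈ U i, e ∈ H → e ∉ T₁ → First Y i (W.tail e) → W.tail e ≠ W.s →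
      p i e ∈ U₀ ∨ p i e ∉ T₁ ∧ p i e ∈ H ∧ (W.tail (p i e) = W.s ∨ ∃ j ≤ i,
        First Y j (W.tail (p i e)) ∧ p i e ∈ U j) := by
    intro i e he heH heT hi hs
    rcases hA i e he heH heT hi hs with h | ⟨h1, h2, h3⟩
    · exact Or.inl h
    · refine Or.inr ⟨h1, h2, ?_⟩
      by_cases h4 : W.tail (p i e) = W.s
      · exact Or.inl h4
      · obtain ⟨j, hj⟩ := exists_first (htail i e he hs)
        exact Or.inr ⟨j, hj.le (htail i e he hs), hj, h3 h4 j hj⟩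
  have hacc₁ : ∀ i, ∀ e ∈ U i, e ∈ H → e ∉ T₁ → First Y i (W.tail e) → Acc (W.Prel q) e := by
    intro i
    induction i using WellFoundedLT.induction with
    | ind i ihi =>
      intro e he
      have := hacc i e he
      induction this with
      | intro e _ ih =>
        intro heH heT hi
        by_cases hes : W.tail e = W.s
        · exact acc_of_source hes
        apply acc_of_pred
        rw [hq₁ i e (fun h => heT (h₀T h)) hi]
        rcases hcases i e he heH heT hi hes with h | ⟨h1, h2, h3 | ⟨j, h3, h4, h5⟩⟩
        · exact hacc₀ _ h
        · exact acc_of_source h3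
        · rcases h3.lt_or_eq with h6 | rfl
          · exact ihi j h6 _ h5 h2 h1 h4
          · exact ih _ ⟨hes, rfl⟩ h5 h2 h1 h4
  refine ⟨q, ?_, ?_, ?_, ?_, ?_⟩
  · rintro e (he | ⟨he, _⟩)
    exacts [h₀.sub he, he]
  · rintro e (he | ⟨heH, heT, he⟩) hs
    · rw [hq₀ e he]; exact Or.inl (h₀.mem e he hs)
    · obtain ⟨i, hi, he⟩ := he.resolve_left hs
      rw [hq₁ i e (fun h => heT (h₀T h)) hi]
      rcases hcases i e he heH heT hi hs with h | ⟨h1, h2, h3⟩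
      · exact Or.inl h
      · refine Or.inr ⟨h2, h1, h3.imp id ?_⟩
        rintro ⟨j, -, h4⟩
        exact ⟨j, h4⟩
  · rintro e (he | ⟨heH, heT, he⟩) hs
    · rw [hq₀ e he]; exact h₀.head_eq e he hs
    · obtain ⟨i, hi, he⟩ := he.resolve_left hs
      rw [hq₁ i e (fun h => heT (h₀T h)) hi]
      exact hhead i e he hs
  · have key : ∀ e, e ∈ U₀ → ∀ f, f ∈ H → f ∉ T₁ → W.tail e ≠ W.s → W.tail f ≠ W.s →
        (W.tail f = W.s ∨ ∃ i, First Y i (W.tail f) ∧ f ∈ U i) → q e ≠ q f := by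
      intro e he f hfH hfT hes hfs hf
      obtain ⟨i, hi, hf⟩ := hf.resolve_left hfs
      rw [hq₀ e he, hq₁ i f (fun h => hfT (h₀T h)) hi]
      exact (hB i f hf hfH hfT hi hfs e he hes).symm
    rintro e (he | ⟨heH, heT, he⟩) f (hf | ⟨hfH, hfT, hf⟩) hes hfs
    · rw [hq₀ e he, hq₀ f hf]; exact h₀.inj e he f hf hes hfs
    · exact fun h => absurd h (key e he f hfH hfT hes hfs hf)
    · exact fun h => absurd h.symm (key f hf e heH heT hfs hes he)
    · obtain ⟨i, hi, he⟩ := he.resolve_left hes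
      obtain ⟨j, hj, hf⟩ := hf.resolve_left hfs
      rw [hq₁ i e (fun h => heT (h₀T h)) hi, hq₁ j f (fun h => hfT (h₀T h)) hj]
      intro h
      have : W.tail e = W.tail f := by
        rw [← hhead i e he hes, ← hhead j f hf hfs, h]
      rw [this] at hi
      obtain rfl := hi.unique hj
      exact hinj i e he f hf hes hfs h
  · rintro e (he | ⟨heH, heT, he⟩)
    · exact hacc₀ e he
    · rcases he with he | ⟨i, hi, he⟩
      exacts [acc_of_source he, hacc₁ i e he heH heT hi]

/-- Gluing flows `U i` whose tails lie in `Y i`. -/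
theorem glue_flows {ι : Type w} [LinearOrder ι] [WellFoundedLT ι] {H : Set E} {Y : ι → Set V}
    {U : ι → Set E} {p : ι → E → E} (hF : ∀ i, W.Flow H (U i) (p i))
    (htail : ∀ i, ∀ e ∈ U i, W.tail e ∈ Y i)
    (hU : ∀ j i, j < i → ∀ e ∈ U i, W.tail e ∈ Y j → W.head e ∉ Y j → W.head e ∈ Y i →
      W.tail e ≠ W.s → e ∈ U j) :
    ∃ q, W.Flow H {e | e ∈ H ∧ (W.tail e = W.s ∨ ∃ i, First Y i (W.tail e) ∧ e ∈ U i)} q := by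
  have h := glue (W := W) (H := H) (Y := Y) (U := U) (p := p) (T₁ := ∅) (U₀ := ∅) (p₀ := id)
    ⟨Set.empty_subset _, by simp, by simp, by simp, by simp⟩ (Set.empty_subset _)
    (fun i => (hF i).head_eq) (fun i e he hs => htail i _ ((hF i).mem e he hs))
    (fun i => (hF i).inj) (fun i => (hF i).acc) ?_ (by simp)
  · simpa using h
  · intro i e he heH _ hi hs
    have hm := (hF i).mem e he hs
    refine Or.inr ⟨Set.notMem_empty _, (hF i).sub hm, fun h1 j hj => ?_⟩
    rcases (hj.le (htail i _ hm)).lt_or_eq with h2 | rfl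
    · have h3 := (hF i).head_eq e he hs
      exact hU j i h2 _ hm hj.1 (h3 ▸ hi.2 j h2) (h3 ▸ hi.1) h1
    · exact hm

/-- The union of a nonempty family of waves is a wave. -/
theorem exists_wave_iUnion {ι : Type w} [Nonempty ι] {H : Set E} {Y : ι → Set V}
    (h : ∀ i, ∃ U p, W.IsWave H (Y i) U p) : ∃ U p, W.IsWave H (⋃ i, Y i) U p := by
  choose U p hW using h
  obtain ⟨_, _⟩ := exists_wellFoundedLT ι
  obtain ⟨q, hq⟩ := glue_flows (fun i => (hW i).toFlow) (fun i => (hW i).tail_mem) (Y := Y)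
    (fun j i _ e he h1 h2 _ _ => (hW j).exit e ((hW i).sub he) h1 h2)
  refine ⟨_, q, hq, ?_, ?_, ?_, ?_⟩
  · exact Set.mem_iUnion.2 ⟨Classical.arbitrary ι, (hW _).s_mem⟩
  · intro ht
    obtain ⟨i, hi⟩ := Set.mem_iUnion.1 ht
    exact (hW i).t_notMem hi
  · rintro e ⟨-, he | ⟨i, hi, -⟩⟩
    · rw [he]; exact Set.mem_iUnion.2 ⟨Classical.arbitrary ι, (hW _).s_mem⟩
    · exact Set.mem_iUnion.2 ⟨i, hi.1⟩
  · intro e he h1 h2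
    obtain ⟨i, hi⟩ := Set.mem_iUnion.1 h1
    obtain ⟨j, hj⟩ := exists_first hi
    exact ⟨he, Or.inr ⟨j, hj, (hW j).exit e he hj.1 fun h3 => h2 (Set.mem_iUnion.2 ⟨j, h3⟩)⟩⟩

variable (W) in
/-- The union of all waves of `H`. -/
def maxWave (H : Set E) : Set V := ⋃ X : {X : Set V // ∃ U p, W.IsWave H X U p}, X.1

theorem isWave_trivial (H : Set E) :
    W.IsWave H {W.s} {e | e ∈ H ∧ W.tail e = W.s} id := by
  constructor
  · constructor
    · exact fun e he => he.1
    · exact fun e he hs => absurd he.2 hs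
    · exact fun e he hs => absurd he.2 hs
    · exact fun e he _ _ hs => absurd he.2 hs
    · exact fun e he => acc_of_source he.2
  · rfl
  · exact W.s_ne_t.symm
  · exact fun e he => he.2
  · exact fun e he h1 _ => ⟨he, h1⟩

variable (W) in
theorem exists_isWave_maxWave (H : Set E) : ∃ U p, W.IsWave H (W.maxWave H) U p := by
  have : Nonempty {X : Set V // ∃ U p, W.IsWave H X U p} := ⟨⟨_, _, _, isWave_trivial H⟩⟩
  exact exists_wave_iUnion fun X => X.2

theorem IsWave.subset_maxWave {H : Set E} {X : Set V} {U : Set E} {p : E → E}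
    (h : W.IsWave H X U p) : X ⊆ W.maxWave H :=
  Set.subset_iUnion (fun X : {X : Set V // ∃ U p, W.IsWave H X U p} => X.1) ⟨X, U, p, h⟩

end Web

open Cardinal Order

section closure

variable {E : Type v}

/-- `K` is closed under the finitary set-valued operation `Φ`. -/
def ListClosed (Φ : List E → Set E) (K : Set E) : Prop := ∀ l, (∀ e ∈ l, e ∈ K) → Φ l ⊆ K

theorem countable_iff_mk_lt {S : Set E} : S.Countable ↔ #S < ℵ₁ := by
  rw [← le_aleph0_iff_set_countable, ← succ_aleph0, Order.lt_succ_iff]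

theorem Set.Finite.subset_of_subset_iUnion_of_monotone {ι : Type w} [LinearOrder ι] [Nonempty ι]
    {c : ι → Set E} (hc : Monotone c) {F : Set E} (hF : F.Finite) (h : F ⊆ ⋃ n, c n) :
    ∃ n, F ⊆ c n := by
  induction F, hF using Set.Finite.induction_on with
  | empty => exact ⟨Classical.arbitrary ι, Set.empty_subset _⟩
  | @insert e F _ _ ih =>
    obtain ⟨n, hn⟩ := ih ((Set.subset_insert _ _).trans h)
    obtain ⟨m, hm⟩ := Set.mem_iUnion.1 (h (Set.mem_insert _ _))
    exact ⟨max n m, Set.insert_subset (hc (le_max_right _ _) hm) (hn.trans (hc (le_max_left _ _)))⟩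

theorem mk_lists_le (S : Set E) : #{l : List E | ∀ e ∈ l, e ∈ S} ≤ max ℵ₀ #S := by
  refine le_trans ?_ (mk_list_le_max S)
  refine mk_le_of_injective (f := fun l => l.1.attach.map fun e => ⟨e.1, l.2 e.1 e.2⟩) ?_
  intro l l' h
  have := congrArg (List.map Subtype.val) h
  apply Subtype.ext
  simpa [List.map_map, Function.comp_def] using this

theorem mk_lists_lt {S : Set E} {κ : Cardinal.{v}} (hκ : ℵ₀ < κ) (hS : #S < κ) :
    #{l : List E | ∀ e ∈ l, e ∈ S} < κ := (mk_lists_le S).trans_lt (max_lt hκ hS)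

theorem mk_biUnion_lists_lt {κ : Cardinal.{v}} (hκ : κ.IsRegular) (h₀ : ℵ₀ < κ)
    {Φ : List E → Set E} (hΦ : ∀ l, #(Φ l) < κ) {S : Set E} (hS : #S < κ) :
    #(⋃ l ∈ {l : List E | ∀ e ∈ l, e ∈ S}, Φ l : Set E) < κ :=
  (card_biUnion_lt_iff_forall_of_isRegular hκ (mk_lists_lt h₀ hS)).2 fun l _ => hΦ l

theorem mk_union_lt {κ : Cardinal.{v}} (hκ : ℵ₀ ≤ κ) {S T : Set E} (hS : #S < κ) (hT : #T < κ) :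
    #(S ∪ T : Set E) < κ :=
  (mk_union_le S T).trans_lt (add_lt_of_lt hκ hS hT)

/-- Iterating an increasing operation that adds `Φ l` for all lists `l` yields closed sets. -/
theorem exists_listClosed {κ : Cardinal.{v}} (hκ : κ.IsRegular) (h₀ : ℵ₀ < κ)
    {Φ : List E → Set E} (hΦ : ∀ l, #(Φ l) < κ) {A : Set E} (hA : #A < κ) :
    ∃ K, A ⊆ K ∧ #K < κ ∧ ListClosed Φ K ∧ ∀ S, A ⊆ S → ListClosed Φ S → K ⊆ S := by
  set c : ℕ → Set E := fun n =>
    (fun S => S ∪ ⋃ l ∈ {l : List E | ∀ e ∈ l, e ∈ S}, Φ l)^[n] A with hc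
  have hsucc : ∀ n, c (n + 1) = c n ∪ ⋃ l ∈ {l : List E | ∀ e ∈ l, e ∈ c n}, Φ l :=
    fun n => Function.iterate_succ_apply' _ _ _
  have hmono : Monotone c := monotone_nat_of_le_succ fun n => by
    rw [hsucc]; exact Set.subset_union_left
  have hcard : ∀ n, #(c n) < κ := by
    intro n
    induction n with
    | zero => exact hA
    | succ n ih =>
      rw [hsucc]
      exact mk_union_lt h₀.le ih (mk_biUnion_lists_lt hκ h₀ hΦ ih)
  refine ⟨⋃ n, c n, Set.subset_iUnion c 0, ?_, ?_, ?_⟩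
  · have h1 : (⋃ n, c n) = ⋃ n : ULift.{v} ℕ, c n.down := by
      ext e; simp
    rw [h1]
    refine (card_iUnion_lt_iff_forall_of_isRegular hκ (by simpa using h₀)).2 fun n => hcard _
  · intro l hl
    obtain ⟨n, hn⟩ := (List.finite_toSet l).subset_of_subset_iUnion_of_monotone hmono hl
    refine Set.Subset.trans ?_ (Set.subset_iUnion c (n + 1))
    rw [hsucc]
    exact fun x hx => Or.inr (Set.mem_biUnion (show l ∈ {l : List E | ∀ e ∈ l, e ∈ c n} from hn) hx)
  · intro S hAS hS
    refine Set.iUnion_subset fun n => ?_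
    induction n with
    | zero => exact hAS
    | succ n ih =>
      rw [hsucc]
      exact Set.union_subset ih (Set.iUnion₂_subset fun l hl => hS l fun e he => ih (hl e he))

end closure

namespace Web

variable {V : Type u} {E : Type v} {W : Web V E}

variable (W) in
/-- `l` is the reversed edge list of a walk of `M` with first edge `a` and last vertex `y`. -/
inductive Walk (M : Set E) (a : E) : V → List E → Prop
  | base : a ∈ M → Walk M a (W.head a) [a]
  | snoc {e : E} {l : List E} : Walk M a (W.tail e) l → e ∈ M → Walk M a (W.head e) (e :: l)

theorem Walk.ne_s {M : Set E} {a : E} {y : V} {l : List E} (h : W.Walk M a y l) : y ≠ W.s := by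
  cases h <;> exact W.head_ne _

theorem Walk.mono {M M' : Set E} {a : E} {y : V} {l : List E} (h : W.Walk M a y l)
    (hl : ∀ e ∈ l, e ∈ M') : W.Walk M' a y l := by
  induction h with
  | base => exact .base (hl _ (by simp))
  | snoc _ _ ih => exact .snoc (ih fun e he => hl e (List.mem_cons_of_mem _ he)) (hl _ (by simp))

theorem Walk.mem {M : Set E} {a : E} {y : V} {l : List E} (h : W.Walk M a y l) :
    ∀ e ∈ l, e ∈ M := by
  induction h with
  | base h => simpa using h
  | snoc _ h ih => simpa using ⟨h, ih⟩

theorem Walk.start_mem {M : Set E} {a : E} {y : V} {l : List E} (h : W.Walk M a y l) :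
    a ∈ l := by
  induction h with
  | base h => simp
  | snoc _ h ih => exact List.mem_cons_of_mem _ ih

variable (W) in
/-- The largest wave after deleting `a` and `F`. -/
def waveDel (G : Set E) (a : E) (F : Set E) : Set V := W.maxWave (G \ insert a F)

variable (W) in
/-- The union of the sets `waveDel` for finite subsets of `σ`. -/
def waveDelUnion (G : Set E) (a : E) (σ : Set E) : Set V :=
  {y | ∃ F, F.Finite ∧ F ⊆ σ ∧ y ∈ W.waveDel G a F}

variable (W) in
/-- All edges leaving `waveDelUnion G a σ` and not in `σ` can be linked simultaneously. -/
def LinkedExits (G : Set E) (a : E) (σ : Set E) : Prop :=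
  ∃ U p, W.Flow (G \ {a}) U p ∧ (∀ e ∈ U, W.tail e ∈ W.waveDelUnion G a σ) ∧
    ∀ e ∈ G, W.tail e ∈ W.waveDelUnion G a σ → W.head e ∉ W.waveDelUnion G a σ → e ∉ σ → e ≠ a →
      e ∈ U

theorem waveDelUnion_mono {G : Set E} {a : E} {σ τ : Set E} (h : σ ⊆ τ) :
    W.waveDelUnion G a σ ⊆ W.waveDelUnion G a τ :=
  fun _ ⟨F, h1, h2, h3⟩ => ⟨F, h1, h2.trans h, h3⟩

theorem s_mem_waveDelUnion {G : Set E} {a : E} {σ : Set E} : W.s ∈ W.waveDelUnion G a σ := by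
  obtain ⟨U, p, h⟩ := W.exists_isWave_maxWave (G \ insert a ∅)
  exact ⟨∅, Set.finite_empty, Set.empty_subset _, h.s_mem⟩

theorem linkedExits_of_countable {G : Set E} {a : E} {σ : Set E}
    (hmono : ∀ F F', F.Finite → F'.Finite → F ⊆ F' → F' ⊆ σ →
      W.waveDel G a F ⊆ W.waveDel G a F') (hσ : σ.Countable) : W.LinkedExits G a σ := by
  obtain ⟨F, hF, hFfin, hFU⟩ : ∃ F : ℕ → Set E, Monotone F ∧ (∀ n, (F n).Finite) ∧
      ⋃ n, F n = σ := by
    rcases σ.eq_empty_or_nonempty with rfl | hne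
    · exact ⟨fun _ => ∅, monotone_const, fun _ => Set.finite_empty, by simp⟩
    obtain ⟨f, rfl⟩ := hσ.exists_eq_range hne
    refine ⟨fun n => f '' Set.Iio n, fun m n h => Set.image_mono (Set.Iio_subset_Iio h),
      fun n => (Set.finite_Iio n).image f, ?_⟩
    ext y
    simp only [Set.mem_iUnion, Set.mem_image, Set.mem_range, Set.mem_Iio]
    exact ⟨fun ⟨_, m, _, h⟩ => ⟨m, h⟩, fun ⟨m, h⟩ => ⟨m + 1, m, by omega, h⟩⟩
  have hFσ : ∀ n, F n ⊆ σ := fun n => hFU ▸ Set.subset_iUnion F n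
  have hX : W.waveDelUnion G a σ = ⋃ n, W.waveDel G a (F n) := by
    ext y
    simp only [Set.mem_iUnion]
    constructor
    · rintro ⟨F', h1, h2, h3⟩
      obtain ⟨n, hn⟩ : ∃ n, F' ⊆ F n := by
        rw [← hFU] at h2
        exact h1.subset_of_subset_iUnion_of_monotone hF h2
      exact ⟨n, hmono _ _ h1 (hFfin n) hn (hFσ n) h3⟩
    · rintro ⟨n, hn⟩
      exact ⟨F n, hFfin n, hFσ n, hn⟩
  choose U p hW using fun n => W.exists_isWave_maxWave (G \ insert a (F n))
  have hsub : ∀ n, G \ insert a (F n) ⊆ G \ {a} := fun n =>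
    Set.sdiff_subset_sdiff_right (by simp)
  obtain ⟨q, hq⟩ := glue_flows (H := G \ {a}) (Y := fun n => W.waveDel G a (F n)) (U := U) (p := p)
    (fun i => (hW i).toFlow.mono ((hW i).sub.trans (hsub i))) (fun i => (hW i).tail_mem) (by
      intro j i hji e he h1 h2 _ _
      refine (hW j).exit e ?_ h1 h2
      exact Set.sdiff_subset_sdiff_right (Set.insert_subset_insert (hF hji.le)) ((hW i).sub he))
  refine ⟨_, q, hq, ?_, ?_⟩
  · rintro e ⟨-, he | ⟨i, hi, -⟩⟩
    · rw [he]; exact s_mem_waveDelUnion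
    · rw [hX]; exact Set.mem_iUnion.2 ⟨i, hi.1⟩
  · intro e he h1 h2 h3 h4
    refine ⟨⟨he, h4⟩, ?_⟩
    rw [hX] at h1 h2
    obtain ⟨i, hi⟩ := Set.mem_iUnion.1 h1
    obtain ⟨j, hj⟩ := exists_first (Y := fun n => W.waveDel G a (F n)) hi
    refine Or.inr ⟨j, hj, (hW j).exit e ⟨he, ?_⟩ hj.1 fun h5 => h2 (Set.mem_iUnion.2 ⟨j, h5⟩)⟩
    rintro (h5 | h5)
    exacts [h4 h5, h3 (hFσ j h5)]

theorem waveDelUnion_two {G : Set E} {a : E} {σ : Set E}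
    (hmono : ∀ F F', F.Finite → F'.Finite → F ⊆ F' → F' ⊆ σ →
      W.waveDel G a F ⊆ W.waveDel G a F') {x y : V} (hx : x ∈ W.waveDelUnion G a σ)
    (hy : y ∈ W.waveDelUnion G a σ) :
    ∃ F, F.Finite ∧ F ⊆ σ ∧ x ∈ W.waveDel G a F ∧ y ∈ W.waveDel G a F := by
  obtain ⟨F, h1, h2, h3⟩ := hx
  obtain ⟨F', h4, h5, h6⟩ := hy
  exact ⟨F ∪ F', h1.union h4, Set.union_subset h2 h5,
    hmono _ _ h1 (h1.union h4) Set.subset_union_left (Set.union_subset h2 h5) h3,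
    hmono _ _ h4 (h1.union h4) Set.subset_union_right (Set.union_subset h2 h5) h6⟩

theorem linkedExits {G : Set E} {a : E} {τ : Set E}
    (hmono : ∀ F F', F.Finite → F'.Finite → F ⊆ F' → F' ⊆ τ →
      W.waveDel G a F ⊆ W.waveDel G a F') : W.LinkedExits G a τ := by
  classical
  have hsw : ∀ e, ∃ S : Set E, S.Finite ∧ S ⊆ τ ∧ ((∃ F, F.Finite ∧ F ⊆ τ ∧
      W.tail e ∈ W.waveDel G a F ∧ W.head e ∈ W.waveDel G a F) →
      W.tail e ∈ W.waveDel G a S ∧ W.head e ∈ W.waveDel G a S) := by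
    intro e
    by_cases h : ∃ F : Set E, F.Finite ∧ F ⊆ τ ∧
      W.tail e ∈ W.waveDel G a F ∧ W.head e ∈ W.waveDel G a F
    · obtain ⟨F, h1, h2, h3⟩ := h
      exact ⟨F, h1, h2, fun _ => h3⟩
    · exact ⟨∅, Set.finite_empty, Set.empty_subset _, fun h' => absurd h' h⟩
  choose S hSfin hSτ hS using hsw
  have hcl : ∀ F : {F : Set E // F.Finite ∧ F ⊆ τ}, ∃ K, F.1 ⊆ K ∧ K.Countable ∧ K ⊆ τ ∧
      ∀ e ∈ K, S e ⊆ K := by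
    rintro ⟨F, hF, hFτ⟩
    obtain ⟨K, h1, h2, h3, h4⟩ := exists_listClosed (E := E) isRegular_aleph_one aleph0_lt_aleph_one
      (Φ := fun l => ⋃ e ∈ l, S e) (A := F) (fun l => by
        rw [← countable_iff_mk_lt]
        exact Set.Countable.biUnion (List.finite_toSet l).countable fun e _ => (hSfin e).countable)
        (by rw [← countable_iff_mk_lt]; exact hF.countable)
    refine ⟨K, h1, countable_iff_mk_lt.2 h2, ?_, ?_⟩
    · exact h4 τ hFτ fun l hl => Set.iUnion₂_subset fun e he => hSτ e
    · intro e he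
      refine Set.Subset.trans ?_ (h3 [e] (by simpa using he))
      simp
  choose cl hcl₁ hcl₂ hcl₃ hcl₄ using hcl
  have hmono' : ∀ i F F', F.Finite → F'.Finite → F ⊆ F' → F' ⊆ cl i →
      W.waveDel G a F ⊆ W.waveDel G a F' := fun i F F' h1 h2 h3 h4 =>
    hmono F F' h1 h2 h3 (h4.trans (hcl₃ i))
  choose U p hU₁ hU₂ hU₃ using fun i => linkedExits_of_countable (hmono' i) (hcl₂ i)
  obtain ⟨_, _⟩ := exists_wellFoundedLT {F : Set E // F.Finite ∧ F ⊆ τ}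
  obtain ⟨q, hq⟩ := glue_flows (Y := fun i => W.waveDelUnion G a (cl i)) hU₁ hU₂ (by
    intro j i _ e he h1 h2 h3 _
    have heH := (hU₁ i).sub he
    refine hU₃ j e heH.1 h1 h2 (fun h4 => h2 ?_) heH.2
    obtain ⟨F, h5, h6, h7⟩ := waveDelUnion_two (hmono' i) (hU₂ i e he) h3
    exact ⟨S e, hSfin e, hcl₄ j e h4, (hS e ⟨F, h5, h6.trans (hcl₃ i), h7⟩).2⟩)
  refine ⟨_, q, hq, ?_, ?_⟩
  · rintro e ⟨-, he | ⟨i, hi, -⟩⟩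
    · rw [he]; exact s_mem_waveDelUnion
    · exact waveDelUnion_mono (hcl₃ i) hi.1
  · intro e he h1 h2 h3 h4
    refine ⟨⟨he, h4⟩, ?_⟩
    obtain ⟨F, h5, h6, h7⟩ := h1
    have hi : W.tail e ∈ W.waveDelUnion G a (cl ⟨F, h5, h6⟩) := ⟨F, h5, hcl₁ ⟨F, h5, h6⟩, h7⟩
    obtain ⟨j, hj⟩ := exists_first (Y := fun i => W.waveDelUnion G a (cl i)) hi
    exact Or.inr ⟨j, hj, hU₃ j e he hj.1 (fun h8 => h2 (waveDelUnion_mono (hcl₃ j) h8))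
      (fun h8 => h3 (hcl₃ j h8)) h4⟩

variable (W) in
/-- `τ` is a set of edges reachable from `a`, the finite subsets of which can be deleted safely. -/
structure SafeTree (G : Set E) (a : E) (τ : Set E) : Prop where
  sub : τ ⊆ G
  start : a ∈ τ
  walk : ∀ e ∈ τ, e = a ∨ ∃ l, W.Walk τ a (W.tail e) l
  safe : ∀ F, F.Finite → F ⊆ τ → a ∈ F → ¬ W.Hindered (G \ F)

theorem exists_maximal_safeTree {G : Set E} (hG : ¬ W.Hindered G) {a : E} (ha : a ∈ G)
    (has : W.tail a = W.s) : ∃ τ, Maximal (W.SafeTree G a) τ := by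
  have h₀ : W.SafeTree G a {a} := by
    refine ⟨by simpa using ha, rfl, fun e he => Or.inl he, fun F _ hF haF => ?_⟩
    rw [hF.antisymm (by simpa using haF)]
    exact not_hindered_diff_source hG ha has
  obtain ⟨τ, -, h⟩ := zorn_subset_nonempty {τ | W.SafeTree G a τ} (by
    rintro c hc hchain ⟨τ₀, hτ₀⟩
    refine ⟨⋃₀ c, ⟨?_, ?_, ?_, ?_⟩, fun s hs => Set.subset_sUnion_of_mem hs⟩
    · exact Set.sUnion_subset fun τ hτ => (hc hτ).sub
    · exact ⟨τ₀, hτ₀, (hc hτ₀).start⟩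
    · rintro e ⟨τ, hτ, he⟩
      refine ((hc hτ).walk e he).imp id ?_
      rintro ⟨l, hl⟩
      exact ⟨l, hl.mono fun f hf => ⟨τ, hτ, hl.mem f hf⟩⟩
    · intro F hF hFc haF
      obtain ⟨τ, hτ, hFτ⟩ := DirectedOn.exists_mem_subset_of_finite_of_subset_sUnion
        ⟨τ₀, hτ₀⟩ hchain.directedOn hF hFc
      exact (hc hτ).safe F hF hFτ haF) {a} h₀
  exact ⟨τ, h⟩

theorem SafeTree.tail_ne {G : Set E} {a : E} {τ : Set E} (h : W.SafeTree G a τ) {e : E}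
    (he : e ∈ τ) (hea : e ≠ a) : W.tail e ≠ W.s := by
  obtain ⟨l, hl⟩ := (h.walk e he).resolve_left hea
  exact hl.ne_s

theorem SafeTree.waveDel_mono {G : Set E} {a : E} {τ : Set E} (h : W.SafeTree G a τ) {F F' : Set E}
    (hF : F.Finite) (hF' : F'.Finite) (hFF' : F ⊆ F') (hF'τ : F' ⊆ τ) :
    W.waveDel G a F ⊆ W.waveDel G a F' := by
  obtain ⟨U, p, hU⟩ := W.exists_isWave_maxWave (G \ insert a F)
  have key : ∀ D : Set E, D.Finite → D ⊆ τ →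
      ∃ U p, W.IsWave (G \ (insert a F ∪ D)) (W.waveDel G a F) U p := by
    intro D hD
    induction D, hD using Set.Finite.induction_on with
    | empty => exact fun _ => ⟨U, p, by rw [Set.union_empty]; exact hU⟩
    | @insert e D _ hDfin ih =>
      intro hD
      obtain ⟨U', p', h1⟩ := ih ((Set.subset_insert _ _).trans hD)
      by_cases hea : e = a
      · refine ⟨U', p', ?_⟩
        convert h1 using 2
        subst hea
        ext x
        simp only [Set.mem_union, Set.mem_insert_iff]
        tauto
      · have h2 : G \ (insert a F ∪ insert e D) = (G \ (insert a F ∪ D)) \ {e} := by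
          ext x
          simp only [Set.mem_sdiff, Set.mem_union, Set.mem_insert_iff, Set.mem_singleton_iff]
          tauto
        rw [h2]
        refine (h1.diff_singleton (e := e) ?_ (h.tail_ne (hD (Set.mem_insert _ _)) hea)).2
        rw [← h2]
        refine h.safe _ ((hF.insert a).union (hDfin.insert e)) ?_ (by simp)
        exact Set.union_subset (Set.insert_subset h.start (hFF'.trans hF'τ)) hD
  obtain ⟨U', p', h1⟩ := key F' hF' hF'τ
  refine IsWave.subset_maxWave (U := U') (p := p') ?_
  convert h1 using 2
  rw [Set.insert_union, Set.union_eq_self_of_subset_left hFF']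

/-- In an unhindered web, every source edge starts a walk to `t` whose deletion leaves the web
unhindered. -/
theorem exists_safe_walk {G : Set E} (hG : ¬ W.Hindered G) {a : E} (ha : a ∈ G)
    (has : W.tail a = W.s) : ∃ l, W.Walk G a W.t l ∧ ¬ W.Hindered (G \ {e | e ∈ l}) := by
  obtain ⟨τ, hτ, hmax⟩ := exists_maximal_safeTree hG ha has
  by_cases ht : ∃ e ∈ τ, W.head e = W.t
  · obtain ⟨e, he, het⟩ := ht
    have : ∃ l, W.Walk τ a W.t l := by
      rcases hτ.walk e he with rfl | ⟨l, hl⟩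
      · exact ⟨_, het ▸ Walk.base he⟩
      · exact ⟨_, het ▸ hl.snoc he⟩
    obtain ⟨l, hl⟩ := this
    exact ⟨l, hl.mono fun e he => hτ.sub (hl.mem e he),
      hτ.safe _ (List.finite_toSet l) hl.mem hl.start_mem⟩
  exfalso
  have hmono : ∀ F F', F.Finite → F'.Finite → F ⊆ F' → F' ⊆ τ →
      W.waveDel G a F ⊆ W.waveDel G a F' := fun F F' h1 h2 h3 h4 => hτ.waveDel_mono h1 h2 h3 h4
  obtain ⟨U, p, h1, h2, h3⟩ := linkedExits hmono
  refine hG ⟨W.waveDelUnion G a τ ∪ W.head '' τ, U, p, a, ?_, ha, has, fun h => (h1.sub h).2 rfl⟩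
  constructor
  · exact h1.mono (h1.sub.trans Set.sdiff_subset)
  · exact Or.inl s_mem_waveDelUnion
  · rintro (⟨F, hF, hFτ, hFt⟩ | ⟨e, he, het⟩)
    · obtain ⟨U', p', h'⟩ := W.exists_isWave_maxWave (G \ insert a F)
      exact h'.t_notMem hFt
    · exact ht ⟨e, he, het⟩
  · exact fun e he => Or.inl (h2 e he)
  · intro e he h4 h5
    have heτ : e ∉ τ := fun h => h5 (Or.inr ⟨e, h, rfl⟩)
    have hea : e ≠ a := fun h => heτ (h ▸ hτ.start)
    have h5' : W.head e ∉ W.waveDelUnion G a τ := fun h => h5 (Or.inl h)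
    by_cases h6 : W.tail e ∈ W.waveDelUnion G a τ
    · exact h3 e he h6 h5' heτ hea
    · exfalso
      obtain ⟨f, hf, hfe⟩ := h4.resolve_left h6
      refine heτ (hmax (y := insert e τ) ⟨Set.insert_subset he hτ.sub, Or.inr hτ.start, ?_, ?_⟩
        (Set.subset_insert _ _) (Set.mem_insert _ _))
      · rintro g (rfl | hg)
        · right
          rw [← hfe]
          rcases hτ.walk f hf with rfl | ⟨l, hl⟩
          · exact ⟨_, .base (Or.inr hf)⟩
          · exact ⟨_, (hl.mono fun x hx => Set.mem_insert_of_mem _ (hl.mem x hx)).snoc (Or.inr hf)⟩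
        · refine (hτ.walk g hg).imp id ?_
          rintro ⟨l, hl⟩
          exact ⟨l, hl.mono fun x hx => Set.mem_insert_of_mem _ (hl.mem x hx)⟩
      · intro F hF hFτ haF hH
        have haF' : a ∈ F \ {e} := ⟨haF, hea.symm⟩
        have hF'τ : F \ {e} ⊆ τ := fun x hx => (hFτ hx.1).resolve_left hx.2
        have hF' : (F \ {e}).Finite := hF.subset Set.sdiff_subset
        have hsafe := hτ.safe _ hF' hF'τ haF'
        have hsub : W.Hindered ((G \ (F \ {e})) \ {e}) := by
          by_cases heF : e ∈ F
          · convert hH using 1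
            ext x
            simp only [Set.mem_sdiff, Set.mem_singleton_iff, not_and, not_not]
            constructor
            · rintro ⟨⟨h7, h8⟩, h9⟩
              exact ⟨h7, fun h => h9 (h8 h)⟩
            · rintro ⟨h7, h8⟩
              exact ⟨⟨h7, fun h => absurd h h8⟩, fun h => h8 (h ▸ heF)⟩
          · refine absurd hH (hτ.safe F hF (fun x hx => (hFτ hx).resolve_left ?_) haF)
            rintro rfl
            exact heF hx
        obtain ⟨X, U', p', h7, h8, -⟩ := exists_wave_of_hindered_diff hsafe
          (e := e) ⟨he, fun h => h.2 rfl⟩ hsub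
        refine h6 ⟨F \ {e}, hF', hF'τ, ?_⟩
        unfold waveDel
        rw [Set.insert_eq_of_mem haF']
        exact h7.subset_maxWave h8

/-- The union of disjoint flows is a flow. -/
theorem flow_iUnion {ι : Type w} {H : Set E} {U : ι → Set E} {p : ι → E → E}
    (h : ∀ i, W.Flow H (U i) (p i)) (hU : ∀ i j e, e ∈ U i → e ∈ U j → i = j) :
    ∃ q, W.Flow H (⋃ i, U i) q ∧ ∀ i, ∀ e ∈ U i, q e = p i e := by
  classical
  set q : E → E := fun e => if h : ∃ i, e ∈ U i then p h.choose e else e with hq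
  have hqe : ∀ i, ∀ e ∈ U i, q e = p i e := by
    intro i e he
    have h' : ∃ i, e ∈ U i := ⟨i, he⟩
    simp only [hq, dif_pos h']
    rw [hU _ _ e h'.choose_spec he]
  refine ⟨q, ⟨Set.iUnion_subset fun i => (h i).sub, ?_, ?_, ?_, ?_⟩, hqe⟩
  · intro e he hs
    obtain ⟨i, hi⟩ := Set.mem_iUnion.1 he
    rw [hqe i e hi]
    exact Set.mem_iUnion.2 ⟨i, (h i).mem e hi hs⟩
  · intro e he hs
    obtain ⟨i, hi⟩ := Set.mem_iUnion.1 he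
    rw [hqe i e hi]
    exact (h i).head_eq e hi hs
  · intro e he f hf hes hfs hef
    obtain ⟨i, hi⟩ := Set.mem_iUnion.1 he
    obtain ⟨j, hj⟩ := Set.mem_iUnion.1 hf
    rw [hqe i e hi, hqe j f hj] at hef
    obtain rfl := hU i j _ ((h i).mem e hi hes) (hef ▸ (h j).mem f hj hfs)
    exact (h i).inj e hi f hj hes hfs hef
  · intro e he
    obtain ⟨i, hi⟩ := Set.mem_iUnion.1 he
    have := (h i).acc e hi
    induction this with
    | intro e _ ih =>
      by_cases hs : W.tail e = W.s
      · exact acc_of_source hs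
      · apply acc_of_pred
        rw [hqe i e hi]
        exact ih _ ⟨hs, rfl⟩ (Set.mem_iUnion.2 ⟨i, (h i).mem e hi hs⟩) ((h i).mem e hi hs)

variable (W) in
/-- The edges that leave the union of the `Y i` and are not covered by the flows of the pieces
`K (succ i) \ K i`. -/
def patchNeed {ι : Type w} [LinearOrder ι] [SuccOrder ι] (G : Set E) (K : ι → Set E)
    (Y : ι → Set V) : Set E :=
  {f | f ∈ G ∧ W.tail f ≠ W.s ∧ (∀ i, W.head f ∉ Y i) ∧ (∃ i, First Y i (W.tail f) ∧ f ∈ K i) ∧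
    ∀ j, f ∈ K (succ j) → W.tail f ∈ Y j → f ∈ K j}

/-- A well-ordered increasing family of hindrances of `G \ K i` that can be patched together gives a
hindrance of `G`. -/
theorem hindered_of_patch {ι : Type w} [LinearOrder ι] [WellFoundedLT ι] [SuccOrder ι]
    [NoMaxOrder ι] {G : Set E} {K : ι → Set E} (hK : Monotone K) {Y : ι → Set V} {U : ι → Set E}
    {p : ι → E → E} {c : ι → E} (hW : ∀ i, W.IsWave (G \ K i) (Y i) (U i) (p i))
    (hc : ∀ i, c i ∈ G \ K i) (hcs : ∀ i, W.tail (c i) = W.s) (hcU : ∀ i, c i ∉ U i)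
    (hcK : ∀ i, c i ∈ K (succ i))
    (hC : ∀ i j, i < j → ∀ e ∈ U i, W.tail e ≠ W.s → (e ∈ K j ↔ p i e ∈ K j))
    (i₀ : ι) (β : E → ι)
    (hβ : ∀ f ∈ W.patchNeed G K Y, β f ≠ i₀ ∧
      W.Reach (G ∩ (K (succ (β f)) \ K (β f))) (U (β f) ∩ (K (succ (β f)) \ K (β f)))
        (c (β f)) (W.tail f))
    (hinj : Set.InjOn β (W.patchNeed G K Y)) : W.Hindered G := by
  set piece : ι → Set E := fun i => K (succ i) \ K i with hpiece
  have hdisj : ∀ i j e, e ∈ piece i → e ∈ piece j → i = j := by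
    have aux : ∀ i j e, e ∈ piece i → e ∈ piece j → ¬ i < j := fun i j e h1 h2 hij =>
      h2.2 (hK (succ_le_of_lt hij) h1.1)
    intro i j e h1 h2
    exact le_antisymm (not_lt.1 (aux j i e h2 h1)) (not_lt.1 (aux i j e h1 h2))
  have hlt : ∀ i : ι, i < succ i := fun i => lt_succ i
  have hsubi : ∀ i, U i ∩ piece i ⊆ G ∩ piece i := fun i e he => ⟨((hW i).sub he.1).1, he.2⟩
  have hWp : ∀ i, W.IsWave (G ∩ piece i) (Y i) (U i ∩ piece i) (p i) := by
    intro i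
    constructor
    · refine ⟨hsubi i, ?_, fun e he => (hW i).head_eq e he.1,
        fun e he f hf => (hW i).inj e he.1 f hf.1, fun e he => (hW i).acc e he.1⟩
      intro e he hs
      have hm := (hW i).mem e he.1 hs
      exact ⟨hm, (hC i _ (hlt i) e he.1 hs).1 he.2.1, ((hW i).sub hm).2⟩
    · exact (hW i).s_mem
    · exact (hW i).t_notMem
    · exact fun e he => (hW i).tail_mem e he.1
    · exact fun e he h1 h2 => ⟨(hW i).exit e ⟨he.1, he.2.2⟩ h1 h2, he.2⟩
  have hcp : ∀ i, c i ∈ G ∩ piece i := fun i => ⟨(hc i).1, hcK i, (hc i).2⟩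
  have hcp' : ∀ i, c i ∉ U i ∩ piece i := fun i h => hcU i h.1
  have hβY : ∀ f ∈ W.patchNeed G K Y, W.tail f ∈ Y (β f) := fun f hf =>
    (hWp _).reach_subset (hcp _) (hcs _) (hcp' _) (hβ f hf).2
  set N : ι → Set E := fun i => (G ∩ piece i) ∪ {f | f ∈ W.patchNeed G K Y ∧ β f = i} with hN
  have hV : ∀ i, ∃ V π, W.IsWave (N i) (Y i) V π ∧ (i = i₀ → c i ∉ V) := by
    intro i
    by_cases hi : ∃ f ∈ W.patchNeed G K Y, β f = i
    · obtain ⟨f, hf, rfl⟩ := hi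
      obtain ⟨V, π, h1⟩ := (hWp (β f)).exists_augment (hcp _) (hcs _) (hcp' _) (f := f)
        (fun h => h.2.2 (hf.2.2.2.2 _ h.2.1 (hβY f hf))) (hβ f hf).2
      refine ⟨V, π, ?_, fun h => absurd h (hβ f hf).1⟩
      have : N (β f) = insert f (G ∩ piece (β f)) := by
        ext x
        simp only [hN, Set.mem_union, Set.mem_insert_iff, Set.mem_ofPred_eq, or_comm (a := x = f)]
        refine or_congr_right ⟨fun h => hinj h.1 hf h.2, ?_⟩
        rintro rfl
        exact ⟨hf, rfl⟩
      rwa [this]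
    · refine ⟨_, _, (hWp i).mono ((hsubi i).trans Set.subset_union_left) ?_, fun _ => hcp' i⟩
      rintro e (he | ⟨he, hei⟩) _ _
      exacts [Or.inl he, absurd ⟨e, he, hei⟩ hi]
  choose V π hVw hVc using hV
  have hNG : ∀ i, N i ⊆ G := by
    rintro i e (h | h)
    exacts [h.1, h.1.1]
  have hVT : ∀ i, ∀ e ∈ V i, e ∈ piece i ∨ (e ∈ W.patchNeed G K Y ∧ β e = i) := by
    intro i e he
    rcases (hVw i).sub he with h | h
    exacts [Or.inl h.2, Or.inr h]
  have hVdisj : ∀ i j e, e ∈ V i → e ∈ V j → i = j := by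
    have aux : ∀ i j e, e ∈ V i → e ∈ V j → e ∈ piece i → e ∈ W.patchNeed G K Y → False :=
      fun i j e h1 h2 h3 h4 => h3.2 (h4.2.2.2.2 i h3.1 ((hVw i).tail_mem e h1))
    intro i j e h1 h2
    rcases hVT i e h1 with h3 | h3 <;> rcases hVT j e h2 with h4 | h4
    · exact hdisj i j e h3 h4
    · exact (aux i j e h1 h2 h3 h4.1).elim
    · exact (aux j i e h2 h1 h4 h3.1).elim
    · exact h3.2.symm.trans h4.2
  obtain ⟨p₀, h₀, hp₀⟩ := flow_iUnion (fun i => (hVw i).toFlow.mono ((hVw i).sub.trans (hNG i)))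
    hVdisj
  set T₁ : Set E := {e | ∃ i, e ∈ piece i ∧ W.tail e ∈ Y i} ∪ W.patchNeed G K Y with hT₁
  have h₀T : (⋃ i, V i) ⊆ T₁ := by
    refine Set.iUnion_subset fun i e he => ?_
    rcases hVT i e he with h | h
    exacts [Or.inl ⟨i, h, (hVw i).tail_mem e he⟩, Or.inr h.1]
  have key : ∀ i, ∀ e ∈ U i, e ∉ T₁ → First Y i (W.tail e) → W.tail e ≠ W.s →
      ∀ j, p i e ∈ piece j → W.tail e ∉ Y j := by
    intro i e he heT hi hs j hj hej
    have hij := hi.le hej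
    have h1 := (hC i _ (hij.trans_lt (hlt j)) e he hs).2 hj.1
    refine heT (Or.inl ⟨j, ⟨h1, fun h2 => ?_⟩, hej⟩)
    rcases hij.lt_or_eq with h3 | rfl
    · exact hj.2 ((hC i j h3 e he hs).1 h2)
    · exact ((hW i).sub he).2 h2
  obtain ⟨q, hq⟩ := glue (Y := Y) (U := U) (p := p) h₀ h₀T (fun i => (hW i).head_eq)
    (fun i e he hs => (hW i).tail_mem _ ((hW i).mem e he hs)) (fun i => (hW i).inj)
    (fun i => (hW i).acc) (by
      intro i e he _ heT hi hs
      have hm := (hW i).mem e he hs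
      have hh := (hW i).head_eq e he hs
      by_cases hT : p i e ∈ T₁
      · rcases hT with ⟨j, h1, h2⟩ | h1
        · refine Or.inl (Set.mem_iUnion.2 ⟨j, (hVw j).exit _ ?_ h2 ?_⟩)
          · exact Or.inl ⟨((hW i).sub hm).1, h1⟩
          · rw [hh]; exact key i e he heT hi hs j h1
        · exact absurd (hh ▸ hi.1) (h1.2.2.1 i)
      · refine Or.inr ⟨hT, ((hW i).sub hm).1, fun hs' j hj => ?_⟩
        rcases (hj.le ((hW i).tail_mem _ hm)).lt_or_eq with h1 | rfl
        · refine (hW j).exit _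
            ⟨((hW i).sub hm).1, fun h2 => ((hW i).sub hm).2 (hK h1.le h2)⟩ hj.1 ?_
          rw [hh]
          exact hi.2 j h1
        · exact hm) (by
      intro i e he _ heT hi hs g hg hgs hge
      obtain ⟨j, hj⟩ := Set.mem_iUnion.1 hg
      rw [hp₀ j g hj] at hge
      have hm := (hVw j).mem g hj hgs
      have hh := (hVw j).head_eq g hj hgs
      rw [← hge, (hW i).head_eq e he hs] at hh
      rw [← hge] at hm
      rcases hVT j _ hm with h1 | h1
      · refine key i e he heT hi hs j h1 ?_
        rw [hh]
        exact (hVw j).tail_mem g hj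
      · refine h1.1.2.2.1 i ?_
        rw [(hW i).head_eq e he hs]
        exact hi.1)
  refine ⟨⋃ i, Y i, _, q, c i₀, ⟨hq, ?_, ?_, ?_, ?_⟩, (hc i₀).1, hcs i₀, ?_⟩
  · exact Set.mem_iUnion.2 ⟨i₀, (hW i₀).s_mem⟩
  · intro h
    obtain ⟨i, hi⟩ := Set.mem_iUnion.1 h
    exact (hW i).t_notMem hi
  · rintro e (he | ⟨-, -, he | ⟨i, hi, -⟩⟩)
    · obtain ⟨i, hi⟩ := Set.mem_iUnion.1 he
      exact Set.mem_iUnion.2 ⟨i, (hVw i).tail_mem e hi⟩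
    · rw [he]
      exact Set.mem_iUnion.2 ⟨i₀, (hW i₀).s_mem⟩
    · exact Set.mem_iUnion.2 ⟨i, hi.1⟩
  · intro e he h1 h2
    have h2' : ∀ i, W.head e ∉ Y i := fun i h => h2 (Set.mem_iUnion.2 ⟨i, h⟩)
    by_cases hT : e ∈ T₁
    · left
      rcases hT with ⟨i, h3, h4⟩ | h3
      · exact Set.mem_iUnion.2 ⟨i, (hVw i).exit e (Or.inl ⟨he, h3⟩) h4 (h2' i)⟩
      · exact Set.mem_iUnion.2 ⟨β e, (hVw _).exit e (Or.inr ⟨h3, rfl⟩) (hβY e h3) (h2' _)⟩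
    · refine Or.inr ⟨he, hT, ?_⟩
      by_cases hs : W.tail e = W.s
      · exact Or.inl hs
      obtain ⟨i, hi⟩ := Set.mem_iUnion.1 h1
      obtain ⟨j, hj⟩ := exists_first hi
      refine Or.inr ⟨j, hj, (hW j).exit e ⟨he, fun h3 => hT (Or.inr ?_)⟩ hj.1 (h2' j)⟩
      refine ⟨he, hs, h2', ⟨j, hj, h3⟩, fun k hk1 hk2 => ?_⟩
      by_contra hk3
      exact hT (Or.inl ⟨k, ⟨hk1, hk3⟩, hk2⟩)
  · rintro (h | h)
    · obtain ⟨i, hi⟩ := Set.mem_iUnion.1 h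
      rcases hVT i _ hi with h1 | h1
      · obtain rfl := hdisj i i₀ _ h1 (hcp i₀).2
        exact hVc i rfl hi
      · exact h1.1.2.1 (hcs _)
    · exact h.2.1 (Or.inl ⟨i₀, (hcp i₀).2, by rw [hcs]; exact (hW i₀).s_mem⟩)

end Web

theorem mk_Iio_ord_lt {κ : Cardinal.{v}} (i : κ.ord.ToType) : #(Set.Iio i) < κ := by
  simpa using mk_Iio_lt i (by simp)

theorem exists_bookkeeping {κ : Cardinal.{v}} (h₀ : ℵ₀ ≤ κ) :
    ∃ b : κ.ord.ToType → κ.ord.ToType × κ.ord.ToType, ∀ x, ∃ ζ, x.1 < ζ ∧ b ζ = x := by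
  have hι : #κ.ord.ToType = κ := mk_ord_toType κ
  have h1 : #((κ.ord.ToType × κ.ord.ToType) × κ.ord.ToType) = #κ.ord.ToType := by
    simp [mul_eq_self h₀]
  obtain ⟨g⟩ := Cardinal.eq.1 h1
  refine ⟨fun ζ => (g.symm ζ).1, fun x => ?_⟩
  by_contra! hx
  have hsub : ∀ θ, g (x, θ) ∈ Set.Iic x.1 := by
    intro θ
    by_contra h
    exact hx _ (not_le.1 h) (by simp)
  have hinj : Function.Injective fun θ => (⟨g (x, θ), hsub θ⟩ : Set.Iic x.1) := by
    intro θ θ' h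
    simpa using h
  have h2 := mk_le_of_injective hinj
  have := noMaxOrder h₀
  obtain ⟨y, hy⟩ := exists_gt x.1
  have h3 : #(Set.Iic x.1) ≤ #(Set.Iio y) := mk_le_mk_of_subset fun z hz => lt_of_le_of_lt hz hy
  rw [hι] at h2
  exact absurd (h2.trans h3) (mk_Iio_ord_lt y).not_ge

theorem exists_recursion {ι : Type v} [LinearOrder ι] [WellFoundedLT ι] {S : Type w}
    (F : (ζ : ι) → (Set.Iio ζ → S) → S) : ∃ K : ι → S, ∀ ζ, K ζ = F ζ fun η => K η :=
  ⟨wellFounded_lt.fix fun ζ K => F ζ fun η => K η η.2, fun ζ => wellFounded_lt.fix_eq _ ζ⟩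

namespace Web

variable {V : Type u} {E : Type v} {W : Web V E}

/-- Removing a sufficiently closed edge set of size less than an uncountable regular cardinal
preserves unhinderedness. -/
theorem exists_closure_not_hindered {κ : Cardinal.{v}} (hκ : κ.IsRegular) (h₀ : ℵ₀ < κ) {G : Set E}
    (hG : ¬ W.Hindered G) : ∃ Φ : List E → Set E, (∀ l, Φ l ⊆ G) ∧ (∀ l, #(Φ l) < κ) ∧
      ∀ K ⊆ G, #K < κ → ListClosed Φ K → ¬ W.Hindered (G \ K) := by
  classical
  by_contra hno
  have hone : ∀ x : E, #({x} : Set E) < κ := fun x => by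
    rw [mk_singleton]; exact one_lt_aleph0.trans h₀
  have hsmall : ∀ F : Set E, F.Finite → #F < κ := fun F hF =>
    (lt_aleph0_iff_finite.2 hF).trans h₀
  set S := {K : Set E // K ⊆ G ∧ #K < κ ∧ W.Hindered (G \ K)} with hS
  have hex : ∀ Φ : List E → Set E, (∀ l, #(Φ l) < κ) →
      ∃ K : S, ListClosed (fun l => Φ l ∩ G) K.1 := by
    intro Φ hΦ
    by_contra! hn
    exact hno ⟨fun l => Φ l ∩ G, fun l => Set.inter_subset_right,
      fun l => (mk_le_mk_of_subset Set.inter_subset_left).trans_lt (hΦ l),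
      fun K hK hKκ hcl hh => hn ⟨K, hK, hKκ, hh⟩ hcl⟩
  choose X U p c hW hcG hcs hcU hreach using fun K : S => K.2.2.2.strong
  have hloc : ∀ (K : S) (f : E), ∃ F : Set E, F.Finite ∧ (W.tail f ∈ X K → W.tail f ≠ W.s →
      ∀ Q, F ⊆ Q → W.Reach ((G \ K.1) ∩ Q) (U K ∩ Q) (c K) (W.tail f)) := by
    intro K f
    by_cases h : W.tail f ∈ X K ∧ W.tail f ≠ W.s
    · obtain ⟨F, hF, hF'⟩ := (hreach K _ h.1 h.2).local
      exact ⟨F, hF, fun _ _ => hF'⟩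
    · exact ⟨∅, Set.finite_empty, fun h1 h2 => absurd ⟨h1, h2⟩ h⟩
  choose loc hlocf hloc using hloc
  set popular : E → Prop := fun f => ∀ Φ : List E → Set E, (∀ l, #(Φ l) < κ) →
    ∃ K : S, ListClosed (fun l => Φ l ∩ G) K.1 ∧ f ∈ K.1 ∧ W.tail f ∈ X K with hpop
  have hφ : ∀ f, ∃ φ : List E → Set E, (∀ l, #(φ l) < κ) ∧ (¬ popular f →
      ∀ K : S, ListClosed (fun l => φ l ∩ G) K.1 → f ∈ K.1 → W.tail f ∉ X K) := by
    intro f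
    by_cases h : popular f
    · exact ⟨fun _ => ∅, fun l => hsmall _ Set.finite_empty, fun h' => absurd h h'⟩
    · have h' := h
      simp only [hpop] at h'
      push Not at h'
      obtain ⟨φ, h1, h2⟩ := h'
      exact ⟨φ, h1, fun _ => h2⟩
  choose φ hφκ hφ using hφ
  set Φs : List E → Set E := fun l => match l with
    | [] => ∅
    | f :: l => φ f l with hΦs
  have hΦsκ : ∀ l, #(Φs l) < κ := by
    intro l
    cases l with
    | nil => exact hsmall _ Set.finite_empty
    | cons f l => exact hφκ f l
  set Ψ : Set S → List E → Set E := fun A l => Φs l ∪ ⋃ K ∈ A, ((K.1 ∪ {c K}) ∪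
    ((⋃ f ∈ K.1, loc K f) ∪ ⋃ e ∈ {e | e ∈ l},
      ({p K e} ∪ {e' | e' ∈ U K ∧ W.tail e' ≠ W.s ∧ p K e' = e}))) with hΨ
  have hU := @mk_union_lt E κ h₀.le
  have hΨκ : ∀ A : Set S, #A < κ → ∀ l, #(Ψ A l) < κ := by
    intro A hA l
    refine hU (hΦsκ l) ((card_biUnion_lt_iff_forall_of_isRegular hκ hA).2 fun K _ => ?_)
    refine hU (hU K.2.2.1 (hone _)) (hU ?_ ?_)
    · exact (card_biUnion_lt_iff_forall_of_isRegular hκ K.2.2.1).2 fun f _ => hsmall _ (hlocf K f)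
    · refine (card_biUnion_lt_iff_forall_of_isRegular hκ (hsmall _ l.finite_toSet)).2
        fun e _ => hU (hone _) (hsmall _ (Set.Subsingleton.finite ?_))
      rintro a ⟨ha, has, rfl⟩ b ⟨hb, hbs, hab⟩
      exact ((hW K).inj b hb a ha hbs has hab).symm
  have hstep : ∀ A : Set S, ∀ f, ∃ K : S, #A < κ → ListClosed (fun l => Ψ A l ∩ G) K.1 ∧
      (popular f → f ∈ K.1 ∧ W.tail f ∈ X K) := by
    intro A f
    by_cases hA : #A < κ
    · by_cases hf : popular f
      · obtain ⟨K, h1, h2⟩ := hf _ (hΨκ A hA)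
        exact ⟨K, fun _ => ⟨h1, fun _ => h2⟩⟩
      · obtain ⟨K, h1⟩ := hex _ (hΨκ A hA)
        exact ⟨K, fun _ => ⟨h1, fun h => absurd h hf⟩⟩
    · obtain ⟨K, -⟩ := hex _ hΦsκ
      exact ⟨K, fun h => absurd h hA⟩
  choose nxt hnxt using hstep
  set ι := κ.ord.ToType with hι
  have := noMaxOrder h₀.le
  let _ : SuccOrder ι := SuccOrder.ofLinearWellFoundedLT ι
  have hen : ∀ K : S, ∃ g : ι → E, ∀ f ∈ K.1, ∃ θ, g θ = f := by
    intro K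
    have h1 : #K.1 ≤ #ι := by rw [mk_ord_toType]; exact K.2.2.1.le
    obtain ⟨i⟩ := h1
    refine ⟨fun θ => if h : ∃ x, i x = θ then h.choose else c K, fun f hf => ⟨i ⟨f, hf⟩, ?_⟩⟩
    have h : ∃ x, i x = i ⟨f, hf⟩ := ⟨_, rfl⟩
    dsimp only
    rw [dif_pos h, i.injective h.choose_spec]
  choose en hen using hen
  obtain ⟨b, hb⟩ := exists_bookkeeping h₀.le
  obtain ⟨K₀, -⟩ := hex _ hΦsκ
  obtain ⟨K, hK⟩ := exists_recursion fun (ζ : ι) (K : Set.Iio ζ → S) => nxt (Set.range K)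
    (if h : (b ζ).1 < ζ then en (K ⟨_, h⟩) (b ζ).2 else c K₀)
  set R : ι → E := fun ζ => if (b ζ).1 < ζ then en (K (b ζ).1) (b ζ).2 else c K₀ with hR
  have hA : ∀ ζ : ι, #(Set.range fun η : Set.Iio ζ => K η) < κ := fun ζ =>
    mk_range_le.trans_lt (mk_Iio_ord_lt ζ)
  have hKc : ∀ ζ, ListClosed (fun l => Ψ (Set.range fun η : Set.Iio ζ => K η) l ∩ G) (K ζ).1 ∧
      (popular (R ζ) → R ζ ∈ (K ζ).1 ∧ W.tail (R ζ) ∈ X (K ζ)) := by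
    intro ζ
    have := hnxt (Set.range fun η : Set.Iio ζ => K η) (R ζ) (hA ζ)
    rw [hK ζ]
    exact this
  have hKs : ∀ ζ, ListClosed (fun l => Φs l ∩ G) (K ζ).1 := fun ζ l hl e he =>
    (hKc ζ).1 l hl ⟨Or.inl he.1, he.2⟩
  have hKl : ∀ η ζ, η < ζ → ListClosed (fun l => (((K η).1 ∪ {c (K η)}) ∪
    ((⋃ f ∈ (K η).1, loc (K η) f) ∪ ⋃ e ∈ {e | e ∈ l}, ({p (K η) e} ∪
      {e' | e' ∈ U (K η) ∧ W.tail e' ≠ W.s ∧ p (K η) e' = e}))) ∩ G) (K ζ).1 := by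
    intro η ζ h l hl e he
    exact (hKc ζ).1 l hl ⟨Or.inr (Set.mem_biUnion ⟨⟨η, h⟩, rfl⟩ he.1), he.2⟩
  have hp : ∀ f ζ, f ∈ (K ζ).1 → W.tail f ∈ X (K ζ) → popular f := by
    intro f ζ h1 h2
    by_contra h3
    refine hφ f h3 (K ζ) (fun l hl => hKs ζ (f :: l) ?_) h1 h2
    simpa using ⟨h1, hl⟩
  have hκ0 : κ.ord ≠ 0 := by
    simpa using (aleph0_pos.trans h₀).ne'
  have hne : Nonempty ι := Ordinal.nonempty_toType_iff.2 hκ0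
  obtain ⟨i₀, -, hi₀⟩ := wellFounded_lt.has_min (Set.univ : Set ι) Set.univ_nonempty
  have hUG : ∀ i, U (K i) ⊆ G := fun i e he => ((hW (K i)).sub he).1
  have hβ : ∀ f ∈ W.patchNeed G (fun i => (K i).1) (fun i => X (K i)), ∃ i ζ, i < ζ ∧ R ζ = f ∧
      f ∈ (K ζ).1 ∧ W.tail f ∈ X (K ζ) := by
    rintro f ⟨-, hs, -, ⟨i, hi, hfi⟩, -⟩
    obtain ⟨θ, hθ⟩ := hen _ f hfi
    obtain ⟨ζ, h1, h2⟩ := hb (i, θ)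
    have h3 : R ζ = f := by
      simp only [hR, h2, if_pos h1, hθ]
    have h4 := (hKc ζ).2 (h3 ▸ hp f i hfi hi.1)
    rw [h3] at h4
    exact ⟨i, ζ, h1, h3, h4⟩
  choose! i₁ β hβ₁ hβ₂ hβ₃ hβ₄ using hβ
  refine hG (hindered_of_patch (K := fun i => (K i).1) (Y := fun i => X (K i))
    (monotone_iff_forall_lt.2 fun i j h => ?_) (fun i => hW (K i)) (fun i => hcG (K i))
    (fun i => hcs (K i)) (fun i => hcU (K i)) (fun i => ?_) (fun i j h e he hs => ⟨?_, ?_⟩) i₀ β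
    (fun f hf => ⟨?_, ?_⟩) ?_)
  · exact fun e he => hKl i j h [] (by simp) ⟨Or.inl (Or.inl he), (K i).2.1 he⟩
  · exact hKl i _ (lt_succ i) [] (by simp) ⟨Or.inl (Or.inr rfl), (hcG (K i)).1⟩
  · exact fun h1 => hKl i j h [e] (by simpa using h1) ⟨Or.inr (Or.inr
      (Set.mem_biUnion (List.mem_singleton_self e) (Or.inl rfl))), hUG i ((hW _).mem e he hs)⟩
  · exact fun h1 => hKl i j h [p (K i) e] (by simpa using h1) ⟨Or.inr (Or.inr
      (Set.mem_biUnion (List.mem_singleton_self _) (Or.inr ⟨he, hs, rfl⟩))), hUG i he⟩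
  · rintro h
    exact hi₀ (i₁ f) trivial (h ▸ hβ₁ f hf)
  · have h1 := hloc (K (β f)) f (hβ₄ f hf) hf.2.1 ((K (succ (β f))).1 ∪ Gᶜ) (by
      intro e he
      by_cases heG : e ∈ G
      · exact Or.inl (hKl _ _ (lt_succ (β f)) [] (by simp)
          ⟨Or.inr (Or.inl (Set.mem_biUnion (hβ₃ f hf) he)), heG⟩)
      · exact Or.inr heG)
    convert h1 using 1
    · ext e
      simp only [Set.mem_inter_iff, Set.mem_sdiff, Set.mem_union, Set.mem_compl_iff]
      tauto
    · ext e
      have h2 : e ∈ U (K (β f)) → _ := fun h => (hW (K (β f))).sub h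
      simp only [Set.mem_inter_iff, Set.mem_sdiff, Set.mem_union, Set.mem_compl_iff] at h2 ⊢
      tauto
  · intro f hf g hg hfg
    rw [← hβ₂ f hf, ← hβ₂ g hg, hfg]

variable (W) in
/-- There are edge-disjoint walks in `M` to the target from all source edges of `M`. -/
def Linked (M : Set E) : Prop :=
  ∃ P : E → List E, (∀ a ∈ M, W.tail a = W.s → W.Walk M a W.t (P a)) ∧
    ∀ a ∈ M, ∀ b ∈ M, W.tail a = W.s → W.tail b = W.s → a ≠ b → (P a).Disjoint (P b)

theorem Walk.eq_start {M : Set E} {a : E} {y : V} {l : List E} (h : W.Walk M a y l) {e : E}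
    (he : e ∈ l) (hs : W.tail e = W.s) : e = a := by
  induction h with
  | base => simpa using he
  | snoc h _ ih =>
    rcases List.mem_cons.1 he with rfl | h1
    exacts [absurd hs h.ne_s, ih h1]

theorem Linked.iUnion {ι : Type w} {M : ι → Set E} {N : Set E} (hM : ∀ i, W.Linked (M i))
    (hd : ∀ i j e, e ∈ M i → e ∈ M j → i = j) (hN : ∀ i, M i ⊆ N)
    (hs : ∀ e ∈ N, W.tail e = W.s → ∃ i, e ∈ M i) : W.Linked N := by
  classical
  rcases isEmpty_or_nonempty ι with hι | hι
  · exact ⟨fun _ => [], fun a ha has => hι.elim (hs a ha has).choose,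
      fun a ha _ _ has => hι.elim (hs a ha has).choose⟩
  choose P hP hPd using hM
  choose! i hi using hs
  refine ⟨fun a => P (i a) a, fun a ha has => ?_, fun a ha b hb has hbs hab e h1 h2 => ?_⟩
  · have h1 := hP _ a (hi a ha has) has
    exact h1.mono fun e he => hN _ (h1.mem e he)
  · have h3 := hP _ a (hi a ha has) has
    have h4 := hP _ b (hi b hb hbs) hbs
    have h5 := hd _ _ e (h3.mem e h1) (h4.mem e h2)
    have h6 := hi b hb hbs
    dsimp only at h2
    rw [← h5] at h2 h6
    exact hPd _ a (hi a ha has) b h6 has hbs hab h1 h2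

theorem linked_of_walk {G : Set E} {a : E} {l : List E} (h : W.Walk G a W.t l) :
    W.Linked {e | e ∈ l} := by
  refine ⟨fun _ => l, fun b hb hbs => ?_, fun b hb c hc hbs hcs hbc => ?_⟩
  · rw [h.eq_start hb hbs]
    exact h.mono fun e he => he
  · exact absurd ((h.eq_start hb hbs).trans (h.eq_start hc hcs).symm) hbc

theorem linked_of_forall_ne {M : Set E} (h : ∀ e ∈ M, W.tail e ≠ W.s) : W.Linked M :=
  ⟨fun _ => [], fun a ha has => absurd has (h a ha), fun a ha _ _ has => absurd has (h a ha)⟩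

variable (W) in
/-- Every set of at most `κ` edges of an unhindered web extends to a linked set of at most `κ` edges
whose removal leaves an unhindered web. -/
def HasBlocks (κ : Cardinal.{v}) : Prop :=
  ∀ G : Set E, ¬ W.Hindered G → ∀ N ⊆ G, #N ≤ κ →
    ∃ M, N ⊆ M ∧ M ⊆ G ∧ #M ≤ κ ∧ ¬ W.Hindered (G \ M) ∧ W.Linked M

theorem hasBlocks_aleph0 : W.HasBlocks ℵ₀ := by
  classical
  intro G hG N hN hNc
  obtain ⟨Φ, hΦG, hΦ, hΦu⟩ := exists_closure_not_hindered isRegular_aleph_one aleph0_lt_aleph_one hG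
  have hT : ∀ (a : E) (Q : List E), ∃ l : List E, ¬ W.Hindered (G \ {e | e ∈ Q}) →
      a ∈ G \ {e | e ∈ Q} → W.tail a = W.s → W.Walk (G \ {e | e ∈ Q}) a W.t l ∧
        ¬ W.Hindered ((G \ {e | e ∈ Q}) \ {e | e ∈ l}) := by
    intro a Q
    by_cases h : ¬ W.Hindered (G \ {e | e ∈ Q}) ∧ a ∈ G \ {e | e ∈ Q} ∧ W.tail a = W.s
    · obtain ⟨l, hl⟩ := exists_safe_walk h.1 h.2.1 h.2.2
      exact ⟨l, fun _ _ _ => hl⟩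
    · exact ⟨[], fun h1 h2 h3 => absurd ⟨h1, h2, h3⟩ h⟩
  choose T hT using hT
  set Ψ : List E → Set E := fun l => Φ l ∪ (match l with
    | [] => ∅
    | a :: Q => {e | e ∈ T a Q} ∩ G) with hΨ
  have hΨκ : ∀ l, #(Ψ l) < ℵ₁ := by
    intro l
    refine mk_union_lt aleph0_lt_aleph_one.le (hΦ l) (countable_iff_mk_lt.1 ?_)
    cases l with
    | nil => exact Set.countable_empty
    | cons a Q => exact ((T a Q).finite_toSet.countable).mono Set.inter_subset_left
  have hΨG : ListClosed Ψ G := by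
    intro l _
    refine Set.union_subset (hΦG l) ?_
    cases l with
    | nil => exact Set.empty_subset _
    | cons a Q => exact Set.inter_subset_right
  obtain ⟨M, hNM, hMc, hM, hMmin⟩ := exists_listClosed isRegular_aleph_one aleph0_lt_aleph_one hΨκ
    (countable_iff_mk_lt.1 (le_aleph0_iff_set_countable.1 hNc))
  have hMG : M ⊆ G := hMmin G hN hΨG
  have hMcount : M.Countable := countable_iff_mk_lt.2 hMc
  refine ⟨M, hNM, hMG, le_aleph0_iff_set_countable.2 hMcount,
    hΦu M hMG hMc fun l hl => Set.subset_union_left.trans (hM l hl), ?_⟩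
  rcases M.eq_empty_or_nonempty with rfl | hne
  · exact linked_of_forall_ne (by simp)
  obtain ⟨a, rfl⟩ := hMcount.exists_eq_range hne
  set good : ℕ → List E → Prop := fun n Q => a n ∉ Q ∧ W.tail (a n) = W.s with hgood
  set Q : ℕ → List E := fun n => Nat.rec [] (fun n Q => if good n Q then T (a n) Q ++ Q else Q) n
    with hQ
  have hQs : ∀ n, Q (n + 1) = if good n (Q n) then T (a n) (Q n) ++ Q n else Q n := fun n => rfl
  have haM : ∀ n, a n ∈ Set.range a := fun n => ⟨n, rfl⟩
  have hQu : ∀ n, ¬ W.Hindered (G \ {e | e ∈ Q n}) ∧ ∀ e ∈ Q n, e ∈ Set.range a := by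
    intro n
    induction n with
    | zero => simpa [hQ] using hG
    | succ n ih =>
      rw [hQs]
      split_ifs with h
      · obtain ⟨h1, h2⟩ := hT (a n) (Q n) ih.1 ⟨hMG (haM n), h.1⟩ h.2
        refine ⟨?_, fun e he => ?_⟩
        · convert h2 using 2
          ext e
          simp only [Set.mem_sdiff, Set.mem_ofPred_eq, List.mem_append]
          tauto
        · rcases List.mem_append.1 he with h3 | h3
          · refine hM (a n :: Q n) ?_ (Or.inr ⟨h3, (h1.mem e h3).1⟩)
            simpa using ih.2
          · exact ih.2 e h3
      · exact ih
  have hQmono : ∀ m n, m ≤ n → ∀ e ∈ Q m, e ∈ Q n := by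
    intro m n hmn
    induction n, hmn using Nat.le_induction with
    | base => exact fun e he => he
    | succ n _ ih =>
      intro e he
      rw [hQs]
      split_ifs
      exacts [List.mem_append_right _ (ih e he), ih e he]
  have hwalk : ∀ n, good n (Q n) → W.Walk (G \ {e | e ∈ Q n}) (a n) W.t (T (a n) (Q n)) :=
    fun n h => (hT (a n) (Q n) (hQu n).1 ⟨hMG (haM n), h.1⟩ h.2).1
  refine Linked.iUnion (ι := ℕ) (M := fun n => {e | good n (Q n) ∧ e ∈ T (a n) (Q n)})
    (fun n => ?_) ?_ (fun n e he => ?_) ?_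
  · by_cases h : good n (Q n)
    · simpa [h] using linked_of_walk (hwalk n h)
    · exact linked_of_forall_ne fun e he => absurd he.1 h
  · have aux : ∀ m n e, m < n → (good m (Q m) ∧ e ∈ T (a m) (Q m)) →
        (good n (Q n) ∧ e ∈ T (a n) (Q n)) → False := by
      rintro m n e hmn ⟨h1, h2⟩ ⟨h3, h4⟩
      refine ((hwalk n h3).mem e h4).2 (hQmono (m + 1) n hmn e ?_)
      rw [hQs, if_pos h1]
      exact List.mem_append_left _ h2
    intro m n e h1 h2
    rcases lt_trichotomy m n with h | h | h
    exacts [(aux m n e h h1 h2).elim, h, (aux n m e h h2 h1).elim]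
  · refine (hQu (n + 1)).2 e ?_
    rw [hQs, if_pos he.1]
    exact List.mem_append_left _ he.2
  · rintro _ ⟨n, rfl⟩ hs
    have hex : ∀ m, a n ∈ Q m → ∃ i, a n ∈ {e | good i (Q i) ∧ e ∈ T (a i) (Q i)} := by
      intro m
      induction m with
      | zero => intro h; exact absurd h (by simp [hQ])
      | succ m ih =>
        rw [hQs]
        split_ifs with h
        · intro h1
          rcases List.mem_append.1 h1 with h2 | h2
          exacts [⟨m, h, h2⟩, ih h2]
        · exact ih
    by_cases h : a n ∈ Q n
    · exact hex n h
    · exact ⟨n, ⟨h, hs⟩, (hwalk n ⟨h, hs⟩).start_mem⟩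

/-- Transfinite construction of a linked set as an increasing union of blocks. -/
theorem exists_tower {ι : Type v} [LinearOrder ι] [WellFoundedLT ι] {G : Set E}
    (hG : ¬ W.Hindered G) (Small : ι → Set E → Prop) (Ω : ι → List E → Set E)
    (hΩ : ∀ i j l, i ≤ j → Ω i l ⊆ Ω j l)
    (hstep : ∀ j, ∀ K ⊆ G, ¬ W.Hindered (G \ K) → Small j K → ∃ L, K ⊆ L ∧ L ⊆ G ∧
      (∀ l, (∀ e ∈ l, e ∈ K) → Ω j l ∩ G ⊆ L) ∧ Small j L ∧ ¬ W.Hindered (G \ L) ∧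
        W.Linked (L \ K))
    (hsmall : ∀ (j) (L : ι → Set E), (∀ i < j, Small i (L i)) → Small j (⋃ i < j, L i))
    (hlim : ∀ (o : WithTop ι) (L : ι → Set E), (∃ j : ι, (j : WithTop ι) < o) →
      (∀ j : ι, (j : WithTop ι) < o → ∃ k : ι, j < k ∧ (k : WithTop ι) < o) → (∀ j, L j ⊆ G) →
      (∀ j : ι, (j : WithTop ι) < o → Small j (L j)) →
      (∀ l, (∀ e ∈ l, e ∈ ⋃ i : ι, ⋃ (_ : (i : WithTop ι) < o), L i) → ∀ j : ι,
        (j : WithTop ι) < o → Ω j l ∩ G ⊆ ⋃ i : ι, ⋃ (_ : (i : WithTop ι) < o), L i) →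
      ¬ W.Hindered (G \ ⋃ i : ι, ⋃ (_ : (i : WithTop ι) < o), L i))
    [Nonempty ι] [NoMaxOrder ι] :
    ∃ L : ι → Set E, (∀ j, Small j (L j)) ∧ (∀ j, L j ⊆ G) ∧ W.Linked (⋃ j, L j) ∧
      ¬ W.Hindered (G \ ⋃ j, L j) ∧ ∀ j, Ω j [] ∩ G ⊆ ⋃ j, L j := by
  classical
  have hstep' : ∀ j K, ∃ L, K ⊆ G → ¬ W.Hindered (G \ K) → Small j K → K ⊆ L ∧ L ⊆ G ∧
      (∀ l, (∀ e ∈ l, e ∈ K) → Ω j l ∩ G ⊆ L) ∧ Small j L ∧ ¬ W.Hindered (G \ L) ∧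
        W.Linked (L \ K) := by
    intro j K
    by_cases h : K ⊆ G ∧ ¬ W.Hindered (G \ K) ∧ Small j K
    · obtain ⟨L, hL⟩ := hstep j K h.1 h.2.1 h.2.2
      exact ⟨L, fun _ _ _ => hL⟩
    · exact ⟨∅, fun h1 h2 h3 => absurd ⟨h1, h2, h3⟩ h⟩
  choose F hF using hstep'
  obtain ⟨L, hL⟩ := exists_recursion fun (j : ι) (L : Set.Iio j → Set E) => F j (⋃ i, L i)
  have hL' : ∀ j, L j = F j (⋃ i < j, L i) := by
    intro j
    rw [hL j]
    congr 1
    ext e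
    simp
  have key : ∀ o : WithTop ι,
      (∀ j : ι, (j : WithTop ι) < o → (⋃ i < j, L i) ⊆ L j ∧ L j ⊆ G ∧
        (∀ l, (∀ e ∈ l, e ∈ ⋃ i < j, L i) → Ω j l ∩ G ⊆ L j) ∧ Small j (L j) ∧
        ¬ W.Hindered (G \ L j) ∧ W.Linked (L j \ ⋃ i < j, L i)) →
      ¬ W.Hindered (G \ ⋃ i : ι, ⋃ (_ : (i : WithTop ι) < o), L i) := by
    intro o ho
    by_cases h0 : ∃ j : ι, (j : WithTop ι) < o
    swap
    · push Not at h0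
      have : (⋃ i : ι, ⋃ (_ : (i : WithTop ι) < o), L i) = ∅ := by
        simp only [Set.iUnion_eq_empty]
        exact fun i hi => absurd hi (h0 i).not_gt
      rw [this, Set.sdiff_empty]
      exact hG
    have hmono : ∀ i j : ι, (j : WithTop ι) < o → i ≤ j → L i ⊆ L j := by
      intro i j hj hij
      rcases hij.lt_or_eq with h | rfl
      · exact fun e he => (ho j hj).1 (Set.mem_biUnion (by exact h) he)
      · exact subset_rfl
    by_cases h1 : ∀ j : ι, (j : WithTop ι) < o → ∃ k : ι, j < k ∧ (k : WithTop ι) < o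
    · have := hlim o (fun i => if (i : WithTop ι) < o then L i else ∅) h0 h1 ?_ ?_ ?_
      · convert this using 4 with i
        ext e
        simp only [Set.mem_iUnion]
        exact ⟨fun ⟨h, h'⟩ => ⟨h, by rwa [if_pos h]⟩, fun ⟨h, h'⟩ => ⟨h, by rwa [if_pos h] at h'⟩⟩
      · intro j
        split_ifs with h
        exacts [(ho j h).2.1, Set.empty_subset _]
      · intro j hj
        rw [if_pos hj]
        exact (ho j hj).2.2.2.1
      · intro l hl j hj
        have hl' : ∃ k : ι, (k : WithTop ι) < o ∧ ∀ e ∈ l, e ∈ L k := by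
          clear * - hl hmono h0
          induction l with
          | nil => exact h0.imp fun j hj => ⟨hj, by simp⟩
          | cons e l ih =>
            obtain ⟨k, hk, hk'⟩ := ih fun f hf => hl f (List.mem_cons_of_mem _ hf)
            have := hl e List.mem_cons_self
            simp only [Set.mem_iUnion] at this
            obtain ⟨m, hm, hm'⟩ := this
            rw [if_pos hm] at hm'
            have h2 : ((max k m : ι) : WithTop ι) < o := by
              rcases max_choice k m with h | h <;> rw [h] <;> assumption
            refine ⟨max k m, h2, ?_⟩
            intro f hf
            rcases List.mem_cons.1 hf with rfl | hf
            exacts [hmono _ _ h2 (le_max_right _ _) hm', hmono _ _ h2 (le_max_left _ _) (hk' f hf)]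
        obtain ⟨k, hk, hk'⟩ := hl'
        have h2 : ((max j k : ι) : WithTop ι) < o := by
          rcases max_choice j k with h | h <;> rw [h] <;> assumption
        obtain ⟨m, hm, hmo⟩ := h1 _ h2
        have h3 := (ho m hmo).2.2.1 l fun e he =>
          Set.mem_biUnion (show k ∈ {i | i < m} from (le_max_right _ _).trans_lt hm) (hk' e he)
        intro e he
        simp only [Set.mem_iUnion]
        refine ⟨m, hmo, ?_⟩
        rw [if_pos hmo]
        exact h3 ⟨hΩ j m l ((le_max_left _ _).trans hm.le) he.1, he.2⟩
    · push Not at h1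
      obtain ⟨j, hj, hj'⟩ := h1
      have : (⋃ i : ι, ⋃ (_ : (i : WithTop ι) < o), L i) = L j := by
        refine subset_antisymm (Set.iUnion₂_subset fun i hi => hmono i j hj ?_)
          (fun e he => Set.mem_biUnion (by exact hj) he)
        by_contra h
        exact (hj' i (not_le.1 h)).not_gt hi
      rw [this]
      exact (ho j hj).2.2.2.2.1
  have main : ∀ j, (⋃ i < j, L i) ⊆ L j ∧ L j ⊆ G ∧
        (∀ l, (∀ e ∈ l, e ∈ ⋃ i < j, L i) → Ω j l ∩ G ⊆ L j) ∧ Small j (L j) ∧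
        ¬ W.Hindered (G \ L j) ∧ W.Linked (L j \ ⋃ i < j, L i) := by
    intro j
    induction j using WellFoundedLT.induction with
    | ind j ih =>
      have h1 := key j fun i hi => ih i (WithTop.coe_lt_coe.1 hi)
      simp only [WithTop.coe_lt_coe] at h1
      have h2 := hF j (⋃ i < j, L i) (Set.iUnion₂_subset fun i hi => (ih i hi).2.1) h1
        (hsmall j L fun i hi => (ih i hi).2.2.2.1)
      rwa [← hL' j] at h2
  have hmono : ∀ i j : ι, i < j → L i ⊆ L j := fun i j hij e he =>
    (main j).1 (Set.mem_biUnion (by exact hij) he)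
  refine ⟨L, fun j => (main j).2.2.2.1, fun j => (main j).2.1, ?_, ?_, ?_⟩
  · refine Linked.iUnion (fun j => (main j).2.2.2.2.2) ?_
      (fun j => Set.sdiff_subset.trans (Set.subset_iUnion L j)) ?_
    · have aux : ∀ i j e, i < j → e ∈ L i → e ∈ L j \ (⋃ i < j, L i) → False :=
        fun i j e hij h1 h2 => h2.2 (Set.mem_biUnion (by exact hij) h1)
      intro i j e h1 h2
      rcases lt_trichotomy i j with h | h | h
      exacts [(aux i j e h h1.1 h2).elim, h, (aux j i e h h2.1 h1).elim]
    · intro e he _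
      obtain ⟨j, hj, hmin⟩ := wellFounded_lt.has_min {j | e ∈ L j} (Set.mem_iUnion.1 he)
      refine ⟨j, hj, fun h => ?_⟩
      simp only [Set.mem_iUnion] at h
      obtain ⟨i, hij, hi⟩ := h
      exact hmin i hi hij
  · have := key ⊤ fun j _ => main j
    simpa using this
  · intro j e he
    exact Set.mem_iUnion.2 ⟨j, (main j).2.2.1 [] (by simp) he⟩

end Web

theorem exists_cofinal_cardinals {κ : Cardinal.{v}} (hκ : κ.IsSingular) :
    ∃ c : κ.ord.cof.ord.ToType → Cardinal.{v}, Monotone c ∧ (∀ j, κ.ord.cof ≤ c j) ∧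
      (∀ j, ℵ₀ ≤ c j) ∧ (∀ j, c j < κ) ∧ ∀ μ < κ, ∃ j, μ ≤ c j := by
  have h₀ : ℵ₀ < κ := by
    refine lt_of_le_of_ne hκ.aleph0_le ?_
    rintro rfl
    exact not_isSingular_aleph0 hκ
  obtain ⟨S, hS, hSc⟩ := exists_cof_eq κ.ord.ToType
  rw [Ordinal.cof_toType] at hSc
  obtain ⟨f⟩ : Nonempty (κ.ord.cof.ord.ToType ≃ S) := Cardinal.eq.1 (by rw [hSc, mk_ord_toType])
  have : NoMaxOrder κ.ord.ToType := noMaxOrder h₀.le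
  set B : κ.ord.cof.ord.ToType → Set κ.ord.ToType :=
    fun j => ⋃ i ∈ Set.Iic j, Set.Iic (f i).1 with hB
  have hcof : κ.ord.cof < κ := hκ.cof_ord_lt
  have hcof₀ : ℵ₀ ≤ κ.ord.cof := by
    have : Nonempty κ.ord.ToType := mk_ne_zero_iff.1 (by
      rw [mk_ord_toType]; exact (aleph0_pos.trans h₀).ne')
    rw [← Ordinal.cof_toType]
    exact aleph0_le_cof
  have : NoMaxOrder κ.ord.cof.ord.ToType := noMaxOrder hcof₀
  refine ⟨fun j => max κ.ord.cof #(B j), fun i j hij => ?_, fun j => le_max_left _ _,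
    fun j => hcof₀.trans (le_max_left _ _), fun j => max_lt hcof ?_, fun μ hμ => ?_⟩
  · exact max_le_max le_rfl (mk_le_mk_of_subset (Set.biUnion_subset_biUnion_left
      (Set.Iic_subset_Iic.2 hij)))
  · have h : ¬ IsCofinal ((fun i => (f i).1) '' Set.Iic j) := by
      intro h
      have h1 := (cof_le h).trans mk_image_le
      rw [Ordinal.cof_toType] at h1
      obtain ⟨k, hk⟩ := exists_gt j
      exact absurd (h1.trans (mk_le_mk_of_subset fun i (hi : i ≤ j) => hi.trans_lt hk))
        (mk_Iio_ord_lt k).not_ge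
    simp only [IsCofinal, Set.mem_image, Set.mem_Iic, exists_exists_and_eq_and] at h
    push Not at h
    obtain ⟨x, hx⟩ := h
    refine (mk_le_mk_of_subset (Set.iUnion₂_subset fun i hi y hy => ?_)).trans_lt (mk_Iio_ord_lt x)
    exact lt_of_le_of_lt hy (hx i hi)
  · by_contra! h
    have h1 : (Set.univ : Set κ.ord.ToType) ⊆ ⋃ j, B j := by
      intro x _
      obtain ⟨y, hy, hxy⟩ := hS x
      refine Set.mem_iUnion.2 ⟨f.symm ⟨y, hy⟩, Set.mem_biUnion (Set.mem_Iic.2 le_rfl) ?_⟩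
      simpa using hxy
    have h2 := (mk_le_mk_of_subset h1).trans (mk_iUnion_le_sum_mk)
    rw [mk_univ, mk_ord_toType] at h2
    have h3 : Cardinal.sum (fun j => #(B j)) ≤ Cardinal.sum fun _ : κ.ord.cof.ord.ToType => μ :=
      sum_le_sum _ _ fun j => ((le_max_right _ _).trans_lt (h j)).le
    rw [sum_const', mk_ord_toType] at h3
    exact absurd (h2.trans h3) (mul_lt_of_lt h₀.le hcof hμ).not_ge

namespace Web

variable {V : Type u} {E : Type v} {W : Web V E}

theorem HasBlocks.exists_step {μ : Cardinal.{v}} (hB : W.HasBlocks μ) (hμ : ℵ₀ ≤ μ) {G K X : Set E}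
    (hK : K ⊆ G) (hu : ¬ W.Hindered (G \ K)) (hKμ : #K ≤ μ) (hX : #X ≤ μ) :
    ∃ L, K ⊆ L ∧ L ⊆ G ∧ X ∩ G ⊆ L ∧ #L ≤ μ ∧ ¬ W.Hindered (G \ L) ∧ W.Linked (L \ K) := by
  obtain ⟨M, h1, h2, h3, h4, h5⟩ := hB (G \ K) hu (X ∩ (G \ K)) Set.inter_subset_right
    ((mk_le_mk_of_subset Set.inter_subset_left).trans hX)
  refine ⟨K ∪ M, Set.subset_union_left, Set.union_subset hK (h2.trans Set.sdiff_subset), ?_, ?_, ?_,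
    ?_⟩
  · intro e he
    by_cases h : e ∈ K
    exacts [Or.inl h, Or.inr (h1 ⟨he.1, he.2, h⟩)]
  · exact (mk_union_le _ _).trans (add_le_of_le hμ hKμ h3)
  · rwa [Set.sdiff_sdiff] at h4
  · rwa [Set.union_sdiff_left, sdiff_eq_left.2 (Set.disjoint_left.2 fun e h => (h2 h).2)]

theorem hasBlocks_of_isRegular {κ : Cardinal.{v}} (hκ : κ.IsRegular) (h₀ : ℵ₀ < κ)
    (ih : ∀ μ < κ, ℵ₀ ≤ μ → W.HasBlocks μ) : W.HasBlocks κ := by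
  intro G hG N hN hNκ
  have hκ' : (succ κ).IsRegular := isRegular_succ h₀.le
  have h₀' : ℵ₀ < succ κ := h₀.trans (lt_succ κ)
  obtain ⟨Φ, hΦG, hΦ, hΦu⟩ := exists_closure_not_hindered hκ h₀ hG
  obtain ⟨Φ', hΦG', hΦ', hΦu'⟩ := exists_closure_not_hindered hκ' h₀' hG
  set ι := κ.ord.ToType with hι
  have := noMaxOrder h₀.le
  have hικ : #ι = κ := mk_ord_toType κ
  have hne : Nonempty ι := mk_ne_zero_iff.1 (by rw [hικ]; exact (aleph0_pos.trans h₀).ne')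
  have hg : ∀ l, ∃ g : E → ι, Set.InjOn g (Φ' l ∪ N) := by
    intro l
    have h1 : #(Φ' l ∪ N : Set E) ≤ #ι := by
      rw [hικ, ← lt_succ_iff]
      exact mk_union_lt h₀'.le (hΦ' l) (lt_succ_iff.2 hNκ)
    obtain ⟨f⟩ := h1
    classical
    refine ⟨fun x => if h : x ∈ Φ' l ∪ N then f ⟨x, h⟩ else hne.some, fun x hx y hy hxy => ?_⟩
    simp only [dif_pos hx, dif_pos hy] at hxy
    simpa using f.injective hxy
  choose g hg using hg
  set Ω : ι → List E → Set E := fun j l => Φ l ∪ {x | x ∈ Φ' l ∪ N ∧ g l x < j} with hΩ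
  have hΩκ : ∀ j l, #(Ω j l) < κ := by
    intro j l
    refine mk_union_lt h₀.le (hΦ l) (lt_of_le_of_lt ?_ (mk_Iio_ord_lt j))
    refine mk_le_of_injective (f := fun x => ⟨g l x.1, x.2.2⟩) fun x y hxy => ?_
    exact Subtype.ext (hg l x.2.1 y.2.1 (congrArg Subtype.val hxy))
  obtain ⟨L, hL1, hL2, hL3, hL4, hL5⟩ := exists_tower hG (fun (_ : ι) K => #K < κ) Ω
    (fun i j l hij => Set.union_subset_union_right _ fun x hx => ⟨hx.1, hx.2.trans_le hij⟩)
    (by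
      intro j K hK hu hKκ
      have hX := mk_biUnion_lists_lt hκ h₀ (hΩκ j) hKκ
      have hμ := max_lt h₀ (max_lt hKκ hX)
      obtain ⟨L, h1, h2, h3, h4, h5⟩ := (ih _ hμ (le_max_left _ _)).exists_step (le_max_left _ _)
        hK hu ((le_max_left _ _).trans (le_max_right _ _))
        ((le_max_right _ _).trans (le_max_right _ _))
      refine ⟨L, h1, h2, fun l hl e he => h3 ⟨Set.mem_biUnion (by exact hl) he.1, he.2⟩,
        h4.trans_lt hμ, h5⟩)
    (fun j L hL => (card_biUnion_lt_iff_forall_of_isRegular hκ (mk_Iio_ord_lt j)).2 hL)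
    (by
      intro o L h0 h1 hLG hLκ hcl
      obtain rfl | ⟨i, rfl⟩ : o = ⊤ ∨ ∃ i : ι, o = i := by
        cases o with
        | top => exact Or.inl rfl
        | coe i => exact Or.inr ⟨i, rfl⟩
      · simp only [WithTop.coe_lt_top, Set.iUnion_true, forall_true_left] at hLκ hcl ⊢
        refine hΦu' _ (Set.iUnion_subset hLG)
          ((card_iUnion_lt_iff_forall_of_isRegular hκ' (hικ ▸ lt_succ κ)).2
            fun i => (hLκ i).trans (lt_succ κ)) fun l hl x hx => ?_
        obtain ⟨j, hj⟩ := exists_gt (g l x)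
        exact hcl l hl j ⟨Or.inr ⟨Or.inl hx, hj⟩, hΦG' l hx⟩
      · obtain ⟨k, hk⟩ := h0
        refine hΦu _ (Set.iUnion₂_subset fun i _ => hLG i) ?_
          fun l hl x hx => hcl l hl k hk ⟨Or.inl hx, hΦG l hx⟩
        simp only [WithTop.coe_lt_coe] at hLκ ⊢
        exact (card_biUnion_lt_iff_forall_of_isRegular hκ (mk_Iio_ord_lt i)).2 hLκ)
  refine ⟨⋃ j, L j, fun x hx => ?_, Set.iUnion_subset hL2, ?_, hL4, hL3⟩
  · obtain ⟨j, hj⟩ := exists_gt (g [] x)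
    exact hL5 j ⟨Or.inr ⟨Or.inr hx, hj⟩, hN hx⟩
  · rw [← lt_succ_iff]
    exact (card_iUnion_lt_iff_forall_of_isRegular hκ' (hικ ▸ lt_succ κ)).2
      fun i => (hL1 i).trans (lt_succ κ)

theorem hasBlocks_of_isSingular {κ : Cardinal.{v}} (hκ : κ.IsSingular) (h₀ : ℵ₀ < κ)
    (ih : ∀ μ < κ, ℵ₀ ≤ μ → W.HasBlocks μ) : W.HasBlocks κ := by
  classical
  intro G hG N hN hNκ
  obtain ⟨ι, _, _, hι, c, hcm, hcι, hc₀, hcκ, hcc⟩ : ∃ (ι : Type v) (_ : LinearOrder ι)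
      (_ : WellFoundedLT ι) (_ : NoMaxOrder ι) (c : ι → Cardinal.{v}), Monotone c ∧
      (∀ j, #ι ≤ c j) ∧ (∀ j, ℵ₀ ≤ c j) ∧ (∀ j, c j < κ) ∧ ∀ μ < κ, ∃ j, μ ≤ c j := by
    obtain ⟨c, h1, h2, h3⟩ := exists_cofinal_cardinals hκ
    refine ⟨_, _, inferInstance,
      noMaxOrder (isRegular_cof (isSuccLimit_ord h₀.le)).1, c, h1, ?_, h3⟩
    rwa [mk_ord_toType]
  obtain ⟨j₀, -⟩ := hcc ℵ₀ h₀
  have hne : Nonempty ι := ⟨j₀⟩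
  have hlimκ : IsSuccLimit κ := hκ.isSuccLimit
  have hr : ∀ j, (succ (c j)).IsRegular := fun j => isRegular_succ (hc₀ j)
  have hr₀ : ∀ j, ℵ₀ < succ (c j) := fun j => (hc₀ j).trans_lt (lt_succ _)
  have hIio : ∀ (s : Set ι) j, #s < succ (c j) := fun s j =>
    ((mk_set_le s).trans (hcι j)).trans_lt (lt_succ _)
  set d : WithTop ι → Cardinal.{v} := fun o =>
    Cardinal.sum fun j : {j : ι // (j : WithTop ι) < o} => c j with hd
  have hcd : ∀ (o : WithTop ι) (j : ι), (j : WithTop ι) < o → c j ≤ d o := fun o j hj =>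
    le_sum (fun j : {j : ι // (j : WithTop ι) < o} => c j) ⟨j, hj⟩
  have hκd : κ ≤ d ⊤ := by
    by_contra! h
    obtain ⟨j, hj⟩ := hcc _ (hlimκ.succ_lt h)
    exact absurd (hj.trans (hcd ⊤ j (WithTop.coe_lt_top j))) (lt_succ _).not_ge
  have hrank : ∀ (o : WithTop ι) (S : Set E), #S ≤ d o → ∃ g : E → ι,
      (∀ x ∈ S, (g x : WithTop ι) < o) ∧ ∀ j, #{x | x ∈ S ∧ g x < j} < succ (c j) := by
    intro o S hS
    obtain ⟨f⟩ := hS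
    refine ⟨fun x => if h : x ∈ S then (f ⟨x, h⟩).1.1 else j₀, fun x hx => ?_, fun j => ?_⟩
    · simp only [dif_pos hx]
      exact (f ⟨x, hx⟩).1.2
    · have h1 : {x | x ∈ S ∧ (if h : x ∈ S then (f ⟨x, h⟩).1.1 else j₀) < j} ⊆
          ⋃ i ∈ Set.Iio j, {x | ∃ h : x ∈ S, (f ⟨x, h⟩).1.1 = i} := by
        rintro x ⟨hx, hxj⟩
        rw [dif_pos hx] at hxj
        exact Set.mem_biUnion hxj ⟨hx, rfl⟩
      refine (mk_le_mk_of_subset h1).trans_lt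
        ((card_biUnion_lt_iff_forall_of_isRegular (hr j) (hIio _ j)).2 fun i hi => ?_)
      refine lt_succ_iff.2 (le_trans ?_ (hcm (le_of_lt hi)))
      by_cases hio : (i : WithTop ι) < o
      · rw [← mk_out (c i)]
        refine le_trans ?_ (mk_range_le (f := fun y : (c i).out =>
          (⟨⟨i, hio⟩, y⟩ : Σ j : {j : ι // (j : WithTop ι) < o}, (c j).out)))
        refine mk_le_of_injective (f := fun x : {x | ∃ h : x ∈ S, (f ⟨x, h⟩).1.1 = i} =>
          ⟨f ⟨x.1, x.2.1⟩, ?_⟩) fun x y hxy => ?_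
        · obtain ⟨x, hx, rfl⟩ := x
          exact ⟨_, rfl⟩
        · have h2 := f.injective (congrArg Subtype.val hxy)
          exact Subtype.ext (Subtype.mk.inj h2)
      · have : IsEmpty {x | ∃ h : x ∈ S, (f ⟨x, h⟩).1.1 = i} :=
          ⟨fun ⟨x, hx, hxi⟩ => hio (hxi ▸ (f ⟨x, hx⟩).1.2)⟩
        exact (mk_eq_zero _).trans_le zero_le
  have hdata : ∀ o : WithTop ι, ∃ (S : List E → Set E) (g : List E → E → ι),
      (∀ l, S l ⊆ G) ∧ (∀ l j, #{x | x ∈ S l ∧ g l x < j} < succ (c j)) ∧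
      (∀ l, ∀ x ∈ S l, (g l x : WithTop ι) < o) ∧
      ((∃ j : ι, (j : WithTop ι) < o) → ∀ K ⊆ G, #K < succ (d o) → ListClosed S K →
        ¬ W.Hindered (G \ K)) ∧ (o = ⊤ → ∀ l, N ⊆ S l) := by
    intro o
    by_cases ho : ∃ j : ι, (j : WithTop ι) < o
    · obtain ⟨j, hj⟩ := ho
      have hd₀ : ℵ₀ ≤ d o := (hc₀ j).trans (hcd o j hj)
      obtain ⟨Φ, hΦG, hΦ, hΦu⟩ := exists_closure_not_hindered (isRegular_succ hd₀)
        (hd₀.trans_lt (lt_succ _)) hG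
      set S : List E → Set E := fun l => Φ l ∪ {x | x ∈ N ∧ o = ⊤} with hS
      have hSd : ∀ l, #(S l) ≤ d o := by
        intro l
        refine (mk_union_le _ _).trans (add_le_of_le hd₀ (lt_succ_iff.1 (hΦ l)) ?_)
        by_cases h : o = ⊤
        · subst h
          simp [hNκ.trans hκd]
        · simp [h]
      choose g hg1 hg2 using fun l => hrank o (S l) (hSd l)
      refine ⟨S, g, fun l => Set.union_subset (hΦG l) fun x hx => hN hx.1, hg2, hg1,
        fun _ K hK hKd hcl => hΦu K hK hKd fun l hl => Set.subset_union_left.trans (hcl l hl),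
        fun h l x hx => Or.inr ⟨hx, h⟩⟩
    · refine ⟨fun _ => ∅, fun _ _ => j₀, fun l => Set.empty_subset _, fun l j => ?_, ?_,
        fun h => absurd h ho, ?_⟩
      · simp [aleph0_pos.trans (hr₀ j)]
      · simp
      · rintro rfl
        exact absurd ⟨j₀, WithTop.coe_lt_top j₀⟩ ho
  choose S g hSG hS hSg hSu hSN using hdata
  set Ω : ι → List E → Set E := fun j l => ⋃ o, {x | x ∈ S o l ∧ g o l x < j} with hΩ
  have hΩκ : ∀ j l, #(Ω j l) < succ (c j) := by
    intro j l
    refine (card_iUnion_lt_iff_forall_of_isRegular (hr j) ?_).2 fun o => hS o l j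
    have h1 : #(WithTop ι) = #ι + 1 := mk_option
    rw [h1]
    exact add_lt_of_lt (hr₀ j).le ((hcι j).trans_lt (lt_succ _)) (one_lt_aleph0.trans (hr₀ j))
  obtain ⟨L, hL1, hL2, hL3, hL4, hL5⟩ := exists_tower hG (fun (j : ι) K => #K < succ (c j)) Ω
    (fun i j l hij => Set.iUnion_mono fun o x hx => ⟨hx.1, hx.2.trans_le hij⟩)
    (by
      intro j K hK hu hKκ
      have hX := mk_biUnion_lists_lt (hr j) (hr₀ j) (hΩκ j) hKκ
      obtain ⟨L, h1, h2, h3, h4, h5⟩ := (ih _ (hcκ j) (hc₀ j)).exists_step (hc₀ j)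
        hK hu (lt_succ_iff.1 hKκ) (lt_succ_iff.1 hX)
      refine ⟨L, h1, h2, fun l hl e he => h3 ⟨Set.mem_biUnion (by exact hl) he.1, he.2⟩,
        lt_succ_iff.2 h4, h5⟩)
    (fun j L hL => (card_biUnion_lt_iff_forall_of_isRegular (hr j) (hIio _ j)).2 fun i hi =>
      (hL i hi).trans_le (succ_le_succ (hcm (le_of_lt hi))))
    (by
      intro o L h0 h1 hLG hLκ hcl
      refine hSu o h0 _ (Set.iUnion₂_subset fun i _ => hLG i) ?_ fun l hl x hx => ?_
      · obtain ⟨j, hj⟩ := h0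
        refine (card_biUnion_lt_iff_forall_of_isRegular
          (isRegular_succ ((hc₀ j).trans (hcd o j hj)))
          ((hIio _ j).trans_le (succ_le_succ (hcd o j hj)))).2 fun i hi =>
            (hLκ i hi).trans_le (succ_le_succ (hcd o i hi))
      · obtain ⟨k, hk, hko⟩ := h1 _ (hSg o l x hx)
        exact hcl l hl k hko ⟨Set.mem_iUnion.2 ⟨o, hx, hk⟩, hSG o l hx⟩)
  refine ⟨⋃ j, L j, fun x hx => ?_, Set.iUnion_subset hL2, ?_, hL4, hL3⟩
  · obtain ⟨j, hj⟩ := exists_gt (g ⊤ [] x)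
    exact hL5 j ⟨Set.mem_iUnion.2 ⟨⊤, hSN ⊤ rfl [] hx, hj⟩, hN hx⟩
  · rw [← lt_succ_iff]
    exact (card_iUnion_lt_iff_forall_of_isRegular (isRegular_succ h₀.le)
      (((hcι j₀).trans_lt (hcκ j₀)).trans (lt_succ κ))).2
      fun i => (hL1 i).trans_le (succ_le_succ (hcκ i).le)

theorem hasBlocks (κ : Cardinal.{v}) (hκ : ℵ₀ ≤ κ) : W.HasBlocks κ := by
  induction κ using WellFoundedLT.induction with
  | ind κ ih =>
    rcases hκ.eq_or_lt with rfl | h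
    · exact hasBlocks_aleph0
    · rcases isRegular_or_isSingular hκ with h1 | h1
      exacts [hasBlocks_of_isRegular h1 h ih, hasBlocks_of_isSingular h1 h ih]

/-- An unhindered web is linked. -/
theorem linked_of_not_hindered {G : Set E} (hG : ¬ W.Hindered G) : W.Linked G := by
  obtain ⟨M, h1, h2, -, -, h3⟩ := hasBlocks (W := W) _ (le_max_left ℵ₀ #G) G hG G subset_rfl
    (le_max_right _ _)
  rwa [subset_antisymm h2 h1] at h3

end Web

namespace MultiDigraph

variable {V : Type u} {E : Type v} {D : MultiDigraph V E}

/-- Directed walks, given by their starting vertex, terminal vertex and list of edges. -/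
inductive Trail (D : MultiDigraph V E) : V → V → List E → Prop
  | nil (x : V) : Trail D x x []
  | cons {e : E} {x y : V} {l : List E} :
    Trail D (D.head e) y l → D.tail e = x → Trail D x y (e :: l)

theorem Trail.of_chain : ∀ {l : List E} (hne : l ≠ []),
    l.IsChain (fun e f => D.head e = D.tail f) →
      D.Trail (D.tail (l.head hne)) (D.head (l.getLast hne)) l
  | [_], _, _ => .cons (.nil _) rfl
  | e :: f :: l, _, h => by
    rw [List.isChain_cons_cons] at h
    have := Trail.of_chain (l := f :: l) (by simp) h.2
    simp only [List.head_cons, ← h.1] at this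
    exact this.cons rfl

theorem Trail.isChain {x y : V} {l : List E} (h : D.Trail x y l) :
    l.IsChain (fun e f => D.head e = D.tail f) := by
  induction h with
  | nil => exact .nil
  | cons h _ ih =>
    cases h with
    | nil => exact .singleton _
    | cons h h' => exact List.isChain_cons_cons.2 ⟨h'.symm, ih⟩

theorem Trail.tail_head {x y : V} {l : List E} (h : D.Trail x y l) (hne : l ≠ []) :
    D.tail (l.head hne) = x := by
  cases h with
  | nil => exact absurd rfl hne
  | cons _ h => exact h

theorem Trail.head_getLast {x y : V} {l : List E} (h : D.Trail x y l) (hne : l ≠ []) :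
    D.head (l.getLast hne) = y := by
  induction h with
  | nil => exact absurd rfl hne
  | cons h _ ih =>
    cases h with
    | nil => rfl
    | cons h => exact ih (by simp)

theorem Trail.exists_suffix {a x y : V} {l : List E} (h : D.Trail a y l)
    (hx : x ∈ a :: l.map D.head) :
    ∃ l', D.Trail x y l' ∧ l' ⊆ l ∧ (x :: l'.map D.head).Sublist (a :: l.map D.head) := by
  induction h with
  | nil =>
    obtain rfl : x = _ := by simpa using hx
    exact ⟨[], .nil _, by simp, by simp⟩
  | @cons e x' y l h he' ih =>
    rcases List.mem_cons.1 hx with rfl | hx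
    · exact ⟨e :: l, h.cons he', by simp, by simp⟩
    · obtain ⟨l', h1, h2, h3⟩ := ih hx
      exact ⟨l', h1, List.subset_cons_of_subset _ h2, h3.cons _⟩

theorem Trail.exists_nodup {x y : V} {l : List E} (h : D.Trail x y l) :
    ∃ l', D.Trail x y l' ∧ l' ⊆ l ∧ (x :: l'.map D.head).Nodup := by
  induction h with
  | nil => exact ⟨[], .nil _, by simp, by simp⟩
  | @cons e x' y l h he' ih =>
    obtain ⟨l', h1, h2, h3⟩ := ih
    by_cases hx : x' ∈ D.head e :: l'.map D.head
    · obtain ⟨l'', h4, h5, h6⟩ := h1.exists_suffix hx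
      exact ⟨l'', h4, List.subset_cons_of_subset _ (List.Subset.trans h5 h2), h3.sublist h6⟩
    · exact ⟨e :: l', h1.cons he', List.cons_subset_cons _ h2, List.nodup_cons.2 ⟨hx, h3⟩⟩

/-- A walk from outside `X` into `X` uses an edge entering `X`. -/
theorem Trail.exists_mem_edgesInto {x y : V} {l : List E} (h : D.Trail x y l) {X : Set V}
    (hx : x ∉ X) (hy : y ∈ X) : ∃ e ∈ l, e ∈ D.edgesInto Set.univ X := by
  induction h with
  | nil => exact absurd hy hx
  | @cons e x' y l h he' ih =>
    by_cases he : D.head e ∈ X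
    · exact ⟨e, by simp, trivial, he' ▸ hx, he⟩
    · obtain ⟨f, hf, hfX⟩ := ih he hy
      exact ⟨f, by simp [hf], hfX⟩

theorem Trail.exists_of_mem {x y : V} {l : List E} (h : D.Trail x y l) {f : E} (hf : f ∈ l) :
    ∃ l₁ l₂, l = l₁ ++ f :: l₂ ∧ D.Trail (D.head f) y l₂ := by
  induction h with
  | nil => simp at hf
  | @cons e x' y l h he' ih =>
    rcases List.mem_cons.1 hf with rfl | hf
    · exact ⟨[], l, rfl, h⟩
    · obtain ⟨l₁, l₂, rfl, h2⟩ := ih hf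
      exact ⟨e :: l₁, l₂, rfl, h2⟩

/-- In a `v`-linked set `X` the linking paths stay inside `X` after their first edge. -/
theorem VLinked.exists_trail {r v : V} {X : Set V} (h : D.VLinked Set.univ r v X) :
    ∃ P : E → List E, (∀ a ∈ D.edgesInto Set.univ X, D.Trail (D.head a) v (P a) ∧
      ∀ f ∈ P a, D.tail f ∈ X ∧ D.head f ∈ X) ∧
      ∀ a ∈ D.edgesInto Set.univ X, ∀ b ∈ D.edgesInto Set.univ X, a ≠ b →
        (P a).Disjoint (P b) := by
  obtain ⟨-, hv, P, hP, hd⟩ := h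
  refine ⟨fun a => (P a).tail, fun a ha => ?_, fun a ha b hb hab f h1 h2 =>
    hd ha hb hab (List.mem_of_mem_tail h1) (List.mem_of_mem_tail h2)⟩
  obtain ⟨⟨hne, h1, h2, h3, h4, -⟩, h5⟩ := hP a ha
  have ht := Trail.of_chain hne h3
  rw [h2] at ht
  have hmem : ∀ b ∈ D.edgesInto Set.univ X, b ∈ P a → b = a := by
    intro b hb hba
    by_contra hne
    have hbb := List.mem_of_mem_head? (hP b hb).2
    exact hd hb ha hne hbb hba
  obtain ⟨l, hl⟩ : ∃ l, P a = a :: l := by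
    cases hPa : P a with
    | nil => exact absurd hPa hne
    | cons b l =>
      rw [hPa] at h5
      obtain rfl : b = a := by simpa using h5
      exact ⟨l, rfl⟩
  simp only [hl] at *
  have hal : a ∉ l := fun hal => by
    have := (List.nodup_cons.1 (List.nodup_cons.1 h4).2).1
    exact this (List.mem_map_of_mem hal)
  simp only [List.tail_cons]
  have hin : ∀ l₁ l₂ x, l = l₁ ++ l₂ → D.Trail x v l₂ → x ∈ X := by
    intro l₁ l₂ x hl' hx
    by_contra hxX
    obtain ⟨b, hb, hbX⟩ := hx.exists_mem_edgesInto hxX hv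
    have hbl : b ∈ l := by rw [hl']; exact List.mem_append_right _ hb
    exact hal (hmem b hbX (List.mem_cons_of_mem _ hbl) ▸ hbl)
  cases ht with
  | cons ht _ =>
    refine ⟨ht, fun f hf => ?_⟩
    obtain ⟨l₁, l₂, hl', h6⟩ := ht.exists_of_mem hf
    exact ⟨hin _ _ _ hl' (h6.cons rfl), hin (l₁ ++ [f]) l₂ _ (by simp [hl']) h6⟩

open Classical in
/-- The web from `v` to `r` obtained from `D` by reversing all edges and contracting `X` to `v`. -/
noncomputable def reversedWeb (D : MultiDigraph V E) {r v : V} (hv : v ≠ r) {X : Set V}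
    (hvX : v ∈ X) : Web V E where
  tail e := if D.head e ∈ X then v else D.head e
  head e := if D.tail e ∈ X then r else D.tail e
  s := v
  t := r
  s_ne_t := hv
  head_ne e := by
    split_ifs with h
    exacts [hv.symm, fun h' => h (h' ▸ hvX)]

variable {r v : V} {hv : v ≠ r} {X : Set V} {hvX : v ∈ X}

theorem reversedWeb_tail_of_mem {e : E} (he : D.head e ∈ X) :
    (D.reversedWeb hv hvX).tail e = v := if_pos he

theorem reversedWeb_tail_of_notMem {e : E} (he : D.head e ∉ X) :
    (D.reversedWeb hv hvX).tail e = D.head e := if_neg he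

theorem reversedWeb_head_of_notMem {e : E} (he : D.tail e ∉ X) :
    (D.reversedWeb hv hvX).head e = D.tail e := if_neg he

theorem reversedWeb_tail_eq_iff {e : E} : (D.reversedWeb hv hvX).tail e = v ↔ D.head e ∈ X := by
  refine ⟨fun h => ?_, reversedWeb_tail_of_mem⟩
  by_contra he
  rw [reversedWeb_tail_of_notMem he] at h
  exact he (h ▸ hvX)

open Relation in
/-- A wave of the reversed web extends a `v`-linked set. -/
theorem VLinked.union_wave (hX : D.VLinked Set.univ r v X) {Y : Set V} {U : Set E} {p : E → E}
    (hY : (D.reversedWeb hv hvX).IsWave {e | D.tail e ∉ X} Y U p) :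
    D.VLinked Set.univ r v (X ∪ Y) := by
  obtain ⟨P, hP, hd⟩ := hX.exists_trail
  set W := D.reversedWeb hv hvX with hW
  have hs : ∀ e, W.tail e = W.s ↔ D.head e ∈ X := fun e => reversedWeb_tail_eq_iff
  have hhead : ∀ e ∈ U, D.head e ∈ X ∪ Y := by
    intro e he
    by_cases h : D.head e ∈ X
    · exact Or.inl h
    · exact Or.inr (reversedWeb_tail_of_notMem (hv := hv) (hvX := hvX) h ▸ hY.tail_mem e he)
  have hmem : ∀ {f e}, ReflTransGen (W.Prel p) f e → e ∈ U → f ∈ U := by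
    intro f e h he
    induction h using ReflTransGen.head_induction_on with
    | refl => exact he
    | head h _ ih => exact h.2 ▸ hY.mem _ ih h.1
  have hexit : ∀ e ∈ D.edgesInto Set.univ (X ∪ Y), e ∈ U ∧ ∀ f ∈ U, ¬ W.Prel p e f := by
    rintro e ⟨-, he1, he2⟩
    rw [Set.mem_union, not_or] at he1
    have h1 : W.head e ∉ Y := by
      rw [hW, reversedWeb_head_of_notMem he1.1]
      exact he1.2
    refine ⟨hY.exit e he1.1 ?_ h1, fun f hf h => h1 ?_⟩
    · by_cases h : D.head e ∈ X
      · rw [(hs e).2 h]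
        exact hY.s_mem
      · rw [hW, reversedWeb_tail_of_notMem h]
        exact he2.resolve_left h
    · rw [h.2, hY.head_eq f hf h.1]
      exact hY.tail_mem f hf
  have huniq : ∀ {f e e'}, ReflTransGen (W.Prel p) f e → ReflTransGen (W.Prel p) f e' →
      e ∈ D.edgesInto Set.univ (X ∪ Y) → e' ∈ D.edgesInto Set.univ (X ∪ Y) → e = e' := by
    intro f e e' h h' he he'
    induction h using ReflTransGen.head_induction_on with
    | refl =>
      rcases ReflTransGen.cases_head h' with rfl | ⟨g, hg, hge⟩
      · rfl
      · exact absurd hg ((hexit _ he).2 g (hmem hge (hexit _ he').1))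
    | @head a b hab hbe ih =>
      have hb := hmem hbe (hexit _ he).1
      rcases ReflTransGen.cases_head h' with rfl | ⟨g, hg, hge⟩
      · exact absurd hab ((hexit _ he').2 b hb)
      · have hg' := hmem hge (hexit _ he').1
        obtain rfl := hY.inj b hb g hg' hab.1 hg.1 (hab.2.symm.trans hg.2)
        exact ih hge
  have hwalk : ∀ e ∈ U, ∃ l, D.Trail (D.head e) v l ∧ ∀ f ∈ l, ReflTransGen (W.Prel p) f e ∨
      (D.tail f ∈ X ∧ D.head f ∈ X ∧
        ∃ a ∈ D.edgesInto Set.univ X, ReflTransGen (W.Prel p) a e ∧ f ∈ P a) := by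
    intro e he
    induction hY.acc e he with
    | intro e _ ih =>
      by_cases h : D.head e ∈ X
      · have heX : e ∈ D.edgesInto Set.univ X := ⟨trivial, hY.sub he, h⟩
        exact ⟨P e, (hP e heX).1, fun f hf => Or.inr ⟨((hP e heX).2 f hf).1, ((hP e heX).2 f hf).2,
          e, heX, .refl, hf⟩⟩
      · have h' : W.tail e ≠ W.s := mt (hs e).1 h
        have hpe : W.Prel p (p e) e := ⟨h', rfl⟩
        obtain ⟨l, hl, hl'⟩ := ih (p e) hpe (hY.mem e he h')
        refine ⟨p e :: l, hl.cons ?_, fun f hf => ?_⟩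
        · have h1 := hY.head_eq e he h'
          rwa [hW, reversedWeb_head_of_notMem (hY.sub (hY.mem e he h')),
            reversedWeb_tail_of_notMem h] at h1
        · rcases List.mem_cons.1 hf with rfl | hf
          · exact Or.inl (.single hpe)
          · rcases hl' f hf with h1 | ⟨h1, h2, a, h3, h4, h5⟩
            exacts [Or.inl (h1.tail hpe), Or.inr ⟨h1, h2, a, h3, h4.tail hpe, h5⟩]
  have hpath : ∀ e, ∃ l, e ∈ D.edgesInto Set.univ (X ∪ Y) → D.Trail (D.head e) v l ∧
      (D.head e :: l.map D.head).Nodup ∧ ∀ f ∈ l, ReflTransGen (W.Prel p) f e ∨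
      (D.tail f ∈ X ∧ D.head f ∈ X ∧
        ∃ a ∈ D.edgesInto Set.univ X, ReflTransGen (W.Prel p) a e ∧ f ∈ P a) := by
    intro e
    by_cases he : e ∈ D.edgesInto Set.univ (X ∪ Y)
    · obtain ⟨l, h1, h2⟩ := hwalk e (hexit e he).1
      obtain ⟨l', h3, h4, h5⟩ := h1.exists_nodup
      exact ⟨l', fun _ => ⟨h3, h5, fun f hf => h2 f (h4 hf)⟩⟩
    · exact ⟨[], fun h => absurd h he⟩
  choose Q hQ using hpath
  refine ⟨fun h => h.elim hX.1 hY.t_notMem, Or.inl hvX, fun e => e :: Q e, fun e he => ?_,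
    fun e he e' he' hne f hf hf' => hne ?_⟩
  · obtain ⟨h1, h2, h3⟩ := hQ e he
    have ht : D.Trail (D.tail e) v (e :: Q e) := h1.cons rfl
    refine ⟨⟨by simp, rfl, ht.head_getLast _, ht.isChain, ?_, fun _ _ => trivial⟩, rfl⟩
    refine List.nodup_cons.2 ⟨fun h => he.2.1 ?_, h2⟩
    obtain ⟨f, hf, hfe⟩ := List.mem_map.1 h
    rw [← hfe]
    rcases List.mem_cons.1 hf with rfl | hf
    · exact he.2.2
    · rcases h3 f hf with h4 | h4
      exacts [hhead f (hmem h4 (hexit e he).1), Or.inl h4.2.1]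
  · have key : ∀ e ∈ D.edgesInto Set.univ (X ∪ Y), f ∈ e :: Q e → ReflTransGen (W.Prel p) f e ∨
        (D.tail f ∈ X ∧ D.head f ∈ X ∧
        ∃ a ∈ D.edgesInto Set.univ X, ReflTransGen (W.Prel p) a e ∧ f ∈ P a) := by
      intro e he hf
      rcases List.mem_cons.1 hf with rfl | hf
      exacts [Or.inl .refl, (hQ e he).2.2 f hf]
    rcases key e he hf with h1 | ⟨h1, -, a, ha, hae, hfa⟩ <;>
      rcases key e' he' hf' with h2 | ⟨h2, -, b, hb, hbe, hfb⟩
    · exact huniq h1 h2 he he'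
    · exact absurd h2 (hY.sub (hmem h1 (hexit e he).1))
    · exact absurd h1 (hY.sub (hmem h2 (hexit e' he').1))
    · by_cases hab : a = b
      · subst hab
        exact huniq hae hbe he he'
      · exact absurd hfb fun h => hd a ha b hb hab hfa h

theorem trail_of_walk_reversedWeb {M : Set E} (hM : M ⊆ {e | D.tail e ∉ X}) {a : E} {y : V}
    {l : List E} (h : (D.reversedWeb hv hvX).Walk M a y l) : D.Trail y (D.head a) l := by
  induction h with
  | base ha => exact (Trail.nil _).cons (reversedWeb_head_of_notMem (hM ha)).symm
  | @snoc e l h he ih =>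
    refine Trail.cons ?_ (reversedWeb_head_of_notMem (hM he)).symm
    rwa [reversedWeb_tail_of_notMem fun h' => h.ne_s (reversedWeb_tail_of_mem h')] at ih

theorem fillable_of_linked (hr : r ∉ X)
    (h : (D.reversedWeb hv hvX).Linked {e | D.tail e ∉ X}) : D.Fillable Set.univ r X := by
  obtain ⟨P, hP, hd⟩ := h
  have hs : ∀ {e}, e ∈ D.edgesInto Set.univ X →
    (D.reversedWeb hv hvX).tail e = (D.reversedWeb hv hvX).s := fun he =>
      reversedWeb_tail_of_mem he.2.2
  have hpath : ∀ a, ∃ l, a ∈ D.edgesInto Set.univ X →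
      D.IsRXPathIn Set.univ r X l ∧ l.getLast? = some a ∧ l ⊆ P a := by
    intro a
    by_cases ha : a ∈ D.edgesInto Set.univ X
    · have hw := hP a ha.2.1 (hs ha)
      obtain ⟨l, h1, h2, h3⟩ := (trail_of_walk_reversedWeb subset_rfl hw).exists_nodup
      have huniq : ∀ f ∈ l, D.head f ∈ X → f = a := fun f hf hfX =>
        hw.eq_start (h2 hf) (reversedWeb_tail_of_mem hfX)
      have hne : l ≠ [] := by
        rintro rfl
        cases h1
        exact hr ha.2.2
      have hlast := h1.head_getLast hne
      have hlast' : l.getLast hne = a := huniq _ (List.getLast_mem hne) (hlast ▸ ha.2.2)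
      refine ⟨l, fun _ => ⟨⟨hne, h1.tail_head hne, hlast ▸ ha.2.2, fun e he heX => ?_, h1.isChain,
        h3, fun _ _ => trivial⟩, ?_, h2⟩⟩
      · obtain rfl := huniq e (List.mem_of_mem_dropLast he) heX
        have h4 := (List.nodup_cons.1 h3).2.of_map
        rw [← List.dropLast_append_getLast hne, hlast'] at h4
        exact (List.disjoint_of_nodup_append h4) he (by simp)
      · rw [List.getLast?_eq_getLast_of_ne_nil hne, hlast']
    · exact ⟨[], fun h => absurd h ha⟩
  choose Q hQ using hpath
  refine ⟨Q '' D.edgesInto Set.univ X, ?_, ?_, ?_⟩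
  · rintro _ ⟨a, ha, rfl⟩
    exact (hQ a ha).1
  · rintro _ ⟨a, ha, rfl⟩ _ ⟨b, hb, rfl⟩ hab f hfa hfb
    exact hd a ha.2.1 b hb.2.1 (hs ha) (hs hb) (fun h => hab (h ▸ rfl)) ((hQ a ha).2.2 hfa)
      ((hQ b hb).2.2 hfb)
  · ext e
    constructor
    · rintro ⟨_, ⟨a, ha, rfl⟩, h⟩
      rw [(hQ a ha).2.1] at h
      exact Option.some.inj h ▸ ha
    · exact fun he => ⟨_, ⟨e, he, rfl⟩, (hQ e he).2.1⟩

end MultiDigraph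

end

/-- The `⊆`-largest `v`-linked set `X_{v,D}` is fillable in `D`. -/
theorem stmt9 {V E : Type*} (D : MultiDigraph V E) (r : V)
    (hroot : ∀ e, D.head e ≠ r)
    (v : V) (hv : v ≠ r)
    (Xv : Set V)
    (hXv : D.VLinked Set.univ r v Xv)
    (hXvmax : ∀ X : Set V, D.VLinked Set.univ r v X → X ⊆ Xv) :
    D.Fillable Set.univ r Xv := by
  refine MultiDigraph.fillable_of_linked (hv := hv) (hvX := hXv.2.1) hXv.1
    (Web.linked_of_not_hindered ?_)
  rintro ⟨Y, U, p, c, hY, hc, hcs, hcU⟩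
  refine hcU (hY.exit c hc (hcs ▸ hY.s_mem) fun h => hc ?_)
  rw [MultiDigraph.reversedWeb_head_of_notMem hc] at h
  exact hXvmax _ (hXv.union_wave hY) (Or.inr h)
end
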